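/- arXiv:1008.4707 — 3 statements merged into one kernel-verified Lean document; each statement's English description precedes it below -/
import Mathlib

section
/- For every ε > 0 there exists N such that for every n ≥ N, every C⃗4-free orgraph Γ on n vertices whose underlying graph is complete multipartite (i.e., there is a partition of the vertex set such that two distinct vertices are adjacent in the underlying graph if and only if they lie in different parts) satisfies: the number of edges of FDF(Γ) is at least (4/9 − ε)·C(n,3). -/
open Finset

/-- `E` is an orgraph relation: no loops and no pair of opposite edges. -/
def IsOrgraph {V : Type*} (E : V → V → Prop) : Prop :=
  (∀ v, ¬ E v v) ∧ ∀ v w, E v w → ¬ E w v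

/-- `E` contains an induced (oriented) 4-cycle: four distinct vertices whose
induced sub-orgraph has edge set exactly the oriented cycle. -/
def HasInducedC4 {V : Type*} (E : V → V → Prop) : Prop :=
  ∃ v₁ v₂ v₃ v₄ : V,
    v₁ ≠ v₂ ∧ v₁ ≠ v₃ ∧ v₁ ≠ v₄ ∧ v₂ ≠ v₃ ∧ v₂ ≠ v₄ ∧ v₃ ≠ v₄ ∧
    E v₁ v₂ ∧ E v₂ v₃ ∧ E v₃ v₄ ∧ E v₄ v₁ ∧
    ¬ E v₂ v₁ ∧ ¬ E v₃ v₂ ∧ ¬ E v₄ v₃ ∧ ¬ E v₁ v₄ ∧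
    ¬ E v₁ v₃ ∧ ¬ E v₃ v₁ ∧ ¬ E v₂ v₄ ∧ ¬ E v₄ v₂

/-- The triple `{u,v,w}` spans an edge of `FDF(Γ)`: within the triple, some
vertex has out-degree 2, or some vertex has in-degree 0 and out-degree 0. -/
def FDFedge {V : Type*} (E : V → V → Prop) (u v w : V) : Prop :=
  (E u v ∧ E u w) ∨ (E v u ∧ E v w) ∨ (E w u ∧ E w v) ∨
  (¬ E u v ∧ ¬ E v u ∧ ¬ E u w ∧ ¬ E w u) ∨
  (¬ E v u ∧ ¬ E u v ∧ ¬ E v w ∧ ¬ E w v) ∨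
  (¬ E w u ∧ ¬ E u w ∧ ¬ E w v ∧ ¬ E v w)

-- The number of edges of the 3-graph `FDF(Γ)`. 
open Classical in
noncomputable def fdfCount (V : Type*) [Fintype V] (E : V → V → Prop) : ℕ :=
  ((Finset.univ.powersetCard 3).filter (fun s : Finset V =>
    ∃ u v w : V, u ≠ v ∧ u ≠ w ∧ v ≠ w ∧ s = {u, v, w} ∧ FDFedge E u v w)).card

-- The number of edges of the undirected graph underlying the orgraph `E`. 
open Classical in
noncomputable def underlyingEdgeCount (V : Type*) [Fintype V] (E : V → V → Prop) : ℕ :=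
  ((Finset.univ.powersetCard 2).filter (fun s : Finset V =>
    ∃ u v : V, u ≠ v ∧ s = {u, v} ∧ (E u v ∨ E v u))).card


/-! ### Analytic part -/

lemma three_parts (α β γ : ℝ) (hβγ : γ ≤ β) (h1 : α + β + γ = 1)
    (hα : 1 / 3 ≤ α) (hγ : 0 ≤ γ) :
    4 / 9 ≤ α ^ 3 + β ^ 3 + γ ^ 3 + 3 * ((1 - α ^ 2 - β ^ 2 - γ ^ 2) / 2) ^ 2 +
      2 * (max ((1 - α ^ 2 - β ^ 2 - γ ^ 2) / 2 - γ) 0) ^ 3 := by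
  obtain ⟨t, ht⟩ : ∃ t, t = (1 / 3 - γ) / 2 := ⟨_, rfl⟩
  obtain ⟨u, hu⟩ : ∃ u, u = (α - β) / 2 := ⟨_, rfl⟩
  have eγ : γ = 1 / 3 - 2 * t := by linarith
  have eα : α = 1 / 3 + t + u := by linarith
  have eβ : β = 1 / 3 + t - u := by linarith
  have ht0 : 0 ≤ t := by linarith
  have ht6 : t ≤ 1 / 6 := by linarith
  have key : α ^ 3 + β ^ 3 + γ ^ 3 + 3 * ((1 - α ^ 2 - β ^ 2 - γ ^ 2) / 2) ^ 2 =
      4 / 9 - 6 * t ^ 3 + 6 * t * u ^ 2 + 3 * (3 * t ^ 2 + u ^ 2) ^ 2 := by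
    rw [eα, eβ, eγ]; ring
  have key2 : (1 - α ^ 2 - β ^ 2 - γ ^ 2) / 2 - γ = 2 * t - 3 * t ^ 2 - u ^ 2 := by
    rw [eα, eβ, eγ]; ring
  rw [key, key2]
  obtain ⟨v, hv⟩ : ∃ v, v = u ^ 2 := ⟨_, rfl⟩
  have hv0 : 0 ≤ v := by rw [hv]; positivity
  rw [← hv]
  have hm0 : 0 ≤ max (2 * t - 3 * t ^ 2 - v) 0 := le_max_right _ _
  have hm1 : 2 * t - 3 * t ^ 2 - v ≤ max (2 * t - 3 * t ^ 2 - v) 0 := le_max_left _ _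
  by_cases hvt : t ^ 2 ≤ v
  · have : 0 ≤ t * (v - t ^ 2) := mul_nonneg ht0 (by linarith)
    have h3 : 0 ≤ (max (2 * t - 3 * t ^ 2 - v) 0) ^ 3 := by positivity
    nlinarith [sq_nonneg (3 * t ^ 2 + v)]
  · push Not at hvt
    have ht2 : t ^ 2 ≤ t / 6 := by
      have := mul_nonneg ht0 (sub_nonneg.2 ht6)
      linarith
    have hp0 : 0 ≤ 2 * t - 3 * t ^ 2 := by linarith
    have hp1 : 0 ≤ 2 * t - 3 * t ^ 2 - v := by linarith
    have h3 : (2 * t - 3 * t ^ 2 - v) ^ 3 ≤ (max (2 * t - 3 * t ^ 2 - v) 0) ^ 3 :=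
      pow_le_pow_left₀ hp1 hm1 3
    obtain ⟨p, hp⟩ : ∃ p, p = 2 * t - 3 * t ^ 2 := ⟨_, rfl⟩
    rw [← hp] at hp0 hp1 h3 ⊢
    have hp2 : p ^ 2 ≤ t := by
      have h8 : p ≤ 2 * t := by linarith [sq_nonneg t]
      have h9 : p ^ 2 ≤ (2 * t) ^ 2 := pow_le_pow_left₀ hp0 h8 2
      linarith
    -- `(p - v)^3 ≥ p^3 - 3 p^2 v`
    have h4 : p ^ 3 - 3 * p ^ 2 * v ≤ (p - v) ^ 3 := by
      have : 0 ≤ v ^ 2 * (3 * p - v) := mul_nonneg (by positivity) (by linarith)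
      linarith
    have h5 : 3 * p ^ 2 * v ≤ 3 * t * v := by
      have := mul_le_mul_of_nonneg_right hp2 hv0
      linarith
    have h6 : 3 * t ^ 3 ≤ p ^ 3 := by
      have : 3 / 2 * t ≤ p := by linarith
      have h7 : (3 / 2 * t) ^ 3 ≤ p ^ 3 := pow_le_pow_left₀ (by positivity) this 3
      have h8 : 0 ≤ t ^ 3 := by positivity
      have h9 : (3 / 2 * t) ^ 3 = 27 / 8 * t ^ 3 := by ring
      linarith
    linarith [sq_nonneg (3 * t ^ 2 + v)]

lemma jensen_case (α m t r : ℝ) (hm : m = 1 - α) (hα : 1 / 3 ≤ α) (hm0 : 0 ≤ m)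
    (ht : t ≤ m ^ 2 / 2) (hr : m * t - m ^ 3 / 4 ≤ r) :
    4 / 9 ≤ α ^ 3 + r + 3 * ((1 - α ^ 2 - t) / 2) ^ 2 := by
  obtain ⟨e, he⟩ : ∃ e, e = m ^ 2 / 2 - t := ⟨_, rfl⟩
  have e1 : t = m ^ 2 / 2 - e := by linarith
  have he0 : 0 ≤ e := by linarith
  obtain ⟨z, hz⟩ : ∃ z, z = α - 1 / 3 := ⟨_, rfl⟩
  have eα : α = 1 / 3 + z := by linarith
  have em : m = 2 / 3 - z := by linarith
  have hz0 : 0 ≤ z := by linarith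
  have hz1 : z ≤ 2 / 3 := by linarith
  subst e1
  have h1 : 4 / 9 ≤ α ^ 3 + (m ^ 3 / 4) + 3 * ((1 - α ^ 2 - m ^ 2 / 2) / 2) ^ 2 := by
    have : α ^ 3 + (m ^ 3 / 4) + 3 * ((1 - α ^ 2 - m ^ 2 / 2) / 2) ^ 2 =
      4 / 9 + 3 / 4 * z ^ 3 + 3 / 4 * (3 / 2 * z ^ 2) ^ 2 := by
      rw [eα, em]; ring
    rw [this]
    have : 0 ≤ z ^ 3 := by positivity
    nlinarith [sq_nonneg (3 / 2 * z ^ 2)]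
  have h2 : 0 ≤ e * (3 / 2 * (1 - α ^ 2 - m ^ 2 / 2) - m) := by
    apply mul_nonneg he0
    rw [eα, em]; nlinarith
  nlinarith [sq_nonneg e]

set_option maxHeartbeats 1000000 in
open Classical in
lemma main_real {ι : Type*} [Fintype ι] (x : ι → ℝ) (hx : ∀ i, 0 ≤ x i)
    (h1 : ∑ i, x i = 1) (D V η : ℝ) (hD : D = (1 - ∑ i, x i ^ 2) / 2) (hV0 : 0 ≤ V)
    (hη : 0 ≤ η)
    (hV : ∀ i j, i ≠ j → 2 / 3 * (max (D - (1 - x i - x j)) 0) ^ 3 - η ≤ V) :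
    4 / 9 - 3 * η ≤ ∑ i, x i ^ 3 + 3 * D ^ 2 + 3 * V := by
  obtain ⟨s, hs⟩ : ∃ s, s = ∑ i, x i ^ 2 := ⟨_, rfl⟩
  rw [← hs] at hD
  by_cases hs3 : s ≤ 1 / 3
  · have h3 : 2 * s * s - s ^ 2 ≤ ∑ i, x i ^ 3 := by
      have : 0 ≤ ∑ i, x i * (x i - s) ^ 2 :=
        Finset.sum_nonneg fun i _ => mul_nonneg (hx i) (sq_nonneg _)
      have e : ∑ i, x i * (x i - s) ^ 2 = ∑ i, x i ^ 3 - 2 * s * ∑ i, x i ^ 2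
          + s ^ 2 * ∑ i, x i := by
        rw [Finset.mul_sum, Finset.mul_sum, ← Finset.sum_sub_distrib, ← Finset.sum_add_distrib]
        exact Finset.sum_congr rfl fun i _ => by ring
      rw [e, h1, ← hs] at this
      linarith
    subst hD
    nlinarith
  push Not at hs3
  obtain ⟨i, hi⟩ : ∃ i, 1 / 3 ≤ x i := by
    by_contra hcon
    push Not at hcon
    have : s ≤ ∑ i, 1 / 3 * x i := by
      rw [hs]
      exact Finset.sum_le_sum fun i _ => by nlinarith [hx i, hcon i]
    rw [← Finset.mul_sum, h1] at this
    linarith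
  obtain ⟨m, hm⟩ : ∃ m, m = 1 - x i := ⟨_, rfl⟩
  have split (p : ℕ) : ∑ k, x k ^ p = x i ^ p + ∑ k ∈ univ.erase i, x k ^ p :=
    (Finset.add_sum_erase _ _ (Finset.mem_univ i)).symm
  have hm' : ∑ k ∈ univ.erase i, x k = m := by
    have := split 1
    simp only [pow_one, h1] at this
    linarith
  have hm0 : 0 ≤ m := by rw [← hm']; exact Finset.sum_nonneg fun k _ => hx k
  obtain ⟨t, ht⟩ : ∃ t, t = ∑ k ∈ univ.erase i, x k ^ 2 := ⟨_, rfl⟩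
  have hst : s = x i ^ 2 + t := by rw [hs, split 2, ht]
  by_cases htm : t ≤ m ^ 2 / 2
  · have hr : m * t - m ^ 3 / 4 ≤ ∑ k ∈ univ.erase i, x k ^ 3 := by
      have : 0 ≤ ∑ k ∈ univ.erase i, x k * (x k - m / 2) ^ 2 :=
        Finset.sum_nonneg fun i _ => mul_nonneg (hx i) (sq_nonneg _)
      have e : ∑ k ∈ univ.erase i, x k * (x k - m / 2) ^ 2 = ∑ k ∈ univ.erase i, x k ^ 3
          - m * ∑ k ∈ univ.erase i, x k ^ 2 + m ^ 2 / 4 * ∑ k ∈ univ.erase i, x k := by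
        rw [Finset.mul_sum, Finset.mul_sum, ← Finset.sum_sub_distrib, ← Finset.sum_add_distrib]
        exact Finset.sum_congr rfl fun i _ => by ring
      rw [e, hm', ← ht] at this
      linarith
    have := jensen_case (x i) m t _ hm hi hm0 htm hr
    rw [split 3, hD, hst, ← sub_sub]
    linarith
  push Not at htm
  obtain ⟨j, hj, hjm⟩ : ∃ j ∈ univ.erase i, m / 2 ≤ x j := by
    by_contra hcon
    push Not at hcon
    have : t ≤ ∑ k ∈ univ.erase i, m / 2 * x k := by
      rw [ht]
      exact Finset.sum_le_sum fun k hk => by nlinarith [hx k, hcon k hk]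
    rw [← Finset.mul_sum, hm'] at this
    linarith
  have hij : i ≠ j := (Finset.ne_of_mem_erase hj).symm
  have split2 (p : ℕ) : ∑ k ∈ univ.erase i, x k ^ p
      = x j ^ p + ∑ k ∈ (univ.erase i).erase j, x k ^ p :=
    (Finset.add_sum_erase _ _ hj).symm
  obtain ⟨γ, hγ⟩ : ∃ γ, γ = 1 - x i - x j := ⟨_, rfl⟩
  have hγ' : ∑ k ∈ (univ.erase i).erase j, x k = γ := by
    have := split2 1
    simp only [pow_one, hm'] at this
    linarith
  have hγ0 : 0 ≤ γ := by rw [← hγ']; exact Finset.sum_nonneg fun k _ => hx k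
  have hle : ∀ k ∈ (univ.erase i).erase j, x k ≤ γ := fun k hk => by
    rw [← hγ']
    exact Finset.single_le_sum (f := x) (fun k _ => hx k) hk
  obtain ⟨r, hr⟩ : ∃ r, r = ∑ k ∈ (univ.erase i).erase j, x k ^ 2 := ⟨_, rfl⟩
  have hrγ : r ≤ γ ^ 2 := by
    have : r ≤ ∑ k ∈ (univ.erase i).erase j, γ * x k := by
      rw [hr]
      exact Finset.sum_le_sum fun k hk => by nlinarith [hx k, hle k hk]
    rw [← Finset.mul_sum, hγ'] at this
    linarith
  have hr3 : 2 * γ * r - γ ^ 3 ≤ ∑ k ∈ (univ.erase i).erase j, x k ^ 3 := by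
    have : 0 ≤ ∑ k ∈ (univ.erase i).erase j, x k * (x k - γ) ^ 2 :=
      Finset.sum_nonneg fun i _ => mul_nonneg (hx i) (sq_nonneg _)
    have e : ∑ k ∈ (univ.erase i).erase j, x k * (x k - γ) ^ 2
        = ∑ k ∈ (univ.erase i).erase j, x k ^ 3
        - 2 * γ * ∑ k ∈ (univ.erase i).erase j, x k ^ 2
        + γ ^ 2 * ∑ k ∈ (univ.erase i).erase j, x k := by
      rw [Finset.mul_sum, Finset.mul_sum, ← Finset.sum_sub_distrib, ← Finset.sum_add_distrib]
      exact Finset.sum_congr rfl fun i _ => by ring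
    rw [e, hγ', ← hr] at this
    linarith
  have hV' := hV i j hij
  rw [← hγ] at hV'
  have h3 := three_parts (x i) (x j) γ (by linarith) (by linarith) hi hγ0
  obtain ⟨D0, hD0⟩ : ∃ D0, D0 = (1 - x i ^ 2 - x j ^ 2 - γ ^ 2) / 2 := ⟨_, rfl⟩
  rw [← hD0] at h3
  obtain ⟨e, he⟩ : ∃ e, e = γ ^ 2 - r := ⟨_, rfl⟩
  have he0 : 0 ≤ e := by linarith
  have hDe : D = D0 + e / 2 := by
    rw [hD, hst, ht, split2 2, ← hr, hD0, he]; ring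
  have hmono : (max (D0 - γ) 0) ^ 3 ≤ (max (D - γ) 0) ^ 3 :=
    pow_le_pow_left₀ (le_max_right _ _) (max_le_max (by linarith) le_rfl) 3
  have hD0γ : 0 ≤ 3 * D0 - 2 * γ := by
    have : D0 = x i * x j + γ * (1 - γ) := by
      rw [hD0, hγ]; ring
    have h' : γ ≤ 1 / 3 := by linarith
    have := mul_nonneg (hx i) (hx j)
    nlinarith
  have := mul_nonneg he0 hD0γ
  rw [split 3, split2 3, hDe]
  have : r = γ ^ 2 - e := by linarith
  subst this
  linarith [sq_nonneg e]

/-! ### Chain (half-graph) lemma -/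

lemma exists_smallest {V : Type*} [DecidableEq V] (A : Finset V) (f : V → ℕ) (k : ℕ)
    (hk : k ≤ A.card) :
    ∃ A' ⊆ A, A'.card = k ∧ ∀ a ∈ A', ∀ b ∈ A, b ∉ A' → f a ≤ f b := by
  induction k with
  | zero => exact ⟨∅, by simp, by simp, by simp⟩
  | succ k ih =>
    obtain ⟨A', hsub, hcard, hmin⟩ := ih (by omega)
    have hne : (A \ A').Nonempty := by
      rw [← Finset.card_pos, Finset.card_sdiff_of_subset hsub]; omega
    obtain ⟨z, hz, hzmin⟩ := Finset.exists_min_image (A \ A') f hne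
    rw [Finset.mem_sdiff] at hz
    refine ⟨insert z A', ?_, ?_, ?_⟩
    · exact Finset.insert_subset hz.1 hsub
    · rw [Finset.card_insert_of_notMem hz.2, hcard]
    · intro a ha b hb hb'
      rw [Finset.mem_insert, not_or] at hb'
      rcases Finset.mem_insert.1 ha with rfl | ha
      · exact hzmin b (Finset.mem_sdiff.2 ⟨hb, hb'.2⟩)
      · exact hmin a ha b hb hb'.2

open Classical in
lemma half_chain {V : Type*} (E : V → V → Prop) (A B A' : Finset V)
    (hor : ∀ a ∈ A, ∀ b ∈ B, E a b ∨ E b a) (has : ∀ v w, E v w → ¬ E w v)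
    (hch : ∀ a ∈ A, ∀ a' ∈ A, ∀ b ∈ B, ∀ b' ∈ B, ¬ (E a b ∧ E b a' ∧ E a' b' ∧ E b' a))
    (hsub : A' ⊆ A)
    (hmin : ∀ a ∈ A', ∀ a'' ∈ A, a'' ∉ A' → (B.filter (E a)).card ≤ (B.filter (E a'')).card)
    (b : V) (hb : b ∈ B) :
    (A'.filter (fun a => E a b)).card ≤ A'.card - (A.filter (E b)).card := by
  rcases (A'.filter (fun a => E a b)).eq_empty_or_nonempty with h0 | ⟨a0, ha0⟩
  · rw [h0]; simp
  rw [Finset.mem_filter] at ha0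
  have hin : A.filter (E b) ⊆ A' := by
    intro a'' ha''
    rw [Finset.mem_filter] at ha''
    by_contra hnot
    have hle := hmin a0 ha0.1 a'' ha''.1 hnot
    have hb1 : b ∈ B.filter (E a0) := Finset.mem_filter.2 ⟨hb, ha0.2⟩
    have hb2 : b ∉ B.filter (E a'') := fun h => has _ _ ha''.2 (Finset.mem_filter.1 h).2
    have hns : ¬ B.filter (E a'') ⊆ B.filter (E a0) := by
      intro hss
      have := Finset.eq_of_subset_of_card_le hss hle
      rw [this] at hb2
      exact hb2 hb1
    rw [Finset.not_subset] at hns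
    obtain ⟨b', hb'1, hb'2⟩ := hns
    rw [Finset.mem_filter] at hb'1
    have hnE : ¬ E a0 b' := fun h => hb'2 (Finset.mem_filter.2 ⟨hb'1.1, h⟩)
    exact hch a0 (hsub ha0.1) a'' ha''.1 b hb b' hb'1.1
      ⟨ha0.2, ha''.2, hb'1.2, (hor a0 (hsub ha0.1) b' hb'1.1).resolve_left hnE⟩
  have hdis : Disjoint (A'.filter (fun a => E a b)) (A.filter (E b)) := by
    rw [Finset.disjoint_left]
    intro a h1 h2
    exact has _ _ (Finset.mem_filter.1 h1).2 (Finset.mem_filter.1 h2).2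
  have := Finset.card_le_card (Finset.union_subset (Finset.filter_subset (fun a => E a b) A') hin)
  rw [Finset.card_union_of_disjoint hdis] at this
  omega

open Classical in
lemma chain_linear {V : Type*} (E : V → V → Prop) (A B : Finset V)
    (hor : ∀ a ∈ A, ∀ b ∈ B, E a b ∨ E b a) (has : ∀ v w, E v w → ¬ E w v)
    (hch : ∀ a ∈ A, ∀ a' ∈ A, ∀ b ∈ B, ∀ b' ∈ B, ¬ (E a b ∧ E b a' ∧ E a' b' ∧ E b' a))
    (k : ℕ) (hA : k ≤ A.card) (hB : k ≤ B.card) :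
    k ^ 2 ≤ ∑ a ∈ A, (k - (B.filter (E a)).card) + ∑ b ∈ B, (k - (A.filter (E b)).card) := by
  obtain ⟨A', hA', hA'c, hA'm⟩ := exists_smallest A (fun a => (B.filter (E a)).card) k hA
  obtain ⟨B', hB', hB'c, hB'm⟩ := exists_smallest B (fun b => (A.filter (E b)).card) k hB
  have h1 : ∑ b ∈ B', (A'.filter (fun a => E a b)).card
      ≤ ∑ b ∈ B, (k - (A.filter (E b)).card) := by
    refine le_trans (Finset.sum_le_sum fun b hb => ?_) (Finset.sum_le_sum_of_subset hB')
    rw [← hA'c]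
    exact half_chain E A B A' hor has hch hA' hA'm b (hB' hb)
  have h2 : ∑ a ∈ A', (B'.filter (fun b => E b a)).card
      ≤ ∑ a ∈ A, (k - (B.filter (E a)).card) := by
    refine le_trans (Finset.sum_le_sum fun a ha => ?_) (Finset.sum_le_sum_of_subset hA')
    rw [← hB'c]
    refine half_chain E B A B' (fun b hb a ha => (hor a ha b hb).symm) has ?_ hB' hB'm a (hA' ha)
    rintro b hb b' hb' a ha a' ha' ⟨e1, e2, e3, e4⟩
    exact hch a ha a' ha' b' hb' b hb ⟨e2, e3, e4, e1⟩
  have h3 : k ^ 2 ≤ ∑ b ∈ B', (A'.filter (fun a => E a b)).card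
      + ∑ a ∈ A', (B'.filter (fun b => E b a)).card := by
    simp only [Finset.card_filter]
    rw [Finset.sum_comm, ← Finset.sum_add_distrib]
    have : ∀ a ∈ A', k ≤ ∑ b ∈ B', (if E a b then 1 else 0)
        + ∑ b ∈ B', (if E b a then 1 else 0) := by
      intro a ha
      rw [← Finset.sum_add_distrib, ← hB'c, Finset.card_eq_sum_ones]
      refine Finset.sum_le_sum fun b hb => ?_
      rcases hor a (hA' ha) b (hB' hb) with h | h <;> simp [h]
    have := Finset.sum_le_sum this
    rw [Finset.sum_const, hA'c, smul_eq_mul] at this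
    linarith
  omega

lemma step_sq (K f : ℕ) : (K - f) ^ 2 + 2 * (K + 1 - f) ≤ (K + 1 - f) ^ 2 + 1 := by
  rcases Nat.lt_or_ge K f with h | h
  · have h1 : K - f = 0 := by omega
    have h2 : K + 1 - f = 0 := by omega
    simp [h1, h2]
  · obtain ⟨m, rfl⟩ := Nat.exists_eq_add_of_le h
    have h1 : f + m - f = m := by omega
    have h2 : f + m + 1 - f = m + 1 := by omega
    rw [h1, h2]
    nlinarith

open Classical in
lemma chain_sq {V : Type*} (E : V → V → Prop) (A B : Finset V)
    (hor : ∀ a ∈ A, ∀ b ∈ B, E a b ∨ E b a) (has : ∀ v w, E v w → ¬ E w v)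
    (hch : ∀ a ∈ A, ∀ a' ∈ A, ∀ b ∈ B, ∀ b' ∈ B, ¬ (E a b ∧ E b a' ∧ E a' b' ∧ E b' a))
    (k : ℕ) (hA : k ≤ A.card) (hB : k ≤ B.card) :
    2 * k ^ 3 ≤ 3 * (∑ a ∈ A, (k - (B.filter (E a)).card) ^ 2
      + ∑ b ∈ B, (k - (A.filter (E b)).card) ^ 2) + 3 * k * (A.card + B.card) := by
  induction k with
  | zero => simp
  | succ k ih =>
    have ih := ih (by omega) (by omega)
    have hl := chain_linear E A B hor has hch (k + 1) hA hB
    have s1 := Finset.sum_le_sum fun a (_ : a ∈ A) => step_sq k (B.filter (E a)).card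
    have s2 := Finset.sum_le_sum fun b (_ : b ∈ B) => step_sq k (A.filter (E b)).card
    simp only [Finset.sum_add_distrib, ← Finset.mul_sum, Finset.sum_const, smul_eq_mul,
      mul_one] at s1 s2
    nlinarith

/-! ### Counting -/

open Classical in
lemma count_lower {V : Type*} [Fintype V] (E : V → V → Prop) (h : IsOrgraph E)
    (c : V → V) (hc : ∀ u v : V, (E u v ∨ E v u) ↔ c u ≠ c v) :
    ∑ i, ((univ.filter (fun v => c v = i)).card).choose 3
      + ∑ w, ((univ.filter (E w)).card).choose 2 ≤ fdfCount V E := by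
  set P : V → Finset (Finset V) :=
    fun i => (univ.filter (fun v => c v = i)).powersetCard 3 with hP
  set Q : V → Finset (Finset V) :=
    fun w => ((univ.filter (E w)).powersetCard 2).image (insert w) with hQ
  have memP : ∀ i s, s ∈ P i → s.card = 3 ∧ ∀ x ∈ s, c x = i := by
    intro i s hs
    rw [hP, Finset.mem_powersetCard] at hs
    exact ⟨hs.2, fun x hx => (Finset.mem_filter.1 (hs.1 hx)).2⟩
  have memQ : ∀ w s, s ∈ Q w → ∃ x y, x ≠ y ∧ E w x ∧ E w y ∧ s = {w, x, y} := by
    intro w s hs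
    rw [hQ, Finset.mem_image] at hs
    obtain ⟨q, hq, rfl⟩ := hs
    rw [Finset.mem_powersetCard] at hq
    obtain ⟨x, y, hxy, rfl⟩ := Finset.card_eq_two.1 hq.2
    exact ⟨x, y, hxy, (Finset.mem_filter.1 (hq.1 (by simp))).2,
      (Finset.mem_filter.1 (hq.1 (by simp))).2, rfl⟩
  have hne : ∀ {u v}, E u v → u ≠ v := by
    rintro u v huv rfl
    exact h.1 _ huv
  have cardQ : ∀ w, (Q w).card = ((univ.filter (E w)).card).choose 2 := by
    intro w
    rw [hQ]
    dsimp only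
    rw [Finset.card_image_of_injOn, Finset.card_powersetCard]
    intro q hq q' hq' heq
    have hw : ∀ q ∈ (univ.filter (E w)).powersetCard 2, w ∉ q := by
      intro q hq hwq
      rw [Finset.mem_powersetCard] at hq
      exact h.1 w (Finset.mem_filter.1 (hq.1 hwq)).2
    have h1 := hw q hq
    have h2 := hw q' hq'
    rw [← Finset.erase_insert h1, ← Finset.erase_insert h2]
    exact congrArg (fun s => Finset.erase s w) heq
  have disjP : ∀ i ∈ (univ : Finset V), ∀ j ∈ (univ : Finset V), i ≠ j →
      Disjoint (P i) (P j) := by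
    intro i _ j _ hij
    rw [Finset.disjoint_left]
    intro s h1 h2
    obtain ⟨h3, h1⟩ := memP i s h1
    obtain ⟨_, h2⟩ := memP j s h2
    obtain ⟨x, hx⟩ := Finset.card_pos.1 (by omega : 0 < s.card)
    exact hij ((h1 x hx).symm.trans (h2 x hx))
  have disjQ : ∀ i ∈ (univ : Finset V), ∀ j ∈ (univ : Finset V), i ≠ j →
      Disjoint (Q i) (Q j) := by
    intro w _ w' _ hij
    rw [Finset.disjoint_left]
    intro s h1 h2
    obtain ⟨x, y, hxy, hx, hy, rfl⟩ := memQ w s h1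
    obtain ⟨x', y', hxy', hx', hy', heq⟩ := memQ w' _ h2
    have m1 : w ∈ ({w', x', y'} : Finset V) := by rw [← heq]; simp
    have m2 : w' ∈ ({w, x, y} : Finset V) := by rw [heq]; simp
    have e1 : E w' w := by
      simp only [Finset.mem_insert, Finset.mem_singleton] at m1
      rcases m1 with rfl | rfl | rfl
      · exact absurd rfl hij
      · exact hx'
      · exact hy'
    have e2 : E w w' := by
      simp only [Finset.mem_insert, Finset.mem_singleton] at m2
      rcases m2 with rfl | rfl | rfl
      · exact absurd rfl hij
      · exact hx
      · exact hy
    exact h.2 _ _ e1 e2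
  have disjPQ : Disjoint (univ.biUnion P) (univ.biUnion Q) := by
    rw [Finset.disjoint_left]
    intro s h1 h2
    rw [Finset.mem_biUnion] at h1 h2
    obtain ⟨i, _, h1⟩ := h1
    obtain ⟨w, _, h2⟩ := h2
    obtain ⟨x, y, hxy, hx, hy, rfl⟩ := memQ w s h2
    obtain ⟨_, h1⟩ := memP i _ h1
    exact (hc w x).1 (Or.inl hx) ((h1 w (by simp)).trans (h1 x (by simp)).symm)
  have e1 : ∑ i, ((univ.filter (fun v => c v = i)).card).choose 3 = (univ.biUnion P).card := by
    rw [Finset.card_biUnion disjP]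
    exact Finset.sum_congr rfl fun i _ => (Finset.card_powersetCard _ _).symm
  have e2 : ∑ w, ((univ.filter (E w)).card).choose 2 = (univ.biUnion Q).card := by
    rw [Finset.card_biUnion disjQ]
    exact Finset.sum_congr rfl fun i _ => (cardQ i).symm
  rw [e1, e2, ← Finset.card_union_of_disjoint disjPQ]
  unfold fdfCount
  apply Finset.card_le_card
  intro s hs
  rw [Finset.mem_filter, Finset.mem_powersetCard]
  rcases Finset.mem_union.1 hs with hs | hs
  · obtain ⟨i, _, hs⟩ := Finset.mem_biUnion.1 hs
    obtain ⟨h3, hi⟩ := memP i s hs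
    refine ⟨⟨Finset.subset_univ _, h3⟩, ?_⟩
    obtain ⟨u, v, w, huv, huw, hvw, rfl⟩ := Finset.card_eq_three.1 h3
    refine ⟨u, v, w, huv, huw, hvw, rfl, ?_⟩
    have e1 := (hc u v).not.2 (not_not.2 ((hi u (by simp)).trans (hi v (by simp)).symm))
    have e2 := (hc u w).not.2 (not_not.2 ((hi u (by simp)).trans (hi w (by simp)).symm))
    unfold FDFedge
    tauto
  · obtain ⟨w, _, hs⟩ := Finset.mem_biUnion.1 hs
    obtain ⟨x, y, hxy, hx, hy, rfl⟩ := memQ w s hs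
    exact ⟨⟨Finset.subset_univ _, Finset.card_eq_three.2 ⟨w, x, y, hne hx, hne hy, hxy, rfl⟩⟩,
      w, x, y, hne hx, hne hy, hxy, rfl, Or.inl ⟨hx, hy⟩⟩

lemma choose_two_real (d : ℕ) : 2 * ((d.choose 2 : ℕ) : ℝ) = (d : ℝ) ^ 2 - d := by
  rw [Nat.cast_choose_two]; ring

lemma choose_three_real (d : ℕ) : (d : ℝ) ^ 3 - 3 * (d : ℝ) ^ 2 ≤ 6 * ((d.choose 3 : ℕ) : ℝ) := by
  induction d with
  | zero => simp
  | succ d ih =>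
    rw [Nat.choose_succ_succ' d 2]
    have := choose_two_real d
    push_cast
    nlinarith

lemma choose_three_le (d : ℕ) : 6 * ((d.choose 3 : ℕ) : ℝ) ≤ (d : ℝ) ^ 3 := by
  induction d with
  | zero => simp
  | succ d ih =>
    rw [Nat.choose_succ_succ' d 2]
    have := choose_two_real d
    have : (0 : ℝ) ≤ d := Nat.cast_nonneg d
    push_cast
    nlinarith

set_option maxHeartbeats 1000000 in
open Classical in
lemma final_bound {V : Type*} [Fintype V] [Nonempty V] (E : V → V → Prop) (h : IsOrgraph E)
    (h4 : ¬ HasInducedC4 E)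
    (c : V → V) (hc : ∀ u v : V, (E u v ∨ E v u) ↔ c u ≠ c v) :
    4 / 9 * (Fintype.card V : ℝ) ^ 3 - 15 * (Fintype.card V : ℝ) ^ 2
      ≤ 6 * (fdfCount V E : ℝ) := by
  obtain ⟨N, hN⟩ : ∃ N : ℝ, N = (Fintype.card V : ℝ) := ⟨_, rfl⟩
  have hNpos : 0 < N := by rw [hN]; exact_mod_cast Fintype.card_pos
  have hNne : N ≠ 0 := hNpos.ne'
  rw [← hN]
  have hcount := count_lower E h c hc
  set a : V → ℕ := fun i => (univ.filter (fun v => c v = i)).card with ha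
  set d : V → ℕ := fun w => (univ.filter (E w)).card with hd
  have hcount' : (∑ i, ((a i).choose 3 : ℝ)) + ∑ w, ((d w).choose 2 : ℝ) ≤ (fdfCount V E : ℝ) := by
    exact_mod_cast hcount
  clear_value a d
  clear hcount
  -- sums
  have hsa : ∑ i, (a i : ℝ) = N := by
    rw [hN, ← Nat.cast_sum]
    congr 1
    rw [ha]
    exact (Finset.card_eq_sum_card_fiberwise (s := (univ : Finset V)) (t := univ) (f := c)
      (fun x _ => by simp)).symm
  have hsd : 2 * ∑ w, (d w : ℝ) = N ^ 2 - ∑ i, (a i : ℝ) ^ 2 := by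
    have e1 : ∑ w, (d w : ℝ) = ∑ w, ∑ v, (if E w v then (1 : ℝ) else 0) := by
      refine Finset.sum_congr rfl fun w _ => ?_
      rw [hd]; simp
    have e2 : ∑ w, (d w : ℝ) = ∑ w, ∑ v, (if E v w then (1 : ℝ) else 0) := by
      rw [e1, Finset.sum_comm]
    have e3 : ∑ i, (a i : ℝ) ^ 2 = ∑ w, ∑ v, (if c w = c v then (1 : ℝ) else 0) := by
      have : ∀ w, ∑ v, (if c w = c v then (1 : ℝ) else 0) = a (c w) := by
        intro w
        rw [ha]
        simp [eq_comm]
      simp only [this]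
      rw [← Finset.sum_fiberwise univ c (fun w => (a (c w) : ℝ))]
      refine Finset.sum_congr rfl fun i _ => ?_
      rw [Finset.sum_congr rfl (g := fun _ => (a i : ℝ))
        (fun w hw => by rw [(Finset.mem_filter.1 hw).2])]
      have hai : (univ.filter (fun v => c v = i)).card = a i := by rw [ha]
      rw [Finset.sum_const, nsmul_eq_mul, sq, hai]
    have e4 : N ^ 2 = ∑ w : V, ∑ v : V, (1 : ℝ) := by
      simp [hN, sq]
    have e5 : ∑ w, (d w : ℝ) + ∑ w, (d w : ℝ) + ∑ i, (a i : ℝ) ^ 2 = N ^ 2 := by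
      conv_lhs => rw [e3]; arg 1; rw [e1]; arg 2; rw [← e1, e2]
      rw [e4]
      simp only [← Finset.sum_add_distrib]
      refine Finset.sum_congr rfl fun w _ => Finset.sum_congr rfl fun v _ => ?_
      have hcv := hc w v
      by_cases hw : E w v
      · have := h.2 _ _ hw
        have h' := hcv.1 (Or.inl hw)
        simp [hw, this, h']
      · by_cases hv : E v w
        · have h' := hcv.1 (Or.inr hv)
          simp [hw, hv, h']
        · have h' : c w = c v := by
            by_contra hh
            rcases hcv.2 hh with h1 | h1
            · exact hw h1
            · exact hv h1
          simp [hw, hv, h']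
    linarith
  obtain ⟨s2, hs2⟩ : ∃ s2, s2 = ∑ i, (a i : ℝ) ^ 2 := ⟨_, rfl⟩
  have hs20 : 0 ≤ s2 := by rw [hs2]; positivity
  obtain ⟨D, hD⟩ : ∃ D, D = (1 - ∑ i, ((a i : ℝ) / N) ^ 2) / 2 := ⟨_, rfl⟩
  have hDs : ∑ i, ((a i : ℝ) / N) ^ 2 = s2 / N ^ 2 := by
    rw [hs2, Finset.sum_div]
    exact Finset.sum_congr rfl fun i _ => by rw [div_pow]
  have hsdD : ∑ w, (d w : ℝ) = N ^ 2 * D := by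
    rw [hD, hDs]
    field_simp
    rw [hs2]; linarith
  obtain ⟨W, hW⟩ : ∃ W, W = ∑ w, ((d w : ℝ) - N * D) ^ 2 := ⟨_, rfl⟩
  have hW0 : 0 ≤ W := by rw [hW]; positivity
  have hWd : ∑ w, (d w : ℝ) ^ 2 = N ^ 3 * D ^ 2 + W := by
    have : W = ∑ w, (d w : ℝ) ^ 2 - 2 * (N * D) * ∑ w, (d w : ℝ) + N * (N * D) ^ 2 := by
      rw [hW, Finset.mul_sum]
      have : N * (N * D) ^ 2 = ∑ w : V, (N * D) ^ 2 := by
        rw [Finset.sum_const, nsmul_eq_mul, Finset.card_univ, ← hN]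
      rw [this, ← Finset.sum_sub_distrib, ← Finset.sum_add_distrib]
      exact Finset.sum_congr rfl fun w _ => by ring
    rw [this, hsdD]; ring
  have hDle : D ≤ 1 / 2 := by
    rw [hD]
    have : 0 ≤ ∑ i, ((a i : ℝ) / N) ^ 2 := by positivity
    linarith
  have haN : ∀ i, (a i : ℝ) / N ≤ 1 := by
    intro i
    rw [div_le_one hNpos, ← hsa]
    exact Finset.single_le_sum (f := fun i => (a i : ℝ)) (fun k _ => by positivity)
      (Finset.mem_univ i)
  have hDi : ∀ i, D ≤ 1 - (a i : ℝ) / N := by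
    intro i
    have : ((a i : ℝ) / N) ^ 2 ≤ ∑ i, ((a i : ℝ) / N) ^ 2 :=
      Finset.single_le_sum (f := fun i => ((a i : ℝ) / N) ^ 2) (fun k _ => by positivity)
      (Finset.mem_univ i)
    nlinarith [sq_nonneg (1 - (a i : ℝ) / N)]
  have main := main_real (fun i => (a i : ℝ) / N) (fun i => by positivity)
    (by rw [← Finset.sum_div, hsa, div_self hNne]) D (W / N ^ 3) (3 / N) hD
    (by positivity) (by positivity) ?_
  · have e : ∑ i, ((a i : ℝ) / N) ^ 3 = (∑ i, (a i : ℝ) ^ 3) / N ^ 3 := by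
      rw [Finset.sum_div]
      exact Finset.sum_congr rfl fun i _ => by rw [div_pow]
    simp only [e] at main
    have main2 : 4 / 9 * N ^ 3 - 9 * N ^ 2 ≤ ∑ i, (a i : ℝ) ^ 3 + 3 * N ^ 3 * D ^ 2 + 3 * W := by
      have := mul_le_mul_of_nonneg_right main (by positivity : 0 ≤ N ^ 3)
      have l : (4 / 9 - 3 * (3 / N)) * N ^ 3 = 4 / 9 * N ^ 3 - 9 * N ^ 2 := by
        field_simp
        norm_num
      have r : ((∑ i, (a i : ℝ) ^ 3) / N ^ 3 + 3 * D ^ 2 + 3 * (W / N ^ 3)) * N ^ 3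
          = ∑ i, (a i : ℝ) ^ 3 + 3 * N ^ 3 * D ^ 2 + 3 * W := by
        field_simp
      rw [l, r] at this
      exact this
    have c3 : ∑ i, (a i : ℝ) ^ 3 - 3 * s2 ≤ 6 * ∑ i, ((a i).choose 3 : ℝ) := by
      rw [hs2, Finset.mul_sum, Finset.mul_sum, ← Finset.sum_sub_distrib]
      exact Finset.sum_le_sum fun i _ => choose_three_real (a i)
    have c2 : 2 * ∑ w, ((d w).choose 2 : ℝ) = ∑ w, (d w : ℝ) ^ 2 - ∑ w, (d w : ℝ) := by
      rw [Finset.mul_sum, ← Finset.sum_sub_distrib]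
      exact Finset.sum_congr rfl fun i _ => choose_two_real (d i)
    have hd0 : 0 ≤ ∑ w, (d w : ℝ) := by positivity
    rw [← hs2] at hsd
    linarith
  · intro i j hij
    obtain ⟨σ, hσ⟩ : ∃ σ, σ = 1 - (a i : ℝ) / N - (a j : ℝ) / N := ⟨_, rfl⟩
    change 2 / 3 * (max (D - (1 - (a i : ℝ) / N - (a j : ℝ) / N)) 0) ^ 3 - 3 / N ≤ W / N ^ 3
    rw [← hσ]
    set A : Finset V := univ.filter (fun v => c v = i) with hA
    set B : Finset V := univ.filter (fun v => c v = j) with hB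
    have hAc : A.card = a i := by rw [ha]
    have hBc : B.card = a j := by rw [ha]
    have mA : ∀ v ∈ A, c v = i := fun v hv => (Finset.mem_filter.1 hv).2
    have mB : ∀ v ∈ B, c v = j := fun v hv => (Finset.mem_filter.1 hv).2
    have hABd : Disjoint A B := by
      rw [Finset.disjoint_left]
      intro v h1 h2
      exact hij ((mA v h1).symm.trans (mB v h2))
    have hABN : (a i : ℝ) + a j ≤ N := by
      rw [hN, ← hAc, ← hBc]
      have := Finset.card_le_univ (A ∪ B)
      rw [Finset.card_union_of_disjoint hABd] at this
      exact_mod_cast this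
    obtain ⟨m, hm⟩ : ∃ m, m = max (D - σ) 0 := ⟨_, rfl⟩
    have hm0 : 0 ≤ m := by rw [hm]; exact le_max_right _ _
    have hσ0 : 0 ≤ σ := by
      have : ((a i : ℝ) + a j) / N ≤ 1 := by rw [div_le_one hNpos]; exact hABN
      rw [add_div] at this
      linarith
    have hm1 : m ≤ 1 := by rw [hm]; exact max_le (by linarith) (by norm_num)
    have hmi : m ≤ (a i : ℝ) / N := by
      rw [hm]
      exact max_le (by linarith [hDi j]) (by positivity)
    have hmj : m ≤ (a j : ℝ) / N := by
      rw [hm]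
      exact max_le (by linarith [hDi i]) (by positivity)
    obtain ⟨k, hk⟩ : ∃ k, k = ⌊N * m⌋₊ := ⟨_, rfl⟩
    have hkle : (k : ℝ) ≤ N * m := by rw [hk]; exact Nat.floor_le (by positivity)
    have hkge : N * m < k + 1 := by rw [hk]; exact Nat.lt_floor_add_one _
    have hki : k ≤ A.card := by
      rw [hAc]
      have : N * m ≤ a i := by rw [le_div_iff₀ hNpos] at hmi; linarith
      exact_mod_cast hkle.trans this
    have hkj : k ≤ B.card := by
      rw [hBc]
      have : N * m ≤ a j := by rw [le_div_iff₀ hNpos] at hmj; linarith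
      exact_mod_cast hkle.trans this
    have hchain := chain_sq E A B
      (fun x hx y hy => (hc x y).2 (by rw [mA x hx, mB y hy]; exact hij)) h.2
      (by
        rintro x hx x' hx' y hy y' hy' ⟨e1, e2, e3, e4⟩
        have hne : ∀ {u v}, E u v → u ≠ v := by
          rintro u v huv rfl
          exact h.1 _ huv
        have nx : ¬ (E x x' ∨ E x' x) := by
          rw [hc, not_not, mA x hx, mA x' hx']
        have ny : ¬ (E y y' ∨ E y' y) := by
          rw [hc, not_not, mB y hy, mB y' hy']
        rw [not_or] at nx ny
        refine h4 ⟨x, y, x', y', hne e1, ?_, (hne e4).symm, hne e2, ?_, hne e3, e1, e2, e3, e4,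
          h.2 _ _ e1, h.2 _ _ e2, h.2 _ _ e3, h.2 _ _ e4, nx.1, nx.2, ny.1, ny.2⟩
        · rintro rfl
          exact h.2 _ _ e1 e2
        · rintro rfl
          exact h.2 _ _ e2 e3)
      k hki hkj
    -- deviation bound
    have dev : ∀ X Y : Finset V, Disjoint X Y → (X.card : ℝ) + Y.card = N * (1 - σ) →
        (∀ x ∈ X, ∀ y ∈ X, ¬ E x y) → ∀ x ∈ X,
        (((k - (Y.filter (E x)).card) ^ 2 : ℕ) : ℝ) ≤ ((d x : ℝ) - N * D) ^ 2 := by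
      intro X Y hXY hXYc hX x hx
      rcases Nat.lt_or_ge k (Y.filter (E x)).card with hlt | hge
      · have : k - (Y.filter (E x)).card = 0 := by omega
        rw [this]
        simp only [ne_eq, OfNat.ofNat_ne_zero, not_false_eq_true, zero_pow, Nat.cast_zero]
        positivity
      · have hdx : (d x : ℝ) ≤ (Y.filter (E x)).card + N * σ := by
          have hsub : univ.filter (E x) ⊆ Y.filter (E x) ∪ (univ \ (X ∪ Y)) := by
            intro v hv
            have hv := (Finset.mem_filter.1 hv).2
            have hvX : v ∉ X := fun hvX => hX x hx v hvX hv
            by_cases hvY : v ∈ Y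
            · exact Finset.mem_union_left _ (Finset.mem_filter.2 ⟨hvY, hv⟩)
            · refine Finset.mem_union_right _ ?_
              simp [hvX, hvY]
          have h1 := (Finset.card_le_card hsub).trans (Finset.card_union_le _ _)
          have hdx' : d x = (univ.filter (E x)).card := by rw [hd]
          rw [← hdx'] at h1
          have h2 : (univ \ (X ∪ Y)).card + (X.card + Y.card) = Fintype.card V := by
            rw [← Finset.card_union_of_disjoint hXY]
            exact Finset.card_sdiff_add_card_eq_card (Finset.subset_univ _)
          have h1' : (d x : ℝ) ≤ (Y.filter (E x)).card + ((univ \ (X ∪ Y)).card : ℝ) := by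
            exact_mod_cast h1
          have h2' : ((univ \ (X ∪ Y)).card : ℝ) + (X.card + Y.card) = N := by
            rw [hN]; exact_mod_cast h2
          linarith
        rcases Nat.eq_zero_or_pos k with hk0 | hkpos
        · have : k - (Y.filter (E x)).card = 0 := by omega
          rw [this]
          simp only [ne_eq, OfNat.ofNat_ne_zero, not_false_eq_true, zero_pow, Nat.cast_zero]
          positivity
        · have hmpos : 0 < m := by
            by_contra hcon
            have : m = 0 := le_antisymm (not_lt.1 hcon) hm0
            rw [this, mul_zero] at hkle
            have : (0 : ℝ) < k := by exact_mod_cast hkpos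
            linarith
          have hmD : m = D - σ := by
            rcases le_total (D - σ) 0 with hh | hh
            · rw [max_eq_right hh] at hm
              linarith
            · rw [max_eq_left hh] at hm
              exact hm
          rw [Nat.cast_pow, Nat.cast_sub hge]
          have h0 : (0 : ℝ) ≤ k - ((Y.filter (E x)).card : ℝ) := by
            rw [sub_nonneg]; exact_mod_cast hge
          have h1 : (k : ℝ) - ((Y.filter (E x)).card : ℝ) ≤ N * D - d x := by
            rw [hmD] at hkle
            linarith
          have := pow_le_pow_left₀ h0 h1 2
          calc _ ≤ _ := this
            _ = _ := by ring
    have hcardAB : (A.card : ℝ) + B.card = N * (1 - σ) := by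
      rw [hσ, hAc, hBc]
      field_simp
      ring
    have dA := dev A B hABd hcardAB (fun x hx y hy he =>
      (hc x y).1 (Or.inl he) ((mA x hx).trans (mA y hy).symm))
    have dB := dev B A hABd.symm (by linarith) (fun x hx y hy he =>
      (hc x y).1 (Or.inl he) ((mB x hx).trans (mB y hy).symm))
    have hsum : (∑ x ∈ A, (((k - (B.filter (E x)).card) ^ 2 : ℕ) : ℝ))
        + ∑ x ∈ B, (((k - (A.filter (E x)).card) ^ 2 : ℕ) : ℝ) ≤ W := by
      refine (add_le_add (Finset.sum_le_sum dA) (Finset.sum_le_sum dB)).trans ?_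
      rw [← Finset.sum_union hABd, hW]
      exact Finset.sum_le_sum_of_subset_of_nonneg (Finset.subset_univ _)
        (fun _ _ _ => sq_nonneg _)
    have hchain' : 2 * (k : ℝ) ^ 3 ≤ 3 * W + 3 * k * ((a i : ℝ) + a j) := by
      have h1 : 2 * (k : ℝ) ^ 3 ≤ 3 * ((∑ x ∈ A, (((k - (B.filter (E x)).card) ^ 2 : ℕ) : ℝ))
        + ∑ x ∈ B, (((k - (A.filter (E x)).card) ^ 2 : ℕ) : ℝ)) + 3 * k * ((a i : ℝ) + a j) := by
        rw [hAc, hBc] at hchain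
        exact_mod_cast hchain
      linarith
    rw [← hm]
    have hk0 : (0 : ℝ) ≤ k := Nat.cast_nonneg k
    have hNm : N * m ≤ N := by nlinarith
    have hkN : (k : ℝ) * ((a i : ℝ) + a j) ≤ N * N :=
      mul_le_mul (hkle.trans hNm) hABN (by positivity) hNpos.le
    have hcube : (N * m) ^ 3 - 3 * (N * m) ^ 2 ≤ (k : ℝ) ^ 3 := by
      obtain ⟨z, hz⟩ : ∃ z, z = N * m := ⟨_, rfl⟩
      rw [← hz] at hkge ⊢
      have hz0 : 0 ≤ z := by rw [hz]; positivity
      rcases le_total z 1 with h1 | h1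
      · have : 0 ≤ (k : ℝ) ^ 3 := by positivity
        have : z ^ 2 * (z - 3) ≤ 0 := mul_nonpos_of_nonneg_of_nonpos (sq_nonneg _) (by linarith)
        linarith
      · have := pow_le_pow_left₀ (by linarith : 0 ≤ z - 1) (by linarith : z - 1 ≤ k) 3
        linarith
    have hsq : (N * m) ^ 2 ≤ N ^ 2 := pow_le_pow_left₀ (by positivity) hNm 2
    have fin : 2 / 3 * (N * m) ^ 3 - 3 * N ^ 2 ≤ W := by linarith
    rw [le_div_iff₀ (by positivity)]
    have : (2 / 3 * m ^ 3 - 3 / N) * N ^ 3 = 2 / 3 * (N * m) ^ 3 - 3 * N ^ 2 := by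
      field_simp
    rw [this]
    exact fin

/-- For every ε > 0 there is N such that for all n ≥ N, every C⃗₄-free orgraph
on n vertices whose underlying graph is complete multipartite has at least
(4/9 − ε)·C(n,3) edges in FDF(Γ). -/
theorem stmt0 :
    ∀ ε : ℝ, ε > 0 → ∃ N : ℕ, ∀ n : ℕ, N ≤ n → ∀ E : Fin n → Fin n → Prop,
      IsOrgraph E → ¬ HasInducedC4 E →
      (∃ c : Fin n → Fin n, ∀ u v : Fin n, (E u v ∨ E v u) ↔ c u ≠ c v) →
      ((4 : ℝ) / 9 - ε) * (n.choose 3 : ℝ) ≤ (fdfCount (Fin n) E : ℝ) := by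
  intro ε hε
  obtain ⟨M, hM⟩ := exists_nat_gt (15 / ε)
  refine ⟨M + 1, fun n hn E h h4 ⟨c, hc⟩ => ?_⟩
  have : Nonempty (Fin n) := ⟨⟨0, by omega⟩⟩
  have hb := final_bound E h h4 c hc
  rw [Fintype.card_fin] at hb
  have hc3 := choose_three_le n
  have hc0 : (0 : ℝ) ≤ (n.choose 3 : ℝ) := Nat.cast_nonneg _
  have hf0 : (0 : ℝ) ≤ (fdfCount (Fin n) E : ℝ) := Nat.cast_nonneg _
  rcases le_total ((4 : ℝ) / 9 - ε) 0 with hneg | hpos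
  · exact (mul_nonpos_of_nonpos_of_nonneg hneg hc0).trans hf0
  · have hnM : (M : ℝ) ≤ n := by exact_mod_cast (by omega : M ≤ n)
    have h15 : 15 ≤ ε * n := by
      rw [div_lt_iff₀ hε] at hM
      nlinarith
    have h1 := mul_le_mul_of_nonneg_left hc3 hpos
    have h2 := mul_le_mul_of_nonneg_right h15 (sq_nonneg (n : ℝ))
    have h3 : ε * (n : ℝ) * (n : ℝ) ^ 2 = ε * (n : ℝ) ^ 3 := by ring
    linarith
end

section
/- There exists an absolute constant ε₀ > 0 such that for every ε > 0 there exists N with: for every n ≥ N, every C⃗4-free orgraph Γ on n vertices whose underlying graph has edge density at least 2/3 − ε₀ satisfies: the number of edges of FDF(Γ) is at least (4/9 − ε)·C(n,3). -/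
open Finset

section basics
open Classical

/-- Indicator of an oriented edge. -/
noncomputable def oo {V : Type*} (E : V → V → Prop) (x y : V) : ℝ := if E x y then 1 else 0

/-- Indicator of non-adjacency (equal to 1 on the diagonal). -/
noncomputable def hh {V : Type*} (E : V → V → Prop) (x y : V) : ℝ :=
  if E x y ∨ E y x then 0 else 1

/-- The polynomial version of the FDF indicator. -/
noncomputable def ph {V : Type*} (E : V → V → Prop) (x y z : V) : ℝ :=
  oo E x y * oo E x z + oo E y x * oo E y z + oo E z x * oo E z y
  + hh E x y * hh E x z + hh E y x * hh E y z + hh E z x * hh E z y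
  - 2 * (hh E x y * hh E y z * hh E z x)

/-- Out-degree. -/
noncomputable def dd {V : Type*} [Fintype V] (E : V → V → Prop) (x : V) : ℝ := ∑ y, oo E x y

/-- Number of non-neighbours (including the vertex itself). -/
noncomputable def pp {V : Type*} [Fintype V] (E : V → V → Prop) (x : V) : ℝ := ∑ y, hh E x y

/-- Ordered triangles of the complement. -/
noncomputable def tt (V : Type*) [Fintype V] (E : V → V → Prop) : ℝ :=
  ∑ x : V, ∑ y : V, ∑ z : V, hh E x y * hh E y z * hh E z x

variable {V : Type*} {E : V → V → Prop}

lemma hh_symm (x y : V) : hh E x y = hh E y x := by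
  unfold hh; simp only [or_comm]

lemma hh_self (hE : IsOrgraph E) (x : V) : hh E x x = 1 := by
  unfold hh; simp [hE.1 x]

lemma oo_self (hE : IsOrgraph E) (x : V) : oo E x x = 0 := by
  unfold oo; simp [hE.1 x]

lemma hh_cases (x y : V) : hh E x y = 0 ∨ hh E x y = 1 := by
  unfold hh; split_ifs <;> simp

lemma oo_cases (x y : V) : oo E x y = 0 ∨ oo E x y = 1 := by
  unfold oo; split_ifs <;> simp

lemma hh_nonneg (x y : V) : 0 ≤ hh E x y := by
  rcases hh_cases (E := E) x y with h | h <;> simp [h]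

lemma hh_le_one (x y : V) : hh E x y ≤ 1 := by
  rcases hh_cases (E := E) x y with h | h <;> simp [h]

lemma oo_nonneg (x y : V) : 0 ≤ oo E x y := by
  rcases oo_cases (E := E) x y with h | h <;> simp [h]

lemma oo_le_one (x y : V) : oo E x y ≤ 1 := by
  rcases oo_cases (E := E) x y with h | h <;> simp [h]

lemma oo_sum (hE : IsOrgraph E) (x y : V) : oo E x y + oo E y x + hh E x y = 1 := by
  unfold oo hh
  have := hE.2 x y
  by_cases h1 : E x y <;> by_cases h2 : E y x <;> simp_all

lemma tri_cases (hE : IsOrgraph E) (x y : V) :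
    (oo E x y = 1 ∧ oo E y x = 0 ∧ hh E x y = 0 ∧ hh E y x = 0) ∨
    (oo E x y = 0 ∧ oo E y x = 1 ∧ hh E x y = 0 ∧ hh E y x = 0) ∨
    (oo E x y = 0 ∧ oo E y x = 0 ∧ hh E x y = 1 ∧ hh E y x = 1) := by
  have h := oo_sum hE x y
  have hs := hh_symm (E := E) x y
  rcases oo_cases (E := E) x y with h1 | h1 <;> rcases oo_cases (E := E) y x with h2 | h2 <;>
  rcases hh_cases (E := E) x y with h3 | h3 <;> rw [h1, h2, h3] at h <;> norm_num at h <;>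
  rw [h3] at hs <;> simp [h1, h2, h3, ← hs]

lemma ph_bounds (hE : IsOrgraph E) (x y z : V) : 0 ≤ ph E x y z ∧ ph E x y z ≤ 1 := by
  unfold ph
  rcases tri_cases hE x y with ⟨h1, h2, h3, h4⟩ | ⟨h1, h2, h3, h4⟩ | ⟨h1, h2, h3, h4⟩ <;>
  rcases tri_cases hE x z with ⟨k1, k2, k3, k4⟩ | ⟨k1, k2, k3, k4⟩ | ⟨k1, k2, k3, k4⟩ <;>
  rcases tri_cases hE y z with ⟨l1, l2, l3, l4⟩ | ⟨l1, l2, l3, l4⟩ | ⟨l1, l2, l3, l4⟩ <;>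
  rw [h1, h2, h3, h4, k1, k2, k3, k4, l1, l2, l3, l4] <;> norm_num

lemma ph_eq_zero (hE : IsOrgraph E) (x y z : V) (hn : ¬ FDFedge E x y z) : ph E x y z = 0 := by
  unfold FDFedge at hn
  have e1 := hE.2 x y
  have e2 := hE.2 x z
  have e3 := hE.2 y z
  unfold ph oo hh
  by_cases h1 : E x y <;> by_cases h2 : E y x <;> by_cases h3 : E x z <;> by_cases h4 : E z x <;>
  by_cases h5 : E y z <;> by_cases h6 : E z y <;> simp_all

variable [Fintype V]

lemma sum_ph (E : V → V → Prop) : ∑ x, ∑ y, ∑ z, ph E x y z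
    = 3 * ∑ x, dd E x ^ 2 + 3 * ∑ x, pp E x ^ 2 - 2 * tt V E := by
  have gen : ∀ f : V → V → ℝ, ∑ x, (∑ y, f x y) ^ 2 = ∑ x, ∑ y, ∑ z, f x y * f x z := by
    intro f
    refine Finset.sum_congr rfl fun x _ => ?_
    rw [sq, Finset.sum_mul_sum]
  have g2 : ∀ f : V → V → ℝ, ∑ x, ∑ y, ∑ z, f y x * f y z = ∑ x, (∑ y, f x y) ^ 2 := by
    intro f
    rw [gen, Finset.sum_comm]
  have g3 : ∀ f : V → V → ℝ, ∑ x, ∑ y, ∑ z, f z x * f z y = ∑ x, (∑ y, f x y) ^ 2 := by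
    intro f
    rw [gen]
    calc _ = ∑ x, ∑ z, ∑ y, f z x * f z y := Finset.sum_congr rfl fun x _ => Finset.sum_comm
      _ = _ := Finset.sum_comm
  have m2 : ∀ f : V → V → V → ℝ, ∑ x, ∑ y, ∑ z, 2 * f x y z = 2 * ∑ x, ∑ y, ∑ z, f x y z := by
    intro f; simp only [Finset.mul_sum]
  unfold ph tt dd pp
  simp only [Finset.sum_add_distrib, Finset.sum_sub_distrib]
  rw [m2, g2, g2, g3, g3, ← gen, ← gen]
  ring

lemma sum_dd (hE : IsOrgraph E) : 2 * ∑ x, dd E x = (Fintype.card V : ℝ) ^ 2 - ∑ x, pp E x := by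
  have h : ∑ x : V, ∑ y : V, (oo E x y + oo E y x + hh E x y) = (Fintype.card V : ℝ) ^ 2 := by
    simp [oo_sum hE, sq]
  simp only [Finset.sum_add_distrib] at h
  rw [Finset.sum_comm (f := fun x y => oo E y x)] at h
  unfold dd pp
  linarith

/-- ordered count versus `fdfCount`. -/
lemma sum_ph_le (hE : IsOrgraph E) : ∑ x, ∑ y, ∑ z, ph E x y z
    ≤ 6 * (fdfCount V E : ℝ) + 3 * (Fintype.card V : ℝ) ^ 2 := by
  set S : Finset (V × V × V) := Finset.univ.filter fun t =>
    t.1 ≠ t.2.1 ∧ t.1 ≠ t.2.2 ∧ t.2.1 ≠ t.2.2 ∧ FDFedge E t.1 t.2.1 t.2.2 with hS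
  have h1 : S.card ≤ 6 * fdfCount V E := by
    unfold fdfCount
    refine Finset.card_le_mul_card_image_of_maps_to (f := fun t : V × V × V => {t.1, t.2.1, t.2.2}) ?_ 6 ?_
    · rintro ⟨x, y, z⟩ ht
      simp only [hS, Finset.mem_filter, Finset.mem_univ, true_and] at ht
      obtain ⟨a, b, c, d⟩ := ht
      simp only [Finset.mem_filter, Finset.mem_powersetCard, Finset.subset_univ, true_and]
      exact ⟨Finset.card_eq_three.2 ⟨x, y, z, a, b, c, rfl⟩, x, y, z, a, b, c, rfl, d⟩
    · intro s hs
      simp only [Finset.mem_filter] at hs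
      obtain ⟨-, u, v, w, huv, huw, hvw, rfl, -⟩ := hs
      refine le_trans (Finset.card_le_card (t := {(u,v,w),(u,w,v),(v,u,w),(v,w,u),(w,u,v),(w,v,u)}) ?_)
        Finset.card_le_six
      rintro ⟨x, y, z⟩ ht
      simp only [hS, Finset.mem_filter, Finset.mem_univ, true_and] at ht
      obtain ⟨⟨a, b, c, d⟩, e⟩ := ht
      have hx : x ∈ ({u, v, w} : Finset V) := by rw [← e]; simp
      have hy : y ∈ ({u, v, w} : Finset V) := by rw [← e]; simp
      have hz : z ∈ ({u, v, w} : Finset V) := by rw [← e]; simp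
      simp only [Finset.mem_insert, Finset.mem_singleton] at hx hy hz
      clear e d hS
      rcases hx with rfl | rfl | rfl <;> rcases hy with rfl | rfl | rfl <;>
        rcases hz with rfl | rfl | rfl <;> simp_all
  have h2 : ∀ x y z : V, ph E x y z ≤ (if (x, y, z) ∈ S then 1 else 0) + (if x = y then 1 else 0)
      + (if x = z then 1 else 0) + (if y = z then (1:ℝ) else 0) := by
    intro x y z
    have hb := (ph_bounds hE x y z).2
    by_cases hxy : x = y
    · simp only [hxy, if_true]; rw [hxy] at hb
      split_ifs <;> linarith
    by_cases hxz : x = z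
    · simp only [hxz, if_true]; rw [hxz] at hb
      split_ifs <;> linarith
    by_cases hyz : y = z
    · simp only [hyz, if_true]; rw [hyz] at hb
      split_ifs <;> linarith
    simp only [hxy, hxz, hyz, if_false, add_zero]
    by_cases hf : FDFedge E x y z
    · have : (x, y, z) ∈ S := by simp [hS, hxy, hxz, hyz, hf]
      simpa [this] using hb
    · rw [ph_eq_zero hE x y z hf]; split_ifs <;> norm_num
  have h3 : ∑ x : V, ∑ y : V, ∑ z : V, (if (x, y, z) ∈ S then (1:ℝ) else 0) = S.card := by
    have h4 : ∑ x : V, ∑ y : V, ∑ z : V, (if (x, y, z) ∈ S then (1:ℝ) else 0)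
        = ∑ t : V × V × V, (if t ∈ S then (1:ℝ) else 0) := by
      rw [Fintype.sum_prod_type]
      refine Finset.sum_congr rfl fun x _ => ?_
      rw [Fintype.sum_prod_type]
    rw [h4]; simp
  calc _ ≤ ∑ x : V, ∑ y : V, ∑ z : V, ((if (x, y, z) ∈ S then 1 else 0) + (if x = y then 1 else 0)
      + (if x = z then 1 else 0) + (if y = z then (1:ℝ) else 0)) :=
        Finset.sum_le_sum fun x _ => Finset.sum_le_sum fun y _ => Finset.sum_le_sum fun z _ => h2 x y z
    _ = S.card + 3 * (Fintype.card V : ℝ) ^ 2 := by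
        simp only [Finset.sum_add_distrib, h3]
        simp [Finset.sum_const]
        ring
    _ ≤ _ := by
        have : (S.card : ℝ) ≤ 6 * fdfCount V E := by exact_mod_cast h1
        linarith

lemma sum_pp_le (E : V → V → Prop) : ∑ x, pp E x
    ≤ (Fintype.card V : ℝ) ^ 2 - 2 * (underlyingEdgeCount V E : ℝ) := by
  set S : Finset (V × V) := Finset.univ.filter fun t => E t.1 t.2 ∨ E t.2 t.1 with hS
  have h1 : 2 * underlyingEdgeCount V E ≤ S.card := by
    unfold underlyingEdgeCount
    refine (Finset.mul_card_image_le_card_of_maps_to (s := S.filter fun t => t.1 ≠ t.2) (f := fun t : V × V => {t.1, t.2}) ?_ 2 ?_).trans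
      (Finset.card_le_card (Finset.filter_subset _ _))
    · rintro ⟨x, y⟩ ht
      simp only [hS, Finset.mem_filter, Finset.mem_univ, true_and] at ht
      simp only [Finset.mem_filter, Finset.mem_powersetCard, Finset.subset_univ, true_and]
      exact ⟨Finset.card_pair ht.2, x, y, ht.2, rfl, ht.1⟩
    · intro s hs
      simp only [Finset.mem_filter] at hs
      obtain ⟨-, u, v, huv, rfl, he⟩ := hs
      have : ((u, v) : V × V) ≠ (v, u) := by simp [huv]
      rw [← Finset.card_pair this]
      refine Finset.card_le_card ?_
      intro t ht
      simp only [Finset.mem_insert, Finset.mem_singleton] at ht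
      rcases ht with rfl | rfl
      · simp [hS, he, huv]
      · simp [hS, he.symm, huv.symm, Finset.pair_comm]
  have h3 : ∑ x, pp E x = (Fintype.card V : ℝ) ^ 2 - S.card := by
    have h4 : ∑ x : V, ∑ y : V, (1 - hh E x y) = S.card := by
      rw [← Finset.sum_product', hS, Finset.card_filter, Nat.cast_sum, Finset.univ_product_univ]
      refine Finset.sum_congr rfl ?_
      rintro ⟨x, y⟩ -
      unfold hh
      simp only
      split_ifs <;> simp
    unfold pp
    simp only [Finset.sum_sub_distrib] at h4
    simp at h4
    rw [← h4]; ring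
  rw [h3]
  have : 2 * (underlyingEdgeCount V E : ℝ) ≤ S.card := by exact_mod_cast h1
  linarith

end basics


section robust

variable {V : Type*} [DecidableEq V] {E : V → V → Prop} [DecidableRel E]

lemma exists_avoid {S : Finset V} {p : V → Prop} [DecidablePred p] {z : ℝ} (hz : ((S.filter p).card : ℝ) ≤ z)
    (hS : z < S.card) : ∃ x ∈ S, ¬ p x := by
  by_contra hcon
  push Not at hcon
  rw [Finset.filter_true_of_mem hcon] at hz
  linarith

lemma c4_near (hE : IsOrgraph E) (hC : ¬ HasInducedC4 E) (A B : Finset V) (z : ℝ) (hz : 0 ≤ z)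
    (nAB : ∀ a ∈ A, ((B.filter fun b => ¬ (E a b ∨ E b a)).card : ℝ) ≤ z)
    (nBB : ∀ b ∈ B, ((B.filter fun c => (E b c ∨ E c b)).card : ℝ) ≤ z)
    (a₀ : V) (ha₀ : a₀ ∈ A)
    (hmin : ∀ a ∈ A, (B.filter (E a₀)).card ≤ (B.filter (E a)).card)
    (a : V) (ha : a ∈ A) (hadj : ¬ (E a₀ a ∨ E a a₀)) :
    (((B.filter (E a₀)) \ (B.filter (E a))).card : ℝ) ≤ 2 * z := by
  by_contra hcon
  push Not at hcon
  set X := (B.filter (E a₀)) \ (B.filter (E a)) with hX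
  set Y := (B.filter (E a)) \ (B.filter (E a₀)) with hY
  have hXY : X.card ≤ Y.card := by
    have h1 := Finset.card_sdiff_add_card_inter (B.filter (E a₀)) (B.filter (E a))
    have h2 := Finset.card_sdiff_add_card_inter (B.filter (E a)) (B.filter (E a₀))
    rw [Finset.inter_comm (B.filter (E a))] at h2
    have h3 := hmin a ha
    rw [← hX] at h1
    rw [← hY] at h2
    omega
  have hXY' : (X.card : ℝ) ≤ Y.card := by exact_mod_cast hXY
  have hXB : X ⊆ B := fun x hx => (Finset.mem_filter.1 (Finset.mem_sdiff.1 hx).1).1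
  have hYB : Y ⊆ B := fun x hx => (Finset.mem_filter.1 (Finset.mem_sdiff.1 hx).1).1
  obtain ⟨b₁, hb₁, hb₁a⟩ := exists_avoid (S := X) (p := fun b => ¬ (E a b ∨ E b a)) (z := z)
    (le_trans (by exact_mod_cast Finset.card_le_card (Finset.filter_subset_filter _ hXB)) (nAB a ha))
    (by linarith)
  obtain ⟨b₂, hb₂, hb₂a⟩ := exists_avoid (S := Y)
    (p := fun b => ¬ (E a₀ b ∨ E b a₀) ∨ (E b₁ b ∨ E b b₁)) (z := 2 * z) (by
      rw [Finset.filter_or]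
      have h1 : (((Y.filter fun b => ¬ (E a₀ b ∨ E b a₀))).card : ℝ) ≤ z :=
        le_trans (by exact_mod_cast Finset.card_le_card (Finset.filter_subset_filter _ hYB)) (nAB a₀ ha₀)
      have h2 : (((Y.filter fun b => (E b₁ b ∨ E b b₁))).card : ℝ) ≤ z :=
        le_trans (by exact_mod_cast Finset.card_le_card (Finset.filter_subset_filter _ hYB)) (nBB b₁ (hXB hb₁))
      refine le_trans (Nat.cast_le.2 (Finset.card_union_le _ _)) ?_
      push_cast
      linarith)
    (by linarith)
  simp only [hX, hY, Finset.mem_sdiff, Finset.mem_filter] at hb₁ hb₂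
  apply hC
  have e1 : E a₀ b₁ := hb₁.1.2
  have e1' : ¬ E a b₁ := fun h => hb₁.2 ⟨hb₁.1.1, h⟩
  have e2 : E b₁ a := by tauto
  have e3 : E a b₂ := hb₂.1.2
  have e3' : ¬ E a₀ b₂ := fun h => hb₂.2 ⟨hb₂.1.1, h⟩
  have e4 : E b₂ a₀ := by tauto
  push Not at hb₂a hadj
  have ir := hE.1
  refine ⟨a₀, b₁, a, b₂, ?_, ?_, ?_, ?_, ?_, ?_, e1, e2, e3, e4, hE.2 _ _ e1, hE.2 _ _ e2,
    hE.2 _ _ e3, hE.2 _ _ e4, hadj.1, hadj.2, hb₂a.2.1, hb₂a.2.2⟩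
  · rintro rfl; exact ir _ e1
  · rintro rfl; exact e3' e3
  · rintro rfl; exact ir _ e4
  · rintro rfl; exact ir _ e2
  · rintro rfl; exact e3' e1
  · rintro rfl; exact ir _ e3

lemma c4_half (A B : Finset V) (z : ℝ)
    (nAA : ∀ a ∈ A, ((A.filter fun c => (E a c ∨ E c a)).card : ℝ) ≤ z) (hz : 0 ≤ z)
    (a₀ : V) (ha₀ : a₀ ∈ A)
    (near : ∀ a ∈ A, ¬ (E a₀ a ∨ E a a₀) →
      (((B.filter (E a₀)) \ (B.filter (E a))).card : ℝ) ≤ 2 * z)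
    (X : Finset V) (hX : X ⊆ A) :
    ∑ a ∈ X, ∑ b ∈ B.filter (E a₀), (if E a b then (0:ℝ) else 1)
      ≤ 2 * z * X.card + z * (B.filter (E a₀)).card := by
  have h1 : ∀ a ∈ X, ∑ b ∈ B.filter (E a₀), (if E a b then (0:ℝ) else 1)
      ≤ 2 * z + (if E a₀ a ∨ E a a₀ then ((B.filter (E a₀)).card : ℝ) else 0) := by
    intro a ha
    have h2 : ∑ b ∈ B.filter (E a₀), (if E a b then (0:ℝ) else 1)
        = (((B.filter (E a₀)) \ (B.filter (E a))).card : ℝ) := by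
      have : (B.filter (E a₀)) \ (B.filter (E a)) = (B.filter (E a₀)).filter (fun b => ¬ E a b) := by
        ext b; simp only [Finset.mem_sdiff, Finset.mem_filter]; tauto
      rw [this, Finset.card_filter, Nat.cast_sum]
      refine Finset.sum_congr rfl fun b _ => ?_
      by_cases h : E a b <;> simp [h]
    rw [h2]
    by_cases hadj : E a₀ a ∨ E a a₀
    · rw [if_pos hadj]
      have : (((B.filter (E a₀)) \ (B.filter (E a))).card : ℝ) ≤ (B.filter (E a₀)).card := by
        exact_mod_cast Finset.card_le_card Finset.sdiff_subset
      linarith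
    · rw [if_neg hadj]
      have := near a (hX ha) hadj
      linarith
  refine (Finset.sum_le_sum h1).trans ?_
  rw [Finset.sum_add_distrib, ← Finset.sum_filter]
  simp only [Finset.sum_const, nsmul_eq_mul]
  have h3 : ((X.filter fun c => (E a₀ c ∨ E c a₀)).card : ℝ) ≤ z :=
    le_trans (by exact_mod_cast Finset.card_le_card (Finset.filter_subset_filter _ hX)) (nAA a₀ ha₀)
  have h4 : (0:ℝ) ≤ (B.filter (E a₀)).card := Nat.cast_nonneg _
  nlinarith

lemma c4_robust (hE : IsOrgraph E) (hC : ¬ HasInducedC4 E) (A B : Finset V) (z η : ℝ) (hz : 0 ≤ z)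
    (hη : 6 * z < η)
    (nAA : ∀ a ∈ A, ((A.filter fun c => (E a c ∨ E c a)).card : ℝ) ≤ z)
    (nAB : ∀ a ∈ A, ((B.filter fun b => ¬ (E a b ∨ E b a)).card : ℝ) ≤ z)
    (nBB : ∀ b ∈ B, ((B.filter fun c => (E b c ∨ E c b)).card : ℝ) ≤ z)
    (nBA : ∀ b ∈ B, ((A.filter fun c => ¬ (E b c ∨ E c b)).card : ℝ) ≤ z)
    (oA : ∀ a ∈ A, η ≤ (B.filter (E a)).card)
    (oB : ∀ b ∈ B, η ≤ (A.filter (E b)).card)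
    (hne : A.Nonempty) : False := by
  obtain ⟨a₀, ha₀, hamin⟩ := Finset.exists_min_image A (fun a => (B.filter (E a)).card) hne
  have hBne : B.Nonempty := by
    have h1 := oA a₀ ha₀
    have h2 : 0 < (B.filter (E a₀)).card := by
      have : (0:ℝ) < (B.filter (E a₀)).card := by linarith
      exact_mod_cast this
    obtain ⟨b, hb⟩ := Finset.card_pos.1 h2
    exact ⟨b, (Finset.mem_filter.1 hb).1⟩
  obtain ⟨b₀, hb₀, hbmin⟩ := Finset.exists_min_image B (fun b => (A.filter (E b)).card) hBne
  have nearA := c4_near hE hC A B z hz nAB nBB a₀ ha₀ hamin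
  have nearB := c4_near hE hC B A z hz nBA nAA b₀ hb₀ hbmin
  have s1 := c4_half A B z nAA hz a₀ ha₀ nearA (A.filter (E b₀)) (Finset.filter_subset _ _)
  have s2 := c4_half B A z nBB hz b₀ hb₀ nearB (B.filter (E a₀)) (Finset.filter_subset _ _)
  set X := A.filter (E b₀)
  set Y := B.filter (E a₀)
  rw [Finset.sum_comm] at s2
  have s3 : ∑ a ∈ X, ∑ b ∈ Y, (1:ℝ) ≤ ∑ a ∈ X, ∑ b ∈ Y, (if E a b then (0:ℝ) else 1)
      + ∑ a ∈ X, ∑ b ∈ Y, (if E b a then (0:ℝ) else 1) := by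
    rw [← Finset.sum_add_distrib]
    refine Finset.sum_le_sum fun a _ => ?_
    rw [← Finset.sum_add_distrib]
    refine Finset.sum_le_sum fun b _ => ?_
    have := hE.2 a b
    by_cases h1 : E a b <;> by_cases h2 : E b a <;> simp_all
  simp only [Finset.sum_const, nsmul_eq_mul, mul_one] at s3
  have hX := oB b₀ hb₀
  have hY := oA a₀ ha₀
  change η ≤ (X.card : ℝ) at hX
  change η ≤ (Y.card : ℝ) at hY
  nlinarith

end robust


section layers

lemma layer_step {S l l' y : ℝ} (h : S ≤ l ^ 2 ∧ S ≤ y ^ 2) (hl : 0 ≤ l) (hl' : l ≤ l') :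
    S + (l' ^ 2 - l ^ 2) * (if l' ≤ y then 1 else 0) ≤ l' ^ 2 ∧
    S + (l' ^ 2 - l ^ 2) * (if l' ≤ y then 1 else 0) ≤ y ^ 2 := by
  split_ifs with hy
  · constructor <;> nlinarith
  · constructor <;> nlinarith

lemma layer_sum {V : Type*} [Fintype V] (y : V → ℝ) (s : ℝ) (hs : 0 < s)
    (h : ∀ t : ℝ, 0 < t → t ≤ s →
      t - s / 100 ≤ ∑ v, (if s - t - s / 1000 ≤ y v then (1:ℝ) else 0)) :
    s ^ 3 / 4 ≤ ∑ v, y v ^ 2 := by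
  have key : ∀ v, (((((((((0:ℝ) + ((99/1000*s)^2 - 0^2) * (if 99/1000*s ≤ y v then 1 else 0))
      + ((199/1000*s)^2 - (99/1000*s)^2) * (if 199/1000*s ≤ y v then 1 else 0))
      + ((299/1000*s)^2 - (199/1000*s)^2) * (if 299/1000*s ≤ y v then 1 else 0))
      + ((399/1000*s)^2 - (299/1000*s)^2) * (if 399/1000*s ≤ y v then 1 else 0))
      + ((499/1000*s)^2 - (399/1000*s)^2) * (if 499/1000*s ≤ y v then 1 else 0))
      + ((599/1000*s)^2 - (499/1000*s)^2) * (if 599/1000*s ≤ y v then 1 else 0))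
      + ((699/1000*s)^2 - (599/1000*s)^2) * (if 699/1000*s ≤ y v then 1 else 0))
      + ((799/1000*s)^2 - (699/1000*s)^2) * (if 799/1000*s ≤ y v then 1 else 0))
      + ((899/1000*s)^2 - (799/1000*s)^2) * (if 899/1000*s ≤ y v then 1 else 0)
      ≤ y v ^ 2 := by
    intro v
    have h0 : (0:ℝ) ≤ 0 ^ 2 ∧ (0:ℝ) ≤ y v ^ 2 := ⟨by norm_num, sq_nonneg _⟩
    exact (layer_step (layer_step (layer_step (layer_step (layer_step (layer_step (layer_step
      (layer_step (layer_step h0 (by linarith) (by linarith)) (by linarith) (by linarith))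
      (by linarith) (by linarith)) (by linarith) (by linarith)) (by linarith) (by linarith))
      (by linarith) (by linarith)) (by linarith) (by linarith)) (by linarith) (by linarith))
      (by linarith) (by linarith)).2
  have key2 := Finset.sum_le_sum (fun v (_ : v ∈ Finset.univ) => key v)
  simp only [Finset.sum_add_distrib, ← Finset.mul_sum, Finset.sum_const_zero] at key2
  have hh : ∀ r : ℝ, 0 < r → r < 1 → (1 - r) * s - s / 100 ≤
      ∑ v, (if (r - 1/1000) * s ≤ y v then (1:ℝ) else 0) := by
    intro r hr hr1
    have := h ((1 - r) * s) (by nlinarith) (by nlinarith)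
    rwa [show s - (1 - r) * s - s / 1000 = (r - 1/1000) * s by ring] at this
  have h1 := hh (1/10) (by norm_num) (by norm_num)
  have h2 := hh (2/10) (by norm_num) (by norm_num)
  have h3 := hh (3/10) (by norm_num) (by norm_num)
  have h4 := hh (4/10) (by norm_num) (by norm_num)
  have h5 := hh (5/10) (by norm_num) (by norm_num)
  have h6 := hh (6/10) (by norm_num) (by norm_num)
  have h7 := hh (7/10) (by norm_num) (by norm_num)
  have h8 := hh (8/10) (by norm_num) (by norm_num)
  have h9 := hh (9/10) (by norm_num) (by norm_num)
  rw [show (1/10 - 1/1000 : ℝ) = 99/1000 by norm_num] at h1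
  rw [show (2/10 - 1/1000 : ℝ) = 199/1000 by norm_num] at h2
  rw [show (3/10 - 1/1000 : ℝ) = 299/1000 by norm_num] at h3
  rw [show (4/10 - 1/1000 : ℝ) = 399/1000 by norm_num] at h4
  rw [show (5/10 - 1/1000 : ℝ) = 499/1000 by norm_num] at h5
  rw [show (6/10 - 1/1000 : ℝ) = 599/1000 by norm_num] at h6
  rw [show (7/10 - 1/1000 : ℝ) = 699/1000 by norm_num] at h7
  rw [show (8/10 - 1/1000 : ℝ) = 799/1000 by norm_num] at h8
  rw [show (9/10 - 1/1000 : ℝ) = 899/1000 by norm_num] at h9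
  have hs2 : 0 < s ^ 2 := by positivity
  have hs3 : 0 < s ^ 3 := by positivity
  have m1 := mul_le_mul_of_nonneg_left h1 hs2.le
  have m2 := mul_le_mul_of_nonneg_left h2 hs2.le
  have m3 := mul_le_mul_of_nonneg_left h3 hs2.le
  have m4 := mul_le_mul_of_nonneg_left h4 hs2.le
  have m5 := mul_le_mul_of_nonneg_left h5 hs2.le
  have m6 := mul_le_mul_of_nonneg_left h6 hs2.le
  have m7 := mul_le_mul_of_nonneg_left h7 hs2.le
  have m8 := mul_le_mul_of_nonneg_left h8 hs2.le
  have m9 := mul_le_mul_of_nonneg_left h9 hs2.le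
  ring_nf at key2 m1 m2 m3 m4 m5 m6 m7 m8 m9 ⊢
  linarith

end layers

section good
open Classical

variable {V : Type*} {E : V → V → Prop}

/-- same-class indicator -/
noncomputable def kk (c : V → Fin 3) (x y : V) : ℝ := if c x = c y then 1 else 0

/-- adjacent pairs inside a class -/
noncomputable def mmm (E : V → V → Prop) (c : V → Fin 3) (x y : V) : ℝ :=
  if c x = c y then 1 - hh E x y else 0

/-- non-adjacent pairs across classes -/
noncomputable def qqq (E : V → V → Prop) (c : V → Fin 3) (x y : V) : ℝ :=
  if c x = c y then 0 else hh E x y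

lemma hh_eq (c : V → Fin 3) (x y : V) : hh E x y = kk c x y - mmm E c x y + qqq E c x y := by
  unfold kk mmm qqq; split_ifs <;> ring

lemma mmm_nonneg (c : V → Fin 3) (x y : V) : 0 ≤ mmm E c x y := by
  unfold mmm; have := hh_le_one (E := E) x y; split_ifs <;> linarith

lemma qqq_nonneg (c : V → Fin 3) (x y : V) : 0 ≤ qqq E c x y := by
  unfold qqq; have := hh_nonneg (E := E) x y; split_ifs <;> linarith

lemma tri_bound (c : V → Fin 3) (x y z : V) :
    hh E x y * hh E y z * hh E z x ≤ kk c x y * kk c x z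
      - mmm E c x y * kk c x z - mmm E c y z * kk c y x - mmm E c z x * kk c z y
      + mmm E c x y * mmm E c x z + mmm E c y x * mmm E c y z + mmm E c z x * mmm E c z y
      + qqq E c x y * qqq E c x z + qqq E c y x * qqq E c y z + qqq E c z x * qqq E c z y := by
  unfold kk mmm qqq
  rw [hh_symm z x, hh_symm y x, hh_symm z y]
  by_cases h1 : c x = c y
  · by_cases h2 : c x = c z
    · have h3 : c y = c z := h1.symm.trans h2
      simp only [h1, h3, if_true]
      rcases hh_cases (E := E) x y with e1 | e1 <;> rcases hh_cases (E := E) y z with e2 | e2 <;>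
        rcases hh_cases (E := E) x z with e3 | e3 <;> rw [e1, e2, e3] <;> norm_num
    · have h3 : ¬ c y = c z := fun h => h2 (h1.trans h)
      have h3' : ¬ c z = c y := fun h => h3 h.symm
      have h2' : ¬ c z = c x := fun h => h2 h.symm
      simp only [h1, h3, h3', if_true, if_false]
      rcases hh_cases (E := E) x y with e1 | e1 <;> rcases hh_cases (E := E) y z with e2 | e2 <;>
        rcases hh_cases (E := E) x z with e3 | e3 <;> rw [e1, e2, e3] <;> norm_num
  · have h1' : ¬ c y = c x := fun h => h1 h.symm
    by_cases h2 : c x = c z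
    · have h3 : ¬ c y = c z := fun h => h1 (h2.trans h.symm)
      have h3' : ¬ c z = c y := fun h => h3 h.symm
      simp only [h2, h3, h3', if_true, if_false]
      rcases hh_cases (E := E) x y with e1 | e1 <;> rcases hh_cases (E := E) y z with e2 | e2 <;>
        rcases hh_cases (E := E) x z with e3 | e3 <;> rw [e1, e2, e3] <;> norm_num
    · have h2' : ¬ c z = c x := fun h => h2 h.symm
      by_cases h3 : c y = c z
      · simp only [h2, h2', h3, if_true, if_false]
        rcases hh_cases (E := E) x y with e1 | e1 <;> rcases hh_cases (E := E) y z with e2 | e2 <;>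
          rcases hh_cases (E := E) x z with e3 | e3 <;> rw [e1, e2, e3] <;> norm_num
      · have h3' : ¬ c z = c y := fun h => h3 h.symm
        simp only [h1, h2, h2', h1', h3, h3', if_false]
        rcases hh_cases (E := E) x y with e1 | e1 <;> rcases hh_cases (E := E) y z with e2 | e2 <;>
          rcases hh_cases (E := E) x z with e3 | e3 <;> rw [e1, e2, e3] <;> norm_num

variable [Fintype V]

lemma ctr1 (f g : V → V → ℝ) :
    ∑ x, ∑ y, ∑ z, f x y * g x z = ∑ x, (∑ y, f x y) * (∑ y, g x y) := by
  refine Finset.sum_congr rfl fun x _ => ?_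
  rw [Finset.sum_mul_sum]

lemma ctr2 (f g : V → V → ℝ) :
    ∑ x, ∑ y, ∑ z, f y x * g y z = ∑ x, (∑ y, f x y) * (∑ y, g x y) := by
  rw [← ctr1, Finset.sum_comm]

lemma ctr2' (f g : V → V → ℝ) :
    ∑ x, ∑ y, ∑ z, f y z * g y x = ∑ x, (∑ y, f x y) * (∑ y, g x y) := by
  have := ctr2 g f
  simp only [mul_comm (g _ _)] at this
  rw [this]
  exact Finset.sum_congr rfl fun x _ => mul_comm _ _

lemma ctr3 (f g : V → V → ℝ) :
    ∑ x, ∑ y, ∑ z, f z x * g z y = ∑ x, (∑ y, f x y) * (∑ y, g x y) := by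
  rw [← ctr1]
  calc _ = ∑ x, ∑ z, ∑ y, f z x * g z y := Finset.sum_congr rfl fun x _ => Finset.sum_comm
    _ = _ := Finset.sum_comm

lemma tt_bound (E : V → V → Prop) (c : V → Fin 3) : tt V E ≤
    ∑ v, ((∑ y, kk c v y) ^ 2 - 3 * ((∑ y, mmm E c v y) * (∑ y, kk c v y))
      + 3 * (∑ y, mmm E c v y) ^ 2 + 3 * (∑ y, qqq E c v y) ^ 2) := by
  have h := Finset.sum_le_sum fun x (_ : x ∈ (Finset.univ : Finset V)) =>
    Finset.sum_le_sum fun y (_ : y ∈ (Finset.univ : Finset V)) =>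
    Finset.sum_le_sum fun z (_ : z ∈ (Finset.univ : Finset V)) => tri_bound (E := E) c x y z
  refine h.trans (le_of_eq ?_)
  simp only [Finset.sum_add_distrib, Finset.sum_sub_distrib]
  rw [ctr1, ctr1, ctr1, ctr1, ctr2', ctr2, ctr2, ctr3, ctr3, ctr3]
  simp only [← Finset.mul_sum, sq]
  ring

end good


section good2
open Classical

variable {V : Type*} {E : V → V → Prop} [Fintype V]

/-- class size -/
noncomputable def ss (c : V → Fin 3) (i : Fin 3) : ℝ := ∑ v, if c v = i then 1 else 0

lemma sum_kk (c : V → Fin 3) (v : V) : ∑ y, kk c v y = ss c (c v) := by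
  unfold kk ss
  exact Finset.sum_congr rfl fun y _ => by simp only [eq_comm]

lemma sum_cls (c : V → Fin 3) (f : Fin 3 → ℝ) : ∑ v, f (c v) = ∑ i, ss c i * f i := by
  unfold ss
  simp only [Finset.sum_mul]
  rw [Finset.sum_comm]
  refine Finset.sum_congr rfl fun v _ => ?_
  simp

lemma sum_ss (c : V → Fin 3) : ss c 0 + ss c 1 + ss c 2 = Fintype.card V := by
  have := sum_cls c (fun _ => 1)
  simp [Fin.sum_univ_three] at this
  linarith

lemma vertex_ineq {n a m q z : ℝ} (hm : 0 ≤ m) (hq : 0 ≤ q) (hz : z = n / 1000000) (h : m + q ≤ z)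
    (ha : n / 3 - z ≤ a) :
    a ^ 2 - n * a + n / 2 * (m + q) ≤ 3 * (a - m + q) ^ 2 - n * (a - m + q)
      - 2 * (a ^ 2 - 3 * (m * a) + 3 * m ^ 2 + 3 * q ^ 2) := by
  have hz0 : 0 ≤ z := by linarith
  have hn : n = 1000000 * z := by linarith
  subst hn
  have h1 : (1000000 * z / 3 - z) * q ≤ a * q := mul_le_mul_of_nonneg_right ha hq
  have h2 : (m + q) * (m + q) ≤ z * (m + q) := mul_le_mul_of_nonneg_right h (by linarith)
  nlinarith [mul_nonneg hm hq, mul_nonneg hz0 hq, mul_nonneg hz0 hm, sq_nonneg (q - m)]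

lemma good_ineq (hE : IsOrgraph E) (c : V → Fin 3) (z : ℝ) (hz : z = (Fintype.card V : ℝ) / 1000000)
    (hmq : ∀ v, ∑ y, mmm E c v y + ∑ y, qqq E c v y ≤ z)
    (hs : ∀ i, |ss c i - (Fintype.card V : ℝ) / 3| ≤ z) :
    3 * ∑ v, (dd E v - (Fintype.card V : ℝ) / 3) ^ 2
      + ∑ i, (ss c i - (Fintype.card V : ℝ) / 3) ^ 3
      + (Fintype.card V : ℝ) / 2 * ∑ v, (∑ y, mmm E c v y + ∑ y, qqq E c v y)
      ≤ ∑ x, ∑ y, ∑ z, ph E x y z - 4 / 9 * (Fintype.card V : ℝ) ^ 3 := by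
  have hsp := sum_ph E
  have hsd := sum_dd hE
  have htt := tt_bound E c
  have hn := sum_ss c
  set n : ℝ := (Fintype.card V : ℝ) with hnd
  have hp : ∀ v, pp E v = ss c (c v) - ∑ y, mmm E c v y + ∑ y, qqq E c v y := by
    intro v
    unfold pp
    simp only [hh_eq (E := E) c v, Finset.sum_add_distrib, Finset.sum_sub_distrib, sum_kk]
  have hv : ∑ v, (ss c (c v) ^ 2 - n * ss c (c v) + n / 2 * (∑ y, mmm E c v y + ∑ y, qqq E c v y))
      ≤ ∑ v, (3 * pp E v ^ 2 - n * pp E v - 2 * ((∑ y, kk c v y) ^ 2 - 3 * ((∑ y, mmm E c v y) * (∑ y, kk c v y))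
      + 3 * (∑ y, mmm E c v y) ^ 2 + 3 * (∑ y, qqq E c v y) ^ 2)) := by
    refine Finset.sum_le_sum fun v _ => ?_
    rw [hp v, sum_kk]
    refine vertex_ineq (Finset.sum_nonneg fun y _ => mmm_nonneg c v y)
      (Finset.sum_nonneg fun y _ => qqq_nonneg c v y) hz (hmq v) ?_
    have := abs_le.1 (hs (c v))
    linarith
  rw [Finset.sum_add_distrib, sum_cls c (fun i => ss c i ^ 2 - n * ss c i), ← Finset.mul_sum,
    Finset.sum_sub_distrib, Finset.sum_sub_distrib, ← Finset.mul_sum, ← Finset.mul_sum, ← Finset.mul_sum] at hv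
  have hd : ∑ v, (dd E v - n / 3) ^ 2 = ∑ v, dd E v ^ 2 - 2 * n / 3 * ∑ v, dd E v + n ^ 3 / 9 := by
    have : ∀ v, (dd E v - n / 3) ^ 2 = dd E v ^ 2 - 2 * n / 3 * dd E v + n ^ 2 / 9 := fun v => by ring
    simp only [this, Finset.sum_add_distrib, Finset.sum_sub_distrib, ← Finset.mul_sum]
    simp only [Finset.sum_const, Finset.card_univ, nsmul_eq_mul, ← hnd]
    ring
  rw [hd]
  simp only [Fin.sum_univ_three] at hv ⊢
  have e : (ss c 0 - n / 3) ^ 3 + (ss c 1 - n / 3) ^ 3 + (ss c 2 - n / 3) ^ 3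
     = ss c 0 * (ss c 0 ^ 2 - n * ss c 0) + ss c 1 * (ss c 1 ^ 2 - n * ss c 1)
      + ss c 2 * (ss c 2 ^ 2 - n * ss c 2) + n ^ 2 / 3 * (ss c 0 + ss c 1 + ss c 2) - n ^ 3 / 9 := by ring
  rw [e, hn]
  have e2 : n * (2 * ∑ x, dd E x) = n * (n ^ 2 - ∑ x, pp E x) := by rw [hsd]
  nlinarith [e2, hsp, htt, hv]

end good2


section good3
open Classical

variable {V : Type*} {E : V → V → Prop} [Fintype V]

/-- total noise degree of a vertex -/
noncomputable def mq (E : V → V → Prop) (c : V → Fin 3) (v : V) : ℝ :=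
  ∑ y, mmm E c v y + ∑ y, qqq E c v y

lemma mq_nonneg (c : V → Fin 3) (v : V) : 0 ≤ mq E c v :=
  add_nonneg (Finset.sum_nonneg fun y _ => mmm_nonneg c v y)
    (Finset.sum_nonneg fun y _ => qqq_nonneg c v y)

lemma card_le_sum_of_one_le {S : Finset V} (f : V → ℝ) (hf : ∀ v, 0 ≤ f v) (h : ∀ v ∈ S, 1 ≤ f v) :
    (S.card : ℝ) ≤ ∑ v, f v := by
  calc (S.card : ℝ) = ∑ v ∈ S, (1:ℝ) := by simp
    _ ≤ ∑ v ∈ S, f v := Finset.sum_le_sum h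
    _ ≤ ∑ v, f v := Finset.sum_le_sum_of_subset_of_nonneg (Finset.subset_univ _) fun v _ _ => hf v

lemma noise_same (c : V → Fin 3) (v : V) (S : Finset V) (h : ∀ y ∈ S, c y = c v ∧ (E v y ∨ E y v)) :
    (S.card : ℝ) ≤ mq E c v := by
  have h1 := card_le_sum_of_one_le (S := S) (fun y => mmm E c v y) (fun y => mmm_nonneg c v y) (by
    intro y hy
    obtain ⟨h1, h2⟩ := h y hy
    simp [mmm, hh, h1, h2])
  have h2 : 0 ≤ ∑ y, qqq E c v y := Finset.sum_nonneg fun y _ => qqq_nonneg c v y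
  unfold mq; linarith

lemma noise_diff (c : V → Fin 3) (v : V) (S : Finset V) (h : ∀ y ∈ S, c y ≠ c v ∧ ¬ (E v y ∨ E y v)) :
    (S.card : ℝ) ≤ mq E c v := by
  have h1 := card_le_sum_of_one_le (S := S) (fun y => qqq E c v y) (fun y => qqq_nonneg c v y) (by
    intro y hy
    obtain ⟨h1, h2⟩ := h y hy
    simp only [qqq, hh, if_neg h1.symm, if_neg h2, le_refl])
  have h2 : 0 ≤ ∑ y, mmm E c v y := Finset.sum_nonneg fun y _ => mmm_nonneg c v y
  unfold mq; linarith

/-- out-degree into a class -/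
noncomputable def outc (E : V → V → Prop) (c : V → Fin 3) (j : Fin 3) (v : V) : ℝ :=
  ((Finset.univ.filter fun y => c y = j ∧ E v y).card : ℝ)

lemma dd_le_outc (c : V → Fin 3) (i j k : Fin 3) (hall : ∀ x : Fin 3, x = i ∨ x = j ∨ x = k) (v : V)
    (hv : c v = i) : dd E v ≤ outc E c j v + ss c k + mq E c v := by
  have h : dd E v ≤ ∑ y, ((if c y = j ∧ E v y then 1 else 0) + (if c y = k then 1 else 0) + mmm E c v y) := by
    unfold dd
    refine Finset.sum_le_sum fun y _ => ?_
    have hm := mmm_nonneg (E := E) c v y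
    by_cases he : E v y
    · have h1 : oo E v y = 1 := by simp [oo, he]
      rw [h1]
      rcases hall (c y) with h | h | h
      · have : mmm E c v y = 1 := by simp [mmm, hh, hv, h, he]
        rw [this]
        have a1 : (0:ℝ) ≤ (if c y = j ∧ E v y then 1 else 0) := by split_ifs <;> norm_num
        have a2 : (0:ℝ) ≤ (if c y = k then 1 else 0) := by split_ifs <;> norm_num
        linarith
      · have a2 : (0:ℝ) ≤ (if c y = k then 1 else 0) := by split_ifs <;> norm_num
        rw [if_pos ⟨h, he⟩]; linarith
      · have a1 : (0:ℝ) ≤ (if c y = j ∧ E v y then 1 else 0) := by split_ifs <;> norm_num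
        rw [if_pos h]; linarith
    · have h1 : oo E v y = 0 := by simp [oo, he]
      rw [h1]
      have a1 : (0:ℝ) ≤ (if c y = j ∧ E v y then 1 else 0) := by split_ifs <;> norm_num
      have a2 : (0:ℝ) ≤ (if c y = k then 1 else 0) := by split_ifs <;> norm_num
      linarith
  rw [Finset.sum_add_distrib, Finset.sum_add_distrib, Finset.sum_boole] at h
  have h2 : 0 ≤ ∑ y, qqq E c v y := Finset.sum_nonneg fun y _ => qqq_nonneg c v y
  unfold outc ss mq
  linarith

/-- low-outdegree clean vertices of class i -/
noncomputable def lowS (E : V → V → Prop) (c : V → Fin 3) (i j : Fin 3) (w t : ℝ) : Finset V :=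
  Finset.univ.filter fun v => c v = i ∧ mq E c v ≤ w ∧ outc E c j v < t

noncomputable def highS (E : V → V → Prop) (c : V → Fin 3) (i j : Fin 3) (w t : ℝ) : Finset V :=
  Finset.univ.filter fun v => c v = i ∧ mq E c v ≤ w ∧ t ≤ outc E c j v

noncomputable def badS (E : V → V → Prop) (c : V → Fin 3) (w : ℝ) : Finset V :=
  Finset.univ.filter fun v => w < mq E c v

lemma low_count (c : V → Fin 3) (i j k : Fin 3) (hall : ∀ x : Fin 3, x = i ∨ x = j ∨ x = k)
    (s t n : ℝ) (hs : s = n / 3 - ss c k) :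
    ((lowS E c i j (s / 1000) t).card : ℝ) ≤ ∑ v, (if s - t - s / 1000 ≤ n / 3 - dd E v then (1:ℝ) else 0) := by
  refine card_le_sum_of_one_le _ (fun v => by split_ifs <;> norm_num) ?_
  intro v hv
  simp only [lowS, Finset.mem_filter, Finset.mem_univ, true_and] at hv
  have := dd_le_outc c i j k hall v hv.1 (E := E)
  rw [if_pos (by linarith [hv.2.1, hv.2.2])]

lemma bad_count (c : V → Fin 3) (w : ℝ) : ((badS E c w).card : ℝ) * w ≤ ∑ v, mq E c v := by
  calc ((badS E c w).card : ℝ) * w = ∑ v ∈ badS E c w, w := by simp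
    _ ≤ ∑ v ∈ badS E c w, mq E c v := Finset.sum_le_sum fun v hv => by
        simp only [badS, Finset.mem_filter] at hv; exact hv.2.le
    _ ≤ ∑ v, mq E c v := Finset.sum_le_sum_of_subset_of_nonneg (Finset.subset_univ _)
        fun v _ _ => mq_nonneg c v

lemma high_out (c : V → Fin 3) (i j : Fin 3) (w t : ℝ) (a : V) (ha : a ∈ highS E c i j w t) :
    t - (badS E c w).card - (lowS E c j i w t).card ≤ ((highS E c j i w t).filter (E a)).card := by
  have hsub : (Finset.univ.filter fun y => c y = j ∧ E a y) ⊆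
      (highS E c j i w t).filter (E a) ∪ badS E c w ∪ lowS E c j i w t := by
    intro y hy
    simp only [highS, lowS, badS, Finset.mem_filter, Finset.mem_univ, true_and, Finset.mem_union] at hy ⊢
    rcases le_or_gt (mq E c y) w with h | h
    · rcases le_or_gt t (outc E c i y) with h' | h'
      · exact Or.inl (Or.inl ⟨⟨hy.1, h, h'⟩, hy.2⟩)
      · exact Or.inr ⟨hy.1, h, h'⟩
    · exact Or.inl (Or.inr h)
  have h1 := Finset.card_le_card hsub
  have h2 := h1.trans ((Finset.card_union_le _ _).trans (Nat.add_le_add_right (Finset.card_union_le _ _) _))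
  have h3 : outc E c j a ≤ ((highS E c j i w t).filter (E a)).card + (badS E c w).card
      + (lowS E c j i w t).card := by unfold outc; exact_mod_cast h2
  simp only [highS, Finset.mem_filter] at ha
  have := ha.2.2.2
  simp only [highS] at h3 ⊢
  linarith

lemma layer_count (hE : IsOrgraph E) (hC : ¬ HasInducedC4 E) (c : V → Fin 3) (i j k : Fin 3) (hij : i ≠ j)
    (hall : ∀ x : Fin 3, x = i ∨ x = j ∨ x = k) (n s t : ℝ) 
    (hs : s = n / 3 - ss c k) (hs0 : 0 < s) (hsn : s ≤ n / 1000000) (hi : n / 3 - n / 1000000 ≤ ss c i)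
    (hν : n * ∑ v, mq E c v < 3 / 2 * s ^ 3) (ht : t ≤ s) :
    t - s / 100 ≤ ∑ v, (if s - t - s / 1000 ≤ n / 3 - dd E v then (1:ℝ) else 0) := by
  by_contra hcon
  push Not at hcon
  have hP := (low_count (E := E) c i j k hall s t n hs).trans_lt hcon
  have hQ := (low_count (E := E) c j i k (fun x => by rcases hall x with h | h | h <;> simp [h]) s t n hs).trans_lt hcon
  have hn : 0 < n := by linarith
  have hR : ((badS E c (s / 1000)).card : ℝ) ≤ 15 / 10000 * s := by
    have h1 := bad_count (E := E) c (s / 1000)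
    have h2 : n * (((badS E c (s / 1000)).card : ℝ) * (s / 1000)) < 3 / 2 * s ^ 3 :=
      (mul_le_mul_of_nonneg_left h1 hn.le).trans_lt hν
    by_contra h3
    push Not at h3
    have h4 : 15 / 10000 * s * (s / 1000) ≤ ((badS E c (s / 1000)).card : ℝ) * (s / 1000) :=
      mul_le_mul_of_nonneg_right h3.le (by positivity)
    have h5 : n * (15 / 10000 * s * (s / 1000)) < 3 / 2 * s ^ 3 :=
      (mul_le_mul_of_nonneg_left h4 hn.le).trans_lt h2
    have h6 : s ^ 2 * s ≤ s ^ 2 * (n / 1000000) := mul_le_mul_of_nonneg_left hsn (by positivity)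
    nlinarith
  set w := s / 1000 with hw
  refine c4_robust hE hC (highS E c i j w t) (highS E c j i w t) w (7 / 1000 * s) (by positivity) (by linarith)
    ?_ ?_ ?_ ?_ ?_ ?_ ?_
  · intro a ha
    simp only [highS, Finset.mem_filter, Finset.mem_univ, true_and] at ha
    refine le_trans (noise_same c a _ ?_) ha.2.1
    intro y hy
    simp only [highS, Finset.mem_filter, Finset.mem_univ, true_and] at hy
    exact ⟨hy.1.1.trans ha.1.symm, hy.2⟩
  · intro a ha
    simp only [highS, Finset.mem_filter, Finset.mem_univ, true_and] at ha
    refine le_trans (noise_diff c a _ ?_) ha.2.1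
    intro y hy
    simp only [highS, Finset.mem_filter, Finset.mem_univ, true_and] at hy
    exact ⟨by rw [hy.1.1, ha.1]; exact hij.symm, hy.2⟩
  · intro a ha
    simp only [highS, Finset.mem_filter, Finset.mem_univ, true_and] at ha
    refine le_trans (noise_same c a _ ?_) ha.2.1
    intro y hy
    simp only [highS, Finset.mem_filter, Finset.mem_univ, true_and] at hy
    exact ⟨hy.1.1.trans ha.1.symm, hy.2⟩
  · intro a ha
    simp only [highS, Finset.mem_filter, Finset.mem_univ, true_and] at ha
    refine le_trans (noise_diff c a _ ?_) ha.2.1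
    intro y hy
    simp only [highS, Finset.mem_filter, Finset.mem_univ, true_and] at hy
    exact ⟨by rw [hy.1.1, ha.1]; exact hij, hy.2⟩
  · intro a ha
    have := high_out c i j w t a ha
    linarith
  · intro a ha
    have := high_out c j i w t a ha
    linarith
  · by_contra hne
    rw [Finset.not_nonempty_iff_eq_empty] at hne
    have hsub : (Finset.univ.filter fun y => c y = i) ⊆ badS E c w ∪ lowS E c i j w t := by
      intro y hy
      simp only [lowS, badS, Finset.mem_filter, Finset.mem_univ, true_and, Finset.mem_union] at hy ⊢
      rcases le_or_gt (mq E c y) w with h | h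
      · rcases le_or_gt t (outc E c j y) with h' | h'
        · have : y ∈ highS E c i j w t := by simp [highS, hy, h, h']
          simp [hne] at this
        · exact Or.inr ⟨hy, h, h'⟩
      · exact Or.inl h
    have h1 := (Finset.card_le_card hsub).trans (Finset.card_union_le _ _)
    have h2 : ss c i ≤ (badS E c w).card + (lowS E c i j w t).card := by
      unfold ss; rw [Finset.sum_boole]; exact_mod_cast h1
    linarith

lemma main_good_aux (hE : IsOrgraph E) (hC : ¬ HasInducedC4 E) (c : V → Fin 3) (i j k : Fin 3) (hij : i ≠ j)
    (hall : ∀ x : Fin 3, x = i ∨ x = j ∨ x = k) (n : ℝ) (hn : n = Fintype.card V)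
    (hmq : ∀ v, mq E c v ≤ n / 1000000)
    (hs : ∀ i, |ss c i - n / 3| ≤ n / 1000000) 
    (hsum : ss c i + ss c j + ss c k = n)
    (hmin : ss c k ≤ n / 3) : 
    0 ≤ 3 * ∑ v, (dd E v - n / 3) ^ 2
      + ((ss c i - n / 3) ^ 3 + (ss c j - n / 3) ^ 3 + (ss c k - n / 3) ^ 3)
      + n / 2 * ∑ v, mq E c v := by
  have hn0 : 0 ≤ n := by rw [hn]; positivity
  have hν0 : 0 ≤ ∑ v, mq E c v := Finset.sum_nonneg fun v _ => mq_nonneg c v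
  have hd0 : 0 ≤ ∑ v, (dd E v - n / 3) ^ 2 := Finset.sum_nonneg fun v _ => sq_nonneg _
  obtain ⟨s, hsd⟩ : ∃ s, s = n / 3 - ss c k := ⟨_, rfl⟩
  have hs0 : 0 ≤ s := by linarith
  have hcube : - (3 / 4 * s ^ 3) ≤ (ss c i - n / 3) ^ 3 + (ss c j - n / 3) ^ 3 + (ss c k - n / 3) ^ 3 := by
    have e1 : ss c k - n / 3 = - s := by linarith
    obtain ⟨x, hx⟩ : ∃ x, x = ss c i - n / 3 := ⟨_, rfl⟩
    have e2 : ss c j - n / 3 = s - x := by linarith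
    rw [e1, e2, ← hx]
    nlinarith [mul_nonneg hs0 (sq_nonneg (x - s / 2))]
  rcases hs0.eq_or_lt with h0 | h0
  · rw [← h0] at hcube
    have : 0 ≤ n / 2 * ∑ v, mq E c v := by positivity
    linarith
  rcases le_or_gt (3 / 2 * s ^ 3) (n * ∑ v, mq E c v) with h1 | h1
  · linarith
  · have := layer_sum (fun v => n / 3 - dd E v) s h0 (fun t _ ht => 
      layer_count hE hC c i j k hij hall n s t hsd h0 (by have := abs_le.1 (hs k); linarith)
        (by have := abs_le.1 (hs i); linarith) h1 ht)
    have e : ∑ v, (n / 3 - dd E v) ^ 2 = ∑ v, (dd E v - n / 3) ^ 2 :=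
      Finset.sum_congr rfl fun v _ => by ring
    rw [e] at this
    have : 0 ≤ n / 2 * ∑ v, mq E c v := by positivity
    linarith

lemma main_good (hE : IsOrgraph E) (hC : ¬ HasInducedC4 E) (c : V → Fin 3) (n : ℝ) (hn : n = Fintype.card V)
    (hmq : ∀ v, mq E c v ≤ n / 1000000)
    (hs : ∀ i, |ss c i - n / 3| ≤ n / 1000000) :
    4 / 9 * n ^ 3 ≤ ∑ x, ∑ y, ∑ z, ph E x y z := by
  have h1 := good_ineq hE c (n / 1000000) (by rw [hn]) hmq (by rw [← hn]; exact hs)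
  have hsum := sum_ss c
  rw [← hn] at h1 hsum
  rw [Fin.sum_univ_three] at h1
  change _ + n / 2 * ∑ v, mq E c v ≤ _ at h1
  suffices H : 0 ≤ 3 * ∑ v, (dd E v - n / 3) ^ 2
      + ((ss c 0 - n / 3) ^ 3 + (ss c 1 - n / 3) ^ 3 + (ss c 2 - n / 3) ^ 3)
      + n / 2 * ∑ v, mq E c v by linarith
  rcases le_or_gt (ss c 2) (n / 3) with h | h
  · exact main_good_aux hE hC c 0 1 2 (by decide) (by decide) n hn hmq hs (by linarith) h
  rcases le_or_gt (ss c 1) (n / 3) with h' | h'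
  · have := main_good_aux hE hC c 0 2 1 (by decide) (by decide) n hn hmq hs (by linarith) h'
    linarith
  · have := main_good_aux hE hC c 1 2 0 (by decide) (by decide) n hn hmq hs (by linarith) (by linarith)
    linarith

end good3


section stab
open Classical

variable {V : Type*} {E : V → V → Prop} [Fintype V]

/-- induced cherries of the complement -/
noncomputable def cher (V : Type*) [Fintype V] (E : V → V → Prop) : ℝ :=
  ∑ x : V, ∑ y : V, ∑ z : V, hh E x y * hh E x z * (1 - hh E y z)

lemma cher_eq (E : V → V → Prop) : cher V E = ∑ x, pp E x ^ 2 - tt V E := by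
  have h : ∑ x, pp E x ^ 2 = ∑ x, ∑ y, ∑ z, hh E x y * hh E x z := by
    rw [ctr1]; exact Finset.sum_congr rfl fun x _ => by rw [sq]; rfl
  rw [h]
  unfold cher tt
  simp only [← Finset.sum_sub_distrib]
  refine Finset.sum_congr rfl fun x _ => Finset.sum_congr rfl fun y _ => Finset.sum_congr rfl fun z _ => ?_
  rw [hh_symm z x]; ring

lemma cher_nonneg (E : V → V → Prop) : 0 ≤ cher V E :=
  Finset.sum_nonneg fun x _ => Finset.sum_nonneg fun y _ => Finset.sum_nonneg fun z _ =>
    mul_nonneg (mul_nonneg (hh_nonneg _ _) (hh_nonneg _ _)) (by have := hh_le_one (E := E) y z; linarith)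

lemma sum_sq_shift (f : V → ℝ) (n : ℝ) (hn : n = Fintype.card V) :
    ∑ v, (f v - n / 3) ^ 2 = ∑ v, f v ^ 2 - 2 * n / 3 * ∑ v, f v + n ^ 3 / 9 := by
  have : ∀ v, (f v - n / 3) ^ 2 = f v ^ 2 - 2 * n / 3 * f v + n ^ 2 / 9 := fun v => by ring
  simp only [this, Finset.sum_add_distrib, Finset.sum_sub_distrib, ← Finset.mul_sum]
  simp only [Finset.sum_const, Finset.card_univ, nsmul_eq_mul, ← hn]
  ring

lemma stab_id (hE : IsOrgraph E) (n : ℝ) (hn : n = Fintype.card V) :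
    3 * ∑ v, (dd E v - n / 3) ^ 2 + ∑ v, (pp E v - n / 3) ^ 2 + 2 * cher V E
      = ∑ x, ∑ y, ∑ z, ph E x y z - 4 / 9 * n ^ 3 + n / 3 * (∑ v, pp E v - n ^ 2 / 3) := by
  rw [sum_sq_shift _ n hn, sum_sq_shift _ n hn, cher_eq, sum_ph]
  have e2 : n * (2 * ∑ x, dd E x) = n * (n ^ 2 - ∑ x, pp E x) := by rw [sum_dd hE, hn]
  nlinarith [e2]

/-- symmetric difference of non-neighbourhoods -/
noncomputable def sd (E : V → V → Prop) (u v : V) : ℝ :=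
  ∑ z, (hh E u z * (1 - hh E v z) + hh E v z * (1 - hh E u z))

noncomputable def cdeg (E : V → V → Prop) (u v : V) : ℝ := ∑ z, hh E u z * hh E v z

noncomputable def chd (E : V → V → Prop) (u : V) : ℝ := ∑ v, hh E u v * sd E u v

lemma sum_chd (E : V → V → Prop) : ∑ u, chd E u = 2 * cher V E := by
  have e1 : ∑ u, chd E u = cher V E + ∑ u : V, ∑ v : V, ∑ z : V, hh E v u * hh E v z * (1 - hh E u z) := by
    unfold chd sd cher
    simp only [Finset.mul_sum, ← Finset.sum_add_distrib]
    refine Finset.sum_congr rfl fun x _ => Finset.sum_congr rfl fun y _ => Finset.sum_congr rfl fun z _ => ?_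
    rw [hh_symm y x]; ring
  rw [e1, Finset.sum_comm (f := fun u v => ∑ z : V, hh E v u * hh E v z * (1 - hh E u z))]
  unfold cher; ring

lemma sum_cdeg (E : V → V → Prop) : ∑ u, ∑ v, (1 - hh E u v) * cdeg E u v = cher V E := by
  have : ∀ u v : V, (1 - hh E u v) * cdeg E u v = ∑ z, hh E z u * hh E z v * (1 - hh E u v) := by
    intro u v
    unfold cdeg
    rw [Finset.mul_sum]
    refine Finset.sum_congr rfl fun z _ => ?_
    rw [hh_symm z u, hh_symm z v]; ring
  simp only [this]
  unfold cher
  calc _ = ∑ x : V, ∑ z : V, ∑ y : V, hh E z x * hh E z y * (1 - hh E x y) :=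
        Finset.sum_congr rfl fun y _ => Finset.sum_comm
    _ = _ := Finset.sum_comm

lemma sd_nonneg (u v : V) : 0 ≤ sd E u v := Finset.sum_nonneg fun z _ => by
  have h1 := hh_nonneg (E := E) u z
  have h2 := hh_nonneg (E := E) v z
  have h3 := hh_le_one (E := E) u z
  have h4 := hh_le_one (E := E) v z
  exact add_nonneg (mul_nonneg h1 (by linarith)) (mul_nonneg h2 (by linarith))

lemma chd_nonneg (u : V) : 0 ≤ chd E u :=
  Finset.sum_nonneg fun v _ => mul_nonneg (hh_nonneg _ _) (sd_nonneg _ _)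

lemma cdeg_nonneg (u v : V) : 0 ≤ cdeg E u v :=
  Finset.sum_nonneg fun z _ => mul_nonneg (hh_nonneg _ _) (hh_nonneg _ _)

lemma tri_count (E : V → V → Prop) (n : ℝ) (hn : n = Fintype.card V) :
    ∑ x, ∑ y, ∑ z, (1 - hh E x y) * (1 - hh E x z) * (1 - hh E y z)
      = n ^ 3 - 3 * n * ∑ v, pp E v + 2 * ∑ v, pp E v ^ 2 + cher V E := by
  have h0 : ∀ f : V → V → ℝ, ∑ x, ∑ y, ∑ z : V, f x y = n * ∑ x, ∑ y, f x y := by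
    intro f
    simp only [Finset.sum_const, Finset.card_univ, nsmul_eq_mul, ← hn, Finset.mul_sum]
  have h1 : ∑ x, ∑ y, ∑ z : V, hh E x y = n * ∑ v, pp E v := h0 _
  have h2 : ∑ x, ∑ y : V, ∑ z : V, hh E x z = n * ∑ v, pp E v := by
    rw [← h1]; exact Finset.sum_congr rfl fun x _ => Finset.sum_comm
  have h3 : ∑ x : V, ∑ y : V, ∑ z : V, hh E y z = n * ∑ v, pp E v := by
    rw [← h2]; exact Finset.sum_comm
  have h4 : ∑ x, ∑ y, ∑ z, hh E x y * hh E x z = ∑ v, pp E v ^ 2 := by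
    rw [ctr1]; exact Finset.sum_congr rfl fun x _ => by rw [sq]; rfl
  have h5 : ∑ x, ∑ y, ∑ z, hh E y x * hh E y z = ∑ v, pp E v ^ 2 := by
    rw [ctr2]; exact Finset.sum_congr rfl fun x _ => by rw [sq]; rfl
  have h6 : ∑ x, ∑ y, ∑ z, hh E z x * hh E z y = ∑ v, pp E v ^ 2 := by
    rw [ctr3]; exact Finset.sum_congr rfl fun x _ => by rw [sq]; rfl
  have h7 : ∑ x : V, ∑ y : V, ∑ z : V, (1:ℝ) = n ^ 3 := by
    simp only [Finset.sum_const, Finset.card_univ, nsmul_eq_mul, ← hn]; ring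
  have e : ∀ x y z, (1 - hh E x y) * (1 - hh E x z) * (1 - hh E y z)
      = 1 - hh E x y - hh E x z - hh E y z + hh E x y * hh E x z + hh E y x * hh E y z
        + hh E z x * hh E z y - hh E x y * hh E y z * hh E z x := by
    intro x y z
    rw [hh_symm y x, hh_symm z x, hh_symm z y]; ring
  simp only [e, Finset.sum_add_distrib, Finset.sum_sub_distrib, h1, h2, h3, h4, h5, h6, h7]
  rw [cher_eq]; unfold tt; ring

lemma exists_tri (E : V → V → Prop) (n ξ e : ℝ) (hn : n = Fintype.card V) (hn0 : 0 < n)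
    (he : 45 / 2 * e < ξ) (he0 : 0 ≤ e) (he1 : e ≤ 1 / 1000)
    (hp : ∑ v, pp E v ≤ (1 / 3 + 3 * e) * n ^ 2)
    (hF : ∑ v, (pp E v - n / 3) ^ 2 + 2 * cher V E ≤ e * n ^ 3) :
    ∃ u : Fin 3 → V, (∀ i, chd E (u i) ≤ ξ * n ^ 2) ∧ (∀ i, (pp E (u i) - n / 3) ^ 2 ≤ ξ * n ^ 2) ∧
      (cdeg E (u 0) (u 1) ≤ ξ * n ∧ cdeg E (u 0) (u 2) ≤ ξ * n ∧ cdeg E (u 1) (u 2) ≤ ξ * n) := by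
  set g : V → ℝ := fun u => chd E u + (pp E u - n / 3) ^ 2 with hg
  set k : V → V → ℝ := fun u v => (1 - hh E u v) * cdeg E u v with hk
  have hg0 : ∀ u, 0 ≤ g u := fun u => add_nonneg (chd_nonneg u) (sq_nonneg _)
  have hk0 : ∀ u v, 0 ≤ k u v := fun u v =>
    mul_nonneg (by have := hh_le_one (E := E) u v; linarith) (cdeg_nonneg u v)
  have hc0 := cher_nonneg E
  have hsg : ∑ u, g u = 2 * cher V E + ∑ v, (pp E v - n / 3) ^ 2 := by
    rw [hg, Finset.sum_add_distrib, sum_chd]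
  have hsk : ∑ u, ∑ v, k u v = cher V E := sum_cdeg E
  set cost : V → V → V → ℝ := fun x y z => g x + g y + g z + n * k x y + n * k x z + n * k y z with hcost
  have hsum : ∑ x, ∑ y, ∑ z, cost x y z ≤ 9 / 2 * e * n ^ 5 := by
    have h0 : ∀ f : V → V → ℝ, ∑ x, ∑ y, ∑ z : V, f x y = n * ∑ x, ∑ y, f x y := by
      intro f
      simp only [Finset.sum_const, Finset.card_univ, nsmul_eq_mul, ← hn, Finset.mul_sum]
    have h1 : ∑ x, ∑ y, ∑ z : V, n * k x y = n ^ 2 * cher V E := by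
      rw [h0]; simp only [← Finset.mul_sum]; rw [hsk]; ring
    have h2 : ∑ x, ∑ y : V, ∑ z : V, n * k x z = n ^ 2 * cher V E := by
      rw [← h1]; exact Finset.sum_congr rfl fun x _ => Finset.sum_comm
    have h3 : ∑ x : V, ∑ y : V, ∑ z : V, n * k y z = n ^ 2 * cher V E := by
      rw [← h2]; exact Finset.sum_comm
    have h4 : ∑ x, ∑ y : V, ∑ z : V, g x = n ^ 2 * ∑ x, g x := by
      simp only [Finset.sum_const, Finset.card_univ, nsmul_eq_mul, ← hn, Finset.mul_sum]
      exact Finset.sum_congr rfl fun _ _ => by ring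
    have h5 : ∑ x : V, ∑ y : V, ∑ z : V, g y = n ^ 2 * ∑ x, g x := by
      rw [← h4]; exact Finset.sum_comm
    have h6 : ∑ x : V, ∑ y : V, ∑ z : V, g z = n ^ 2 * ∑ x, g x := by
      rw [← h5]; exact Finset.sum_congr rfl fun x _ => Finset.sum_comm
    simp only [hcost, Finset.sum_add_distrib]
    rw [h1, h2, h3, h4, h5, h6, hsg]
    have hs0 : 0 ≤ ∑ v, (pp E v - n / 3) ^ 2 := Finset.sum_nonneg fun v _ => sq_nonneg _
    have := mul_le_mul_of_nonneg_left hF (by positivity : 0 ≤ n ^ 2)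
    nlinarith [mul_nonneg (by positivity : 0 ≤ n ^ 2) hs0]
  have hcount : n ^ 3 / 5 ≤ ∑ x, ∑ y, ∑ z, (1 - hh E x y) * (1 - hh E x z) * (1 - hh E y z) := by
    rw [tri_count E n hn]
    have hs0 : 0 ≤ ∑ v, (pp E v - n / 3) ^ 2 := Finset.sum_nonneg fun v _ => sq_nonneg _
    rw [sum_sq_shift _ n hn] at hs0
    have h1 := mul_le_mul_of_nonneg_left hp hn0.le
    have h2 : e * n ^ 3 ≤ 1 / 1000 * n ^ 3 := mul_le_mul_of_nonneg_right he1 (by positivity)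
    nlinarith [h1, h2, hs0, pow_pos hn0 3]
  have hex : ∃ x y z, hh E x y = 0 ∧ hh E x z = 0 ∧ hh E y z = 0 ∧ cost x y z ≤ ξ * n ^ 2 := by
    by_contra hcon
    push Not at hcon
    have h1 : ∑ x, ∑ y, ∑ z, ξ * n ^ 2 * ((1 - hh E x y) * (1 - hh E x z) * (1 - hh E y z))
        ≤ ∑ x, ∑ y, ∑ z, cost x y z := by
      refine Finset.sum_le_sum fun x _ => Finset.sum_le_sum fun y _ => Finset.sum_le_sum fun z _ => ?_
      have hcz : 0 ≤ cost x y z := by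
        have := hg0 x; have := hg0 y; have := hg0 z
        have := mul_nonneg hn0.le (hk0 x y)
        have := mul_nonneg hn0.le (hk0 x z)
        have := mul_nonneg hn0.le (hk0 y z)
        simp only [hcost]; linarith
      rcases hh_cases (E := E) x y with h1 | h1
      · rcases hh_cases (E := E) x z with h2 | h2
        · rcases hh_cases (E := E) y z with h3 | h3
          · have := hcon x y z h1 h2 h3
            rw [h1, h2, h3]; linarith
          · rw [h3]; simpa using hcz
        · rw [h2]; simpa using hcz
      · rw [h1]; simpa using hcz
    simp only [← Finset.mul_sum] at h1
    have h2 : ξ * n ^ 2 * (n ^ 3 / 5) ≤ 9 / 2 * e * n ^ 5 :=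
      (mul_le_mul_of_nonneg_left hcount (by have : 0 ≤ ξ := by linarith
                                            positivity)).trans (h1.trans hsum)
    have h3 : 45 / 2 * e * n ^ 5 < ξ * n ^ 5 := mul_lt_mul_of_pos_right he (by positivity)
    nlinarith
  obtain ⟨x, y, z, h1, h2, h3, hc⟩ := hex
  have e1 : k x y = cdeg E x y := by simp [hk, h1]
  have e2 : k x z = cdeg E x z := by simp [hk, h2]
  have e3 : k y z = cdeg E y z := by simp [hk, h3]
  simp only [hcost] at hc
  rw [e1, e2, e3] at hc
  have c1 := mul_nonneg hn0.le (cdeg_nonneg (E := E) x y)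
  have c2 := mul_nonneg hn0.le (cdeg_nonneg (E := E) x z)
  have c3 := mul_nonneg hn0.le (cdeg_nonneg (E := E) y z)
  have gx := hg0 x
  have gy := hg0 y
  have gz := hg0 z
  have k1 : ∀ a, n * a ≤ ξ * n ^ 2 → a ≤ ξ * n := fun a ha => by
    by_contra hh'
    push Not at hh'
    nlinarith
  have k2 : ∀ u, g u ≤ ξ * n ^ 2 → chd E u ≤ ξ * n ^ 2 ∧ (pp E u - n / 3) ^ 2 ≤ ξ * n ^ 2 := fun u hu => by
    have a1 := chd_nonneg (E := E) u
    have a2 := sq_nonneg (pp E u - n / 3)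
    simp only [hg] at hu
    constructor <;> linarith
  refine ⟨![x, y, z], ?_, ?_, ?_⟩
  · intro i; fin_cases i
    · exact (k2 x (by linarith)).1
    · exact (k2 y (by linarith)).1
    · exact (k2 z (by linarith)).1
  · intro i; fin_cases i
    · exact (k2 x (by linarith)).2
    · exact (k2 y (by linarith)).2
    · exact (k2 z (by linarith)).2
  · refine ⟨k1 _ ?_, k1 _ ?_, k1 _ ?_⟩
    · change n * cdeg E x y ≤ _; linarith
    · change n * cdeg E x z ≤ _; linarith
    · change n * cdeg E y z ≤ _; linarith

end stab


section cls
open Classical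

variable {V : Type*} {E : V → V → Prop} [Fintype V]

/-- the three reference vertices are good -/
def GoodTri (E : V → V → Prop) (n : ℝ) (u : Fin 3 → V) : Prop :=
  (∀ i, chd E (u i) ≤ (1 / 10 ^ 24) * n ^ 2) ∧ (∀ i, |pp E (u i) - n / 3| ≤ (1 / 10 ^ 12) * n) ∧
  (∀ i j, i ≠ j → cdeg E (u i) (u j) ≤ (1 / 10 ^ 24) * n)

/-- badness weight -/
noncomputable def beta (E : V → V → Prop) (n : ℝ) (u : Fin 3 → V) (y : V) : ℝ :=
  (hh E (u 0) y * sd E (u 0) y + hh E (u 1) y * sd E (u 1) y + hh E (u 2) y * sd E (u 2) y) * (10 ^ 7 / n)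
  + (1 - (hh E (u 0) y + hh E (u 1) y + hh E (u 2) y) + hh E (u 0) y * hh E (u 1) y
    + hh E (u 0) y * hh E (u 2) y + hh E (u 1) y * hh E (u 2) y)

lemma sum_beta (n : ℝ) (hn : n = Fintype.card V) (hn0 : 0 < n) (u : Fin 3 → V) (hu : GoodTri E n u) :
    ∑ y, beta E n u y ≤ (4 / 10 ^ 12) * n := by
  have e : ∑ y, beta E n u y = (chd E (u 0) + chd E (u 1) + chd E (u 2)) * (10 ^ 7 / n)
      + (n - (pp E (u 0) + pp E (u 1) + pp E (u 2)) + cdeg E (u 0) (u 1) + cdeg E (u 0) (u 2)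
        + cdeg E (u 1) (u 2)) := by
    unfold beta chd pp cdeg
    simp only [Finset.sum_add_distrib, Finset.sum_sub_distrib, ← Finset.sum_mul]
    simp only [Finset.sum_const, Finset.card_univ, nsmul_eq_mul, ← hn, mul_one]
  rw [e]
  obtain ⟨h1, h2, h3⟩ := hu
  have a0 := h1 0
  have a1 := h1 1
  have a2 := h1 2
  have b0 := (abs_le.1 (h2 0)).1
  have b1 := (abs_le.1 (h2 1)).1
  have b2 := (abs_le.1 (h2 2)).1
  have c0 := h3 0 1 (by decide)
  have c1 := h3 0 2 (by decide)
  have c2 := h3 1 2 (by decide)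
  have d : (chd E (u 0) + chd E (u 1) + chd E (u 2)) * (10 ^ 7 / n) ≤ 3 * ((1 / 10 ^ 24) * n ^ 2) * (10 ^ 7 / n) :=
    mul_le_mul_of_nonneg_right (by linarith) (by positivity)
  have d2 : 3 * ((1 / 10 ^ 24) * n ^ 2) * (10 ^ 7 / n) = 3 / 10 ^ 17 * n := by
    field_simp
  rw [d2] at d
  norm_num at *
  linarith

lemma incl_excl {a b c : ℝ} (ha : a = 0 ∨ a = 1) (hb : b = 0 ∨ b = 1) (hc : c = 0 ∨ c = 1) :
    0 ≤ 1 - (a + b + c) + a * b + a * c + b * c := by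
  rcases ha with h | h <;> rcases hb with h' | h' <;> rcases hc with h'' | h'' <;> rw [h, h', h''] <;> norm_num

lemma beta_aux {n : ℝ} (hn0 : 0 < n) (a b c A B C : ℝ) (ha : a = 0 ∨ a = 1) (hb : b = 0 ∨ b = 1) (hc : c = 0 ∨ c = 1)
    (hA : 0 ≤ A) (hB : 0 ≤ B) (hC : 0 ≤ C) :
    0 ≤ (a * A + b * B + c * C) * (10 ^ 7 / n) + (1 - (a + b + c) + a * b + a * c + b * c) ∧
    (((a = 1 → 1 / 10 ^ 7 * n ≤ A) ∧ (b = 1 → 1 / 10 ^ 7 * n ≤ B) ∧ (c = 1 → 1 / 10 ^ 7 * n ≤ C)) →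
      1 ≤ (a * A + b * B + c * C) * (10 ^ 7 / n) + (1 - (a + b + c) + a * b + a * c + b * c)) ∧
    ((a = 1 ∧ 1 / 10 ^ 7 * n ≤ A ∨ b = 1 ∧ 1 / 10 ^ 7 * n ≤ B ∨ c = 1 ∧ 1 / 10 ^ 7 * n ≤ C) →
      1 ≤ (a * A + b * B + c * C) * (10 ^ 7 / n) + (1 - (a + b + c) + a * b + a * c + b * c)) := by
  have hie := incl_excl ha hb hc
  have ha0 : 0 ≤ a := by rcases ha with h | h <;> rw [h] <;> norm_num
  have hb0 : 0 ≤ b := by rcases hb with h | h <;> rw [h] <;> norm_num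
  have hc0 : 0 ≤ c := by rcases hc with h | h <;> rw [h] <;> norm_num
  have key : ∀ X, 1 / 10 ^ 7 * n ≤ X → 1 ≤ X * (10 ^ 7 / n) := by
    intro X hX
    have := mul_le_mul_of_nonneg_right hX (by positivity : 0 ≤ 10 ^ 7 / n)
    have e : 1 / 10 ^ 7 * n * (10 ^ 7 / n) = 1 := by field_simp
    linarith
  have n1 : 0 ≤ a * A * (10 ^ 7 / n) := by positivity
  have n2 : 0 ≤ b * B * (10 ^ 7 / n) := by positivity
  have n3 : 0 ≤ c * C * (10 ^ 7 / n) := by positivity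
  have k3 : (a = 1 ∧ 1 / 10 ^ 7 * n ≤ A ∨ b = 1 ∧ 1 / 10 ^ 7 * n ≤ B ∨ c = 1 ∧ 1 / 10 ^ 7 * n ≤ C) →
      1 ≤ (a * A + b * B + c * C) * (10 ^ 7 / n) + (1 - (a + b + c) + a * b + a * c + b * c) := by
    rintro (⟨h1, h2⟩ | ⟨h1, h2⟩ | ⟨h1, h2⟩)
    · have := key A h2
      rw [h1, one_mul] at n1
      have e : a * A * (10 ^ 7 / n) = A * (10 ^ 7 / n) := by rw [h1, one_mul]
      nlinarith
    · have := key B h2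
      have e : b * B * (10 ^ 7 / n) = B * (10 ^ 7 / n) := by rw [h1, one_mul]
      nlinarith
    · have := key C h2
      have e : c * C * (10 ^ 7 / n) = C * (10 ^ 7 / n) := by rw [h1, one_mul]
      nlinarith
  refine ⟨by nlinarith, ?_, k3⟩
  rintro ⟨h1, h2, h3⟩
  rcases ha with h | h
  · rcases hb with h' | h'
    · rcases hc with h'' | h''
      · rw [h, h', h'']; norm_num
      · exact k3 (Or.inr (Or.inr ⟨h'', h3 h''⟩))
    · exact k3 (Or.inr (Or.inl ⟨h', h2 h'⟩))
  · exact k3 (Or.inl ⟨h, h1 h⟩)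

lemma beta_nonneg {n : ℝ} (hn0 : 0 < n) (u : Fin 3 → V) (y : V) : 0 ≤ beta E n u y :=
  (beta_aux hn0 _ _ _ _ _ _ (hh_cases _ _) (hh_cases _ _) (hh_cases _ _) (sd_nonneg _ _) (sd_nonneg _ _)
    (sd_nonneg _ _)).1

lemma beta_one_all {n : ℝ} (hn0 : 0 < n) (u : Fin 3 → V) (y : V)
    (h : ∀ i, hh E (u i) y = 1 → 1 / 10 ^ 7 * n ≤ sd E (u i) y) : 1 ≤ beta E n u y :=
  (beta_aux hn0 _ _ _ _ _ _ (hh_cases _ _) (hh_cases _ _) (hh_cases _ _) (sd_nonneg _ _) (sd_nonneg _ _)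
    (sd_nonneg _ _)).2.1 ⟨h 0, h 1, h 2⟩

lemma beta_one_ex {n : ℝ} (hn0 : 0 < n) (u : Fin 3 → V) (y : V) (i : Fin 3)
    (h : hh E (u i) y = 1) (h' : 1 / 10 ^ 7 * n ≤ sd E (u i) y) : 1 ≤ beta E n u y :=
  (beta_aux hn0 _ _ _ _ _ _ (hh_cases _ _) (hh_cases _ _) (hh_cases _ _) (sd_nonneg _ _) (sd_nonneg _ _)
    (sd_nonneg _ _)).2.2 (by fin_cases i <;> simp_all)

lemma sd_eq (u v : V) : sd E u v = pp E u + pp E v - 2 * cdeg E u v := by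
  unfold sd pp cdeg
  rw [Finset.mul_sum, ← Finset.sum_add_distrib, ← Finset.sum_sub_distrib]
  exact Finset.sum_congr rfl fun z _ => by ring

lemma sd_tri (u v w : V) : sd E u v ≤ sd E u w + sd E v w := by
  unfold sd
  rw [← Finset.sum_add_distrib]
  refine Finset.sum_le_sum fun z _ => ?_
  rcases hh_cases (E := E) u z with h | h <;> rcases hh_cases (E := E) v z with h' | h' <;>
    rcases hh_cases (E := E) w z with h'' | h'' <;> rw [h, h', h''] <;> norm_num

lemma sd_sep {n : ℝ} (hn0 : 0 < n) (u : Fin 3 → V) (hu : GoodTri E n u) (i j : Fin 3) (hij : i ≠ j) (y : V)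
    (h : sd E (u i) y ≤ 1 / 10 ^ 7 * n) : 1 / 10 ^ 7 * n < sd E (u j) y := by
  have h1 := sd_tri (E := E) (u i) (u j) y
  rw [sd_eq] at h1
  have h2 := (abs_le.1 (hu.2.1 i)).1
  have h3 := (abs_le.1 (hu.2.1 j)).1
  have h4 := hu.2.2 i j hij
  norm_num at *
  linarith

/-- class function -/
noncomputable def clsf (E : V → V → Prop) (n : ℝ) (u : Fin 3 → V) (v : V) : Fin 3 :=
  if sd E (u 0) v ≤ 1 / 10 ^ 7 * n then 0 else if sd E (u 1) v ≤ 1 / 10 ^ 7 * n then 1 else 2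

noncomputable def goodW (E : V → V → Prop) (n : ℝ) (u : Fin 3 → V) : Finset V :=
  Finset.univ.filter fun v => ∃ i, sd E (u i) v ≤ 1 / 10 ^ 7 * n

lemma clsf_spec (n : ℝ) (u : Fin 3 → V) (v : V) (hv : v ∈ goodW E n u) :
    sd E (u (clsf E n u v)) v ≤ 1 / 10 ^ 7 * n := by
  simp only [goodW, Finset.mem_filter, Finset.mem_univ, true_and] at hv
  unfold clsf
  split_ifs with h1 h2
  · exact h1
  · exact h2
  · obtain ⟨i, hi⟩ := hv
    fin_cases i
    · exact absurd hi h1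
    · exact absurd hi h2
    · exact hi

lemma beta_W {n : ℝ} (hn0 : 0 < n) (u : Fin 3 → V) (hu : GoodTri E n u) (i : Fin 3) (y : V)
    (hy : y ∈ goodW E n u) : |hh E (u i) y - (if clsf E n u y = i then 1 else 0)| ≤ beta E n u y := by
  have hsp := clsf_spec n u y hy
  have hb0 := beta_nonneg (E := E) hn0 u y
  by_cases hc : clsf E n u y = i
  · rw [if_pos hc]
    rcases hh_cases (E := E) (u i) y with h | h
    · rw [h]
      have : 1 ≤ beta E n u y := by
        refine beta_one_all hn0 u y ?_
        intro j hj
        have hij : clsf E n u y ≠ j := by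
          rintro rfl
          rw [hc] at hj
          rw [hj] at h; norm_num at h
        exact (sd_sep hn0 u hu _ j hij y hsp).le
      simpa using this
    · rw [h]; simpa using hb0
  · rw [if_neg hc]
    rcases hh_cases (E := E) (u i) y with h | h
    · rw [h]; simpa using hb0
    · rw [h]
      have := beta_one_ex hn0 u y i h (sd_sep hn0 u hu _ i hc y hsp).le
      simpa using this

lemma beta_D {n : ℝ} (hn0 : 0 < n) (u : Fin 3 → V) (y : V)
    (hy : y ∉ goodW E n u) : 1 ≤ beta E n u y := by
  simp only [goodW, Finset.mem_filter, Finset.mem_univ, true_and, not_exists, not_le] at hy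
  exact beta_one_all hn0 u y fun i _ => (hy i).le

lemma card_D (n : ℝ) (hn : n = Fintype.card V) (hn0 : 0 < n) (u : Fin 3 → V) (hu : GoodTri E n u) :
    ((goodW E n u)ᶜ.card : ℝ) ≤ (4 / 10 ^ 12) * n :=
  (card_le_sum_of_one_le (fun y => beta E n u y) (fun y => beta_nonneg hn0 u y)
    (fun y hy => beta_D hn0 u y (Finset.mem_compl.1 hy))).trans (sum_beta n hn hn0 u hu)

lemma W_bound (hE : IsOrgraph E) (hC : ¬ HasInducedC4 E) (n : ℝ) (hn : n = Fintype.card V) (hn0 : 0 < n)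
    (u : Fin 3 → V) (hu : GoodTri E n u) :
    4 / 9 * ((goodW E n u).card : ℝ) ^ 3 ≤
      ∑ x ∈ goodW E n u, ∑ y ∈ goodW E n u, ∑ z ∈ goodW E n u, ph E x y z := by
  set W := goodW E n u with hW
  have hD := card_D n hn hn0 u hu
  have hwn : (W.card : ℝ) = n - (Wᶜ.card : ℝ) := by
    have := Finset.card_add_card_compl W
    have h2 : (W.card : ℝ) + (Wᶜ.card : ℝ) = n := by rw [hn]; exact_mod_cast this
    linarith
  have hw1 : n - (4 / 10 ^ 12) * n ≤ (W.card : ℝ) := by rw [hwn]; linarith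
  have hw2 : (W.card : ℝ) ≤ n := by rw [hwn]; have : (0:ℝ) ≤ (Wᶜ.card : ℝ) := by positivity
                                    linarith
  have hsb := sum_beta n hn hn0 u hu
  let E' : W → W → Prop := fun a b => E a b
  let c' : W → Fin 3 := fun a => clsf E n u a
  have hE' : IsOrgraph E' := ⟨fun v => hE.1 v, fun v w => hE.2 v w⟩
  have hC' : ¬ HasInducedC4 E' := by
    rintro ⟨a, b, c, d, h1, h2, h3, h4, h5, h6, h⟩
    exact hC ⟨a, b, c, d, fun h => h1 (Subtype.ext h), fun h => h2 (Subtype.ext h), fun h => h3 (Subtype.ext h),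
      fun h => h4 (Subtype.ext h), fun h => h5 (Subtype.ext h), fun h => h6 (Subtype.ext h), h⟩
  have hsumW : ∀ f : V → ℝ, ∑ y : W, f y = ∑ y ∈ W, f y := fun f => Finset.sum_coe_sort W f
  have key := main_good hE' hC' c' (W.card : ℝ) (by simp) ?_ ?_
  · have e : ∑ x : W, ∑ y : W, ∑ z : W, ph E' x y z = ∑ x ∈ W, ∑ y ∈ W, ∑ z ∈ W, ph E x y z := by
      rw [← hsumW (fun x => ∑ y ∈ W, ∑ z ∈ W, ph E x y z)]
      refine Finset.sum_congr rfl fun x _ => ?_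
      rw [← hsumW (fun y => ∑ z ∈ W, ph E x y z)]
      refine Finset.sum_congr rfl fun y _ => ?_
      rw [← hsumW (fun z => ph E x y z)]
      rfl
    rw [e] at key
    exact key
  · intro v
    have h1 : mq E' c' v ≤ ∑ y : W, ((hh E (u (c' v)) y * (1 - hh E v y) + hh E v y * (1 - hh E (u (c' v)) y))
        + beta E n u y) := by
      unfold mq
      rw [← Finset.sum_add_distrib]
      refine Finset.sum_le_sum fun y _ => ?_
      have hb := beta_W hn0 u hu (c' v) y.1 y.2
      have e1 : mmm E' c' v y + qqq E' c' v y = |hh E v y - (if clsf E n u y = c' v then 1 else 0)| := by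
        have : hh E' v y = hh E v y := rfl
        unfold mmm qqq
        rw [this]
        by_cases hc : c' v = c' y
        · rw [if_pos hc, if_pos hc, if_pos hc.symm]
          rcases hh_cases (E := E) v y with h | h <;> rw [h] <;> norm_num
        · rw [if_neg hc, if_neg hc, if_neg (fun h => hc h.symm)]
          rcases hh_cases (E := E) v y with h | h <;> rw [h] <;> norm_num
      have e2 : |hh E v y - hh E (u (c' v)) y| =
          hh E (u (c' v)) y * (1 - hh E v y) + hh E v y * (1 - hh E (u (c' v)) y) := by
        rcases hh_cases (E := E) v y with h | h <;> rcases hh_cases (E := E) (u (c' v)) y with h' | h' <;>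
          rw [h, h'] <;> norm_num
      rw [e1, ← e2]
      exact (abs_sub_le _ (hh E (u (c' v)) y) _).trans (by linarith)
    rw [Finset.sum_add_distrib, hsumW (fun y => hh E (u (c' v)) y * (1 - hh E v y) + hh E v y * (1 - hh E (u (c' v)) y)),
      hsumW (fun y => beta E n u y)] at h1
    have h2 : ∑ y ∈ W, (hh E (u (c' v)) y * (1 - hh E v y) + hh E v y * (1 - hh E (u (c' v)) y))
        ≤ sd E (u (c' v)) v := by
      refine Finset.sum_le_sum_of_subset_of_nonneg (Finset.subset_univ _) fun y _ _ => ?_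
      have h1 := hh_nonneg (E := E) (u (c' v)) y
      have h2 := hh_nonneg (E := E) v y
      have h3 := hh_le_one (E := E) (u (c' v)) y
      have h4 := hh_le_one (E := E) v y
      exact add_nonneg (mul_nonneg h1 (by linarith)) (mul_nonneg h2 (by linarith))
    have h3 : ∑ y ∈ W, beta E n u y ≤ ∑ y, beta E n u y :=
      Finset.sum_le_sum_of_subset_of_nonneg (Finset.subset_univ _) fun y _ _ => beta_nonneg hn0 u y
    have h4 := clsf_spec n u v.1 v.2
    change sd E (u (c' v)) v ≤ _ at h4
    norm_num at *
    linarith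
  · intro i
    have e1 : ss c' i = ∑ y ∈ W, (if clsf E n u y = i then (1:ℝ) else 0) := by
      rw [← hsumW (fun y => if clsf E n u y = i then (1:ℝ) else 0)]; rfl
    have e2 : pp E (u i) = ∑ y ∈ W, hh E (u i) y + ∑ y ∈ Wᶜ, hh E (u i) y := by
      rw [Finset.sum_add_sum_compl]; rfl
    have e3 : ∑ y, beta E n u y = ∑ y ∈ W, beta E n u y + ∑ y ∈ Wᶜ, beta E n u y := by
      rw [Finset.sum_add_sum_compl]
    have h1 : |∑ y ∈ W, hh E (u i) y - ss c' i| ≤ ∑ y ∈ W, beta E n u y := by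
      rw [e1, ← Finset.sum_sub_distrib]
      exact (Finset.abs_sum_le_sum_abs _ _).trans (Finset.sum_le_sum fun y hy => beta_W hn0 u hu i y hy)
    have h2 : ∑ y ∈ Wᶜ, hh E (u i) y ≤ ∑ y ∈ Wᶜ, beta E n u y :=
      Finset.sum_le_sum fun y hy => (hh_le_one _ _).trans (beta_D hn0 u y (Finset.mem_compl.1 hy))
    have h3 : 0 ≤ ∑ y ∈ Wᶜ, hh E (u i) y := Finset.sum_nonneg fun y _ => hh_nonneg _ _
    have h4 := abs_le.1 (hu.2.1 i)
    have h5 := abs_le.1 h1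
    rw [abs_le]
    obtain ⟨h4a, h4b⟩ := h4
    obtain ⟨h5a, h5b⟩ := h5
    norm_num at *
    constructor <;> linarith

end cls


section badv
open Classical

variable {V : Type*} {E : V → V → Prop} [Fintype V]

lemma arith_core {a b c : ℝ} (ha : 0 ≤ a) (hb : 0 ≤ b) (hc : 0 ≤ c) (hba : b ≤ a) (hca : c ≤ a)
    (ha1 : a ≤ 1 / 3 + 1 / 10 ^ 12) (hd : 1 / (2 * 10 ^ 7) ≤ 1 / 3 - a + (b + c)) :
    2 / 10 ^ 9 ≤ 1 / 9 + (a + b + c) ^ 2 - 2 * (a ^ 2 + b ^ 2 + c ^ 2) := by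
  have h1 : b ^ 2 + c ^ 2 ≤ a * (b + c) := by nlinarith
  have h2 : b ^ 2 + c ^ 2 ≤ (b + c) ^ 2 := by nlinarith [mul_nonneg hb hc]
  have h3 : (1 / 3 - a) * (1 / 3 + a) + a * (b + c) ≤ 1 / 9 + (a + b + c) ^ 2 - 2 * (a ^ 2 + b ^ 2 + c ^ 2) := by
    nlinarith
  refine le_trans ?_ h3
  have h4 : 0 ≤ a * (b + c) := by positivity
  rcases le_or_gt (1 / (4 * 10 ^ 7)) (1 / 3 - a) with h | h
  · have : 1 / (4 * 10 ^ 7) * (1 / 3) ≤ (1 / 3 - a) * (1 / 3 + a) := by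
      refine mul_le_mul h (by linarith) (by norm_num) ?_
      refine le_trans (by norm_num) h
    norm_num at *
    linarith
  · have h5 : 1 / (4 * 10 ^ 7) ≤ b + c := by norm_num at *; linarith
    have h6 : 1 / 4 ≤ a := by norm_num at *; linarith
    have h7 : 1 / 4 * (1 / (4 * 10 ^ 7)) ≤ a * (b + c) := mul_le_mul h6 h5 (by norm_num) ha
    have h8 : - (1 / 10 ^ 12) ≤ (1 / 3 - a) * (1 / 3 + a) := by
      rcases le_or_gt a (1 / 3) with h | h
      · have : 0 ≤ (1 / 3 - a) * (1 / 3 + a) := mul_nonneg (by linarith) (by linarith)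
        norm_num; linarith
      · have : (a - 1 / 3) * (1 / 3 + a) ≤ 1 / 10 ^ 12 * 1 :=
          mul_le_mul (by linarith) (by norm_num at *; linarith) (by linarith) (by norm_num)
        linarith
    norm_num at *
    linarith

lemma arith_core' {a b c : ℝ} (ha : 0 ≤ a) (hb : 0 ≤ b) (hc : 0 ≤ c)
    (ha1 : a ≤ 1 / 3 + 1 / 10 ^ 12) (hb1 : b ≤ 1 / 3 + 1 / 10 ^ 12) (hc1 : c ≤ 1 / 3 + 1 / 10 ^ 12)
    (hda : 1 / (2 * 10 ^ 7) ≤ 1 / 3 - a + (b + c))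
    (hdb : 1 / (2 * 10 ^ 7) ≤ 1 / 3 - b + (a + c))
    (hdc : 1 / (2 * 10 ^ 7) ≤ 1 / 3 - c + (a + b)) :
    2 / 10 ^ 9 ≤ 1 / 9 + (a + b + c) ^ 2 - 2 * (a ^ 2 + b ^ 2 + c ^ 2) := by
  rcases le_total a b with h | h
  · rcases le_total b c with h' | h'
    · have := arith_core hc ha hb (h.trans h') h' hc1 hdc
      linarith
    · have := arith_core hb ha hc h h' hb1 hdb
      linarith
  · rcases le_total a c with h' | h'
    · have := arith_core hc ha hb h' (h.trans h') hc1 hdc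
      linarith
    · exact arith_core ha hb hc h h' ha1 hda

lemma arith_bad {a b c A B C p d F : ℝ} (ha : 0 ≤ a) (hb : 0 ≤ b) (hc : 0 ≤ c)
    (haA : a ≤ A) (hbB : b ≤ B) (hcC : c ≤ C)
    (hA : |A - 1 / 3| ≤ 1 / 10 ^ 12) (hB : |B - 1 / 3| ≤ 1 / 10 ^ 12) (hC : |C - 1 / 3| ≤ 1 / 10 ^ 12)
    (hp1 : a + b + c - 4 / 10 ^ 12 ≤ p) (hp2 : p ≤ a + b + c + 4 / 10 ^ 12)
    (hda : 1 / 10 ^ 7 ≤ p + A - 2 * a) (hdb : 1 / 10 ^ 7 ≤ p + B - 2 * b) (hdc : 1 / 10 ^ 7 ≤ p + C - 2 * c)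
    (hF : d ^ 2 + 2 / 3 * (1 - p - d) - 2 / 10 ^ 12 + p ^ 2
      + 2 * (a * (A - a) + b * (B - b) + c * (C - c)) - 12 / 10 ^ 24 ≤ F) :
    4 / 9 + 1 / 10 ^ 9 ≤ F := by
  obtain ⟨hA1, hA2⟩ := abs_le.1 hA
  obtain ⟨hB1, hB2⟩ := abs_le.1 hB
  obtain ⟨hC1, hC2⟩ := abs_le.1 hC
  have h := arith_core' ha hb hc (by linarith) (by linarith) (by linarith)
    (by norm_num at *; linarith) (by norm_num at *; linarith) (by norm_num at *; linarith)
  have h1 : a * (1 / 3 - 1 / 10 ^ 12) ≤ a * A := mul_le_mul_of_nonneg_left (by linarith) ha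
  have h2 : b * (1 / 3 - 1 / 10 ^ 12) ≤ b * B := mul_le_mul_of_nonneg_left (by linarith) hb
  have h3 : c * (1 / 3 - 1 / 10 ^ 12) ≤ c * C := mul_le_mul_of_nonneg_left (by linarith) hc
  have hσ : a + b + c ≤ 2 := by norm_num at *; linarith
  obtain ⟨s, hs⟩ : ∃ s, s = a + b + c := ⟨_, rfl⟩
  obtain ⟨q, hq⟩ : ∃ q, q = p - s := ⟨_, rfl⟩
  have hp : p = s + q := by linarith
  have hs0 : 0 ≤ s := by linarith
  have h4 : s * (- (4 / 10 ^ 12)) ≤ s * q := mul_le_mul_of_nonneg_left (by linarith) hs0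
  have h5 : s ^ 2 - 16 / 10 ^ 12 ≤ p ^ 2 := by
    rw [hp]; norm_num at *; nlinarith [sq_nonneg q]
  rw [← hs] at h
  norm_num at *
  nlinarith [sq_nonneg (d - 1 / 3)]

lemma phi_eq (v : V) : ∑ y, ∑ z, ph E v y z = dd E v ^ 2 + 2 * ∑ y, oo E y v * dd E y + pp E v ^ 2
    + 2 * ∑ y, ∑ z, hh E v y * hh E y z * (1 - hh E v z) := by
  have h1 : ∑ y, ∑ z, oo E v y * oo E v z = dd E v ^ 2 := by
    rw [sq]; unfold dd; rw [Finset.sum_mul_sum]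
  have h2 : ∑ y, ∑ z, oo E y v * oo E y z = ∑ y, oo E y v * dd E y := by
    unfold dd; simp only [Finset.mul_sum]
  have h3 : ∑ y, ∑ z, oo E z v * oo E z y = ∑ y, oo E y v * dd E y := by
    rw [Finset.sum_comm]; exact h2
  have h4 : ∑ y, ∑ z, hh E v y * hh E v z = pp E v ^ 2 := by
    rw [sq]; unfold pp; rw [Finset.sum_mul_sum]
  have h5 : ∑ y, ∑ z, hh E z v * hh E z y = ∑ y, ∑ z, hh E y v * hh E y z := by
    rw [Finset.sum_comm]
  have h6 : ∑ y, ∑ z, hh E v y * hh E y z * (1 - hh E v z)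
      = ∑ y, ∑ z, hh E y v * hh E y z - ∑ y, ∑ z, hh E v y * hh E y z * hh E z v := by
    rw [← Finset.sum_sub_distrib]
    refine Finset.sum_congr rfl fun y _ => ?_
    rw [← Finset.sum_sub_distrib]
    refine Finset.sum_congr rfl fun z _ => ?_
    rw [hh_symm y v, hh_symm z v]; ring
  have h7 : ∑ y, ∑ z, 2 * (hh E v y * hh E y z * hh E z v) = 2 * ∑ y, ∑ z, hh E v y * hh E y z * hh E z v := by
    simp only [Finset.mul_sum]
  rw [h6]
  unfold ph
  simp only [Finset.sum_add_distrib, Finset.sum_sub_distrib]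
  rw [h1, h2, h3, h4, h5, h7]
  ring

lemma out_part (hE : IsOrgraph E) (n r : ℝ) (hn : n = Fintype.card V) (v : V)
    (hd : ∑ y, |dd E y - n / 3| ≤ r) :
    n / 3 * (n - pp E v - dd E v) - r ≤ ∑ y, oo E y v * dd E y := by
  have h1 : ∑ y, oo E y v = n - pp E v - dd E v := by
    have h : ∑ y : V, (oo E v y + oo E y v + hh E v y) = n := by
      simp [oo_sum hE, hn]
    simp only [Finset.sum_add_distrib] at h
    unfold pp dd; linarith
  have h2 : ∑ y, (n / 3 * oo E y v - |dd E y - n / 3|) ≤ ∑ y, oo E y v * dd E y := by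
    refine Finset.sum_le_sum fun y _ => ?_
    have ha := neg_abs_le (dd E y - n / 3)
    have hb := abs_nonneg (dd E y - n / 3)
    rcases oo_cases (E := E) y v with h | h <;> rw [h] <;> linarith
  rw [Finset.sum_sub_distrib, ← Finset.mul_sum, h1] at h2
  linarith

lemma cher_part (n : ℝ) (hn : n = Fintype.card V) (hn0 : 0 < n) (u : Fin 3 → V) (hu : GoodTri E n u) (v : V) :
    cdeg E (u 0) v * (pp E (u 0) - cdeg E (u 0) v) + cdeg E (u 1) v * (pp E (u 1) - cdeg E (u 1) v)
      + cdeg E (u 2) v * (pp E (u 2) - cdeg E (u 2) v) - 6 / 10 ^ 24 * n ^ 2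
      ≤ ∑ y, ∑ z, hh E v y * hh E y z * (1 - hh E v z) := by
  set R : V → ℝ := fun y => ∑ z, hh E y z * (1 - hh E v z) with hR
  have hR0 : ∀ y, 0 ≤ R y := fun y => Finset.sum_nonneg fun z _ =>
    mul_nonneg (hh_nonneg _ _) (by have := hh_le_one (E := E) v z; linarith)
  have hRn : ∀ y, R y ≤ n := fun y => by
    have : R y ≤ ∑ z : V, (1:ℝ) := Finset.sum_le_sum fun z _ => by
      rcases hh_cases (E := E) y z with h | h <;> rcases hh_cases (E := E) v z with h' | h' <;>
        rw [h, h'] <;> norm_num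
    simpa [← hn] using this
  have hRi : ∀ i y, pp E (u i) - cdeg E (u i) v - sd E (u i) y ≤ R y := fun i y => by
    unfold pp cdeg sd
    rw [← Finset.sum_sub_distrib, ← Finset.sum_sub_distrib]
    refine Finset.sum_le_sum fun z _ => ?_
    rcases hh_cases (E := E) y z with h | h <;> rcases hh_cases (E := E) v z with h' | h' <;>
      rcases hh_cases (E := E) (u i) z with h'' | h'' <;> rw [h, h', h''] <;> norm_num
  have e0 : ∑ y, ∑ z, hh E v y * hh E y z * (1 - hh E v z) = ∑ y, hh E v y * R y := by
    simp only [hR, Finset.mul_sum, mul_assoc]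
  rw [e0]
  have hi : ∀ i, cdeg E (u i) v * (pp E (u i) - cdeg E (u i) v) - chd E (u i)
      ≤ ∑ y, hh E (u i) y * (hh E v y * R y) := by
    intro i
    have e1 : cdeg E (u i) v * (pp E (u i) - cdeg E (u i) v) =
        ∑ y, hh E (u i) y * hh E v y * (pp E (u i) - cdeg E (u i) v) := by
      rw [← Finset.sum_mul]; rfl
    rw [e1]
    unfold chd
    rw [← Finset.sum_sub_distrib]
    refine Finset.sum_le_sum fun y _ => ?_
    have h1 := hRi i y
    have h2 := sd_nonneg (E := E) (u i) y
    rcases hh_cases (E := E) (u i) y with h | h <;> rcases hh_cases (E := E) v y with h' | h' <;>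
      rw [h, h'] <;> linarith
  have hpt : ∑ y, (hh E (u 0) y * (hh E v y * R y) + hh E (u 1) y * (hh E v y * R y) + hh E (u 2) y * (hh E v y * R y)
      - n * (hh E (u 0) y * hh E (u 1) y + hh E (u 0) y * hh E (u 2) y + hh E (u 1) y * hh E (u 2) y))
      ≤ ∑ y, hh E v y * R y := by
    refine Finset.sum_le_sum fun y _ => ?_
    have h1 := hR0 y
    have h2 := hRn y
    rcases hh_cases (E := E) v y with h' | h' <;> rcases hh_cases (E := E) (u 0) y with k0 | k0 <;>
      rcases hh_cases (E := E) (u 1) y with k1 | k1 <;> rcases hh_cases (E := E) (u 2) y with k2 | k2 <;>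
      rw [h', k0, k1, k2] <;> linarith
  simp only [Finset.sum_add_distrib, Finset.sum_sub_distrib, ← Finset.mul_sum] at hpt
  have c0 := mul_le_mul_of_nonneg_left (hu.2.2 0 1 (by decide)) hn0.le
  have c1 := mul_le_mul_of_nonneg_left (hu.2.2 0 2 (by decide)) hn0.le
  have c2 := mul_le_mul_of_nonneg_left (hu.2.2 1 2 (by decide)) hn0.le
  unfold cdeg at c0 c1 c2
  have a0 := hi 0
  have a1 := hi 1
  have a2 := hi 2
  have b0 := hu.1 0
  have b1 := hu.1 1
  have b2 := hu.1 2
  nlinarith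

lemma pp_part (n : ℝ) (hn : n = Fintype.card V) (hn0 : 0 < n) (u : Fin 3 → V) (hu : GoodTri E n u) (v : V) :
    cdeg E (u 0) v + cdeg E (u 1) v + cdeg E (u 2) v - 4 / 10 ^ 12 * n ≤ pp E v ∧
    pp E v ≤ cdeg E (u 0) v + cdeg E (u 1) v + cdeg E (u 2) v + 4 / 10 ^ 12 * n := by
  have c0 := hu.2.2 0 1 (by decide)
  have c1 := hu.2.2 0 2 (by decide)
  have c2 := hu.2.2 1 2 (by decide)
  have p0 := (abs_le.1 (hu.2.1 0)).1
  have p1 := (abs_le.1 (hu.2.1 1)).1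
  have p2 := (abs_le.1 (hu.2.1 2)).1
  have h1 : cdeg E (u 0) v + cdeg E (u 1) v + cdeg E (u 2) v
      ≤ pp E v + (cdeg E (u 0) (u 1) + cdeg E (u 0) (u 2) + cdeg E (u 1) (u 2)) := by
    unfold cdeg pp
    simp only [← Finset.sum_add_distrib]
    refine Finset.sum_le_sum fun y _ => ?_
    rcases hh_cases (E := E) v y with h' | h' <;> rcases hh_cases (E := E) (u 0) y with k0 | k0 <;>
      rcases hh_cases (E := E) (u 1) y with k1 | k1 <;> rcases hh_cases (E := E) (u 2) y with k2 | k2 <;>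
      rw [h', k0, k1, k2] <;> norm_num
  have h2 : pp E v ≤ cdeg E (u 0) v + cdeg E (u 1) v + cdeg E (u 2) v + (n - (pp E (u 0) + pp E (u 1) + pp E (u 2))
      + (cdeg E (u 0) (u 1) + cdeg E (u 0) (u 2) + cdeg E (u 1) (u 2))) := by
    have : n = ∑ y : V, (1:ℝ) := by simp [hn]
    rw [this]
    unfold cdeg pp
    simp only [← Finset.sum_add_distrib, ← Finset.sum_sub_distrib]
    refine Finset.sum_le_sum fun y _ => ?_
    rcases hh_cases (E := E) v y with h' | h' <;> rcases hh_cases (E := E) (u 0) y with k0 | k0 <;>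
      rcases hh_cases (E := E) (u 1) y with k1 | k1 <;> rcases hh_cases (E := E) (u 2) y with k2 | k2 <;>
      rw [h', k0, k1, k2] <;> norm_num
  norm_num at *
  constructor <;> linarith

lemma cdeg_le (u v : V) : cdeg E u v ≤ pp E u := by
  unfold cdeg pp
  refine Finset.sum_le_sum fun y _ => ?_
  exact mul_le_of_le_one_right (hh_nonneg _ _) (hh_le_one _ _)

lemma bad_vertex (hE : IsOrgraph E) (n : ℝ) (hn : n = Fintype.card V) (hn0 : 0 < n) (u : Fin 3 → V)
    (hu : GoodTri E n u) (hd : ∑ y, |dd E y - n / 3| ≤ 1 / 10 ^ 12 * n ^ 2) (v : V) (hv : v ∉ goodW E n u) :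
    (4 / 9 + 1 / 10 ^ 9) * n ^ 2 ≤ ∑ y, ∑ z, ph E v y z := by
  have h1 := phi_eq (E := E) v
  have h2 := out_part hE n _ hn v hd
  have h3 := cher_part n hn hn0 u hu v
  obtain ⟨h4, h5⟩ := pp_part n hn hn0 u hu v
  simp only [goodW, Finset.mem_filter, Finset.mem_univ, true_and, not_exists, not_le] at hv
  have s : ∀ i, 1 / 10 ^ 7 * n ≤ pp E v + pp E (u i) - 2 * cdeg E (u i) v := fun i => by
    have := hv i
    rw [sd_eq] at this; linarith
  have key : 4 / 9 + 1 / 10 ^ 9 ≤ (∑ y, ∑ z, ph E v y z) / n ^ 2 := by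
    have habs : ∀ i, |pp E (u i) / n - 1 / 3| ≤ 1 / 10 ^ 12 := fun i => by
      have e : pp E (u i) / n - 1 / 3 = (pp E (u i) - n / 3) / n := by field_simp
      rw [e, abs_div, abs_of_pos hn0, div_le_iff₀ hn0]
      exact hu.2.1 i
    have hs' : ∀ i, 1 / 10 ^ 7 ≤ pp E v / n + pp E (u i) / n - 2 * (cdeg E (u i) v / n) := fun i => by
      have e : pp E v / n + pp E (u i) / n - 2 * (cdeg E (u i) v / n)
        = (pp E v + pp E (u i) - 2 * cdeg E (u i) v) / n := by ring
      rw [e, le_div_iff₀ hn0]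
      exact s i
    refine arith_bad (a := cdeg E (u 0) v / n) (b := cdeg E (u 1) v / n) (c := cdeg E (u 2) v / n)
      (A := pp E (u 0) / n) (B := pp E (u 1) / n) (C := pp E (u 2) / n) (p := pp E v / n) (d := dd E v / n)
      (div_nonneg (cdeg_nonneg _ _) hn0.le) (div_nonneg (cdeg_nonneg _ _) hn0.le)
      (div_nonneg (cdeg_nonneg _ _) hn0.le) (div_le_div_of_nonneg_right (cdeg_le _ _) hn0.le)
      (div_le_div_of_nonneg_right (cdeg_le _ _) hn0.le) (div_le_div_of_nonneg_right (cdeg_le _ _) hn0.le)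
      (habs 0) (habs 1) (habs 2) ?_ ?_ (hs' 0) (hs' 1) (hs' 2) ?_
    · have e : cdeg E (u 0) v / n + cdeg E (u 1) v / n + cdeg E (u 2) v / n - 4 / 10 ^ 12
        = (cdeg E (u 0) v + cdeg E (u 1) v + cdeg E (u 2) v - 4 / 10 ^ 12 * n) / n := by field_simp
      rw [e]; exact div_le_div_of_nonneg_right h4 hn0.le
    · have e : cdeg E (u 0) v / n + cdeg E (u 1) v / n + cdeg E (u 2) v / n + 4 / 10 ^ 12
        = (cdeg E (u 0) v + cdeg E (u 1) v + cdeg E (u 2) v + 4 / 10 ^ 12 * n) / n := by field_simp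
      rw [e]; exact div_le_div_of_nonneg_right h5 hn0.le
    · rw [le_div_iff₀ (by positivity)]
      have e : ((dd E v / n) ^ 2 + 2 / 3 * (1 - pp E v / n - dd E v / n) - 2 / 10 ^ 12 + (pp E v / n) ^ 2 +
          2 * (cdeg E (u 0) v / n * (pp E (u 0) / n - cdeg E (u 0) v / n) +
          cdeg E (u 1) v / n * (pp E (u 1) / n - cdeg E (u 1) v / n) +
          cdeg E (u 2) v / n * (pp E (u 2) / n - cdeg E (u 2) v / n)) - 12 / 10 ^ 24) * n ^ 2
          = dd E v ^ 2 + 2 * (n / 3 * (n - pp E v - dd E v) - 1 / 10 ^ 12 * n ^ 2) + pp E v ^ 2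
          + 2 * (cdeg E (u 0) v * (pp E (u 0) - cdeg E (u 0) v) + cdeg E (u 1) v * (pp E (u 1) - cdeg E (u 1) v)
      + cdeg E (u 2) v * (pp E (u 2) - cdeg E (u 2) v) - 6 / 10 ^ 24 * n ^ 2) := by
        field_simp
        ring
      rw [e, h1]
      linarith
  rwa [le_div_iff₀ (by positivity)] at key

end badv


section final
open Classical

variable {V : Type*} {E : V → V → Prop} [Fintype V]

lemma ph_swap12 (x y z : V) : ph E x y z = ph E y x z := by
  unfold ph
  rw [hh_symm z y, hh_symm z x, hh_symm y x]; ring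

lemma ph_swap13 (x y z : V) : ph E x y z = ph E z y x := by
  unfold ph
  rw [hh_symm z y, hh_symm z x, hh_symm y x]; ring

lemma abs_sum_small (f : V → ℝ) (n : ℝ) (hn : n = Fintype.card V) (hn0 : 0 < n)
    (h : ∑ v, f v ^ 2 ≤ 1 / 10 ^ 24 * n ^ 3) : ∑ v, |f v| ≤ 1 / 10 ^ 12 * n ^ 2 := by
  have h1 : ∑ v, |f v| ≤ ∑ v, (10 ^ 12 / (2 * n) * f v ^ 2 + 1 / (2 * 10 ^ 12) * n) := by
    refine Finset.sum_le_sum fun v _ => ?_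
    have h2 : 0 ≤ 10 ^ 12 / (2 * n) * (|f v| - 1 / 10 ^ 12 * n) ^ 2 := by positivity
    have e : 10 ^ 12 / (2 * n) * (|f v| - 1 / 10 ^ 12 * n) ^ 2
        = 10 ^ 12 / (2 * n) * |f v| ^ 2 + 1 / (2 * 10 ^ 12) * n - |f v| := by field_simp; ring
    rw [e, sq_abs] at h2
    linarith
  rw [Finset.sum_add_distrib, ← Finset.mul_sum] at h1
  simp only [Finset.sum_const, Finset.card_univ, nsmul_eq_mul, ← hn] at h1
  have h3 := mul_le_mul_of_nonneg_left h (by positivity : 0 ≤ 10 ^ 12 / (2 * n))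
  have e : 10 ^ 12 / (2 * n) * (1 / 10 ^ 24 * n ^ 3) = 1 / (2 * 10 ^ 12) * n ^ 2 := by field_simp
  rw [e] at h3
  have e2 : n * (1 / (2 * 10 ^ 12) * n) = 1 / (2 * 10 ^ 12) * n ^ 2 := by ring
  rw [e2] at h1
  norm_num at *
  linarith

lemma split_bound (hE : IsOrgraph E) (n : ℝ) (hn : n = Fintype.card V) (W : Finset V) :
    ∑ x ∈ W, ∑ y ∈ W, ∑ z ∈ W, ph E x y z + 3 * ∑ v ∈ Wᶜ, ∑ y, ∑ z, ph E v y z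
      - 6 * (Wᶜ.card : ℝ) ^ 2 * n ≤ ∑ x, ∑ y, ∑ z, ph E x y z := by
  set e : V → ℝ := fun v => if v ∈ W then 0 else 1 with he
  have hpt : ∑ x, ∑ y, ∑ z, ((1 - e x) * ((1 - e y) * ((1 - e z) * ph E x y z)) + e x * ph E x y z + e y * ph E x y z
      + e z * ph E x y z - 2 * (e x * e y) - 2 * (e x * e z) - 2 * (e y * e z)) ≤ ∑ x, ∑ y, ∑ z, ph E x y z := by
    refine Finset.sum_le_sum fun x _ => Finset.sum_le_sum fun y _ => Finset.sum_le_sum fun z _ => ?_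
    obtain ⟨h0, h1⟩ := ph_bounds hE x y z
    simp only [he]
    split_ifs <;> linarith
  have hWs : ∀ f : V → ℝ, ∑ x, (1 - e x) * f x = ∑ x ∈ W, f x := fun f => by
    rw [← Finset.sum_filter_add_sum_filter_not Finset.univ (fun x => x ∈ W)]
    rw [Finset.filter_mem_eq_inter, Finset.univ_inter]
    have a1 : ∑ x ∈ W, (1 - e x) * f x = ∑ x ∈ W, f x :=
      Finset.sum_congr rfl fun x hx => by simp [he, hx]
    have a2 : ∑ x ∈ Finset.univ.filter (fun x => x ∉ W), (1 - e x) * f x = 0 :=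
      Finset.sum_eq_zero fun x hx => by simp [he, (Finset.mem_filter.1 hx).2]
    rw [a1, a2, add_zero]
  have hDs : ∀ f : V → ℝ, ∑ x, e x * f x = ∑ x ∈ Wᶜ, f x := fun f => by
    have h1 := hWs f
    have h2 := Finset.sum_add_sum_compl W f
    have h3 : ∑ x, (1 - e x) * f x = ∑ x, f x - ∑ x, e x * f x := by
      rw [← Finset.sum_sub_distrib]; exact Finset.sum_congr rfl fun x _ => by ring
    linarith
  have hes : ∑ x, e x = Wᶜ.card := by
    have := hDs (fun _ => 1)
    simpa using this
  have t1 : ∑ x, ∑ y, ∑ z, (1 - e x) * ((1 - e y) * ((1 - e z) * ph E x y z))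
      = ∑ x ∈ W, ∑ y ∈ W, ∑ z ∈ W, ph E x y z := by
    simp only [← Finset.mul_sum, hWs]
  have t2 : ∑ x, ∑ y, ∑ z, e x * ph E x y z = ∑ v ∈ Wᶜ, ∑ y, ∑ z, ph E v y z := by
    simp only [← Finset.mul_sum, hDs]
  have t3 : ∑ x, ∑ y, ∑ z, e y * ph E x y z = ∑ v ∈ Wᶜ, ∑ y, ∑ z, ph E v y z := by
    rw [← t2, Finset.sum_comm]
    refine Finset.sum_congr rfl fun x _ => Finset.sum_congr rfl fun y _ => Finset.sum_congr rfl fun z _ => ?_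
    rw [ph_swap12]
  have t4 : ∑ x, ∑ y, ∑ z, e z * ph E x y z = ∑ v ∈ Wᶜ, ∑ y, ∑ z, ph E v y z := by
    rw [← t3]
    refine Finset.sum_congr rfl fun x _ => ?_
    rw [Finset.sum_comm]
    refine Finset.sum_congr rfl fun y _ => Finset.sum_congr rfl fun z _ => ?_
    rw [ph_swap12 x z y, ph_swap13 z x y, ph_swap12 y x z]
  have u0 : ∀ x : V, ∑ y, e x * e y = e x * Wᶜ.card := fun x => by rw [← Finset.mul_sum, hes]
  have t5 : ∑ x, ∑ y, ∑ z : V, 2 * (e x * e y) = 2 * (Wᶜ.card : ℝ) ^ 2 * n := by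
    simp only [Finset.sum_const, Finset.card_univ, nsmul_eq_mul, ← hn, ← Finset.mul_sum, hes, ← Finset.sum_mul]
    ring
  have t6 : ∑ x, ∑ y : V, ∑ z : V, 2 * (e x * e z) = 2 * (Wᶜ.card : ℝ) ^ 2 * n := by
    rw [← t5]; exact Finset.sum_congr rfl fun x _ => Finset.sum_comm
  have t7 : ∑ x : V, ∑ y : V, ∑ z : V, 2 * (e y * e z) = 2 * (Wᶜ.card : ℝ) ^ 2 * n := by
    rw [← t6]; exact Finset.sum_comm
  simp only [Finset.sum_add_distrib, Finset.sum_sub_distrib] at hpt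
  rw [t1, t2, t3, t4, t5, t6, t7] at hpt
  linarith

theorem main_real_s1 (hE : IsOrgraph E) (hC : ¬ HasInducedC4 E) (n : ℝ) (hn : n = Fintype.card V) (hn0 : 0 < n)
    (hp : ∑ v, pp E v ≤ (1 / 3 + 3 * (1 / 10 ^ 26)) * n ^ 2) :
    4 / 9 * n ^ 3 ≤ ∑ x, ∑ y, ∑ z, ph E x y z := by
  by_contra hcon
  push Not at hcon
  have hid := stab_id hE n hn
  have hd0 : 0 ≤ ∑ v, (dd E v - n / 3) ^ 2 := Finset.sum_nonneg fun v _ => sq_nonneg _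
  have hp0 : 0 ≤ ∑ v, (pp E v - n / 3) ^ 2 := Finset.sum_nonneg fun v _ => sq_nonneg _
  have hc0 := cher_nonneg E
  have hF : 3 * ∑ v, (dd E v - n / 3) ^ 2 + ∑ v, (pp E v - n / 3) ^ 2 + 2 * cher V E ≤ 1 / 10 ^ 26 * n ^ 3 := by
    have := mul_le_mul_of_nonneg_left hp hn0.le
    nlinarith
  obtain ⟨u, hu1, hu2, hu3, hu4, hu5⟩ := exists_tri E n (1 / 10 ^ 24) (1 / 10 ^ 26) hn hn0 (by norm_num) (by norm_num)
    (by norm_num) hp (by linarith)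
  have hsymm : ∀ a b : V, cdeg E a b = cdeg E b a := fun a b => by
    unfold cdeg; exact Finset.sum_congr rfl fun z _ => mul_comm _ _
  have hu : GoodTri E n u := by
    refine ⟨hu1, fun i => ?_, ?_⟩
    · refine abs_le_of_sq_le_sq ?_ (by positivity)
      refine (hu2 i).trans (le_of_eq ?_)
      ring
    · intro i j hij
      fin_cases i <;> fin_cases j
      · exact absurd rfl hij
      · exact hu3
      · exact hu4
      · exact (hsymm _ _).trans_le hu3
      · exact absurd rfl hij
      · exact hu5
      · exact (hsymm _ _).trans_le hu4
      · exact (hsymm _ _).trans_le hu5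
      · exact absurd rfl hij
  have hn3 : 0 < n ^ 3 := by positivity
  have hd : ∑ y, |dd E y - n / 3| ≤ 1 / 10 ^ 12 * n ^ 2 :=
    abs_sum_small _ n hn hn0 (by norm_num at *; linarith)
  have hW := W_bound hE hC n hn hn0 u hu
  have hD := card_D n hn hn0 u hu
  have hsp := split_bound hE n hn (goodW E n u)
  set W := goodW E n u with hWd
  have hwn : (W.card : ℝ) = n - (Wᶜ.card : ℝ) := by
    have := Finset.card_add_card_compl W
    have h2 : (W.card : ℝ) + (Wᶜ.card : ℝ) = n := by rw [hn]; exact_mod_cast this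
    linarith
  have hb : (Wᶜ.card : ℝ) * ((4 / 9 + 1 / 10 ^ 9) * n ^ 2) ≤ ∑ v ∈ Wᶜ, ∑ y, ∑ z, ph E v y z := by
    have : ∑ v ∈ Wᶜ, (4 / 9 + 1 / 10 ^ 9) * n ^ 2 ≤ ∑ v ∈ Wᶜ, ∑ y, ∑ z, ph E v y z :=
      Finset.sum_le_sum fun v hv => bad_vertex hE n hn hn0 u hu hd v (Finset.mem_compl.1 hv)
    rw [Finset.sum_const, nsmul_eq_mul] at this
    exact this
  rw [hwn] at hW
  have hk0 : (0:ℝ) ≤ (Wᶜ.card : ℝ) := by positivity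
  generalize (Wᶜ.card : ℝ) = k at *
  have hkn : k ≤ n := by norm_num at *; linarith
  have h1 : n ^ 3 - 3 * n ^ 2 * k ≤ (n - k) ^ 3 := by
    have : 0 ≤ k ^ 2 * (3 * n - k) := mul_nonneg (sq_nonneg _) (by linarith)
    nlinarith
  have h2 : k * n * k ≤ k * n * (4 / 10 ^ 12 * n) := mul_le_mul_of_nonneg_left hD (by positivity)
  have h3 : 0 ≤ k * n ^ 2 := by positivity
  norm_num at *
  nlinarith

end final


/-- There is an absolute ε₀ > 0 such that every C⃗₄-free orgraph on n vertices
(n large) of underlying edge density at least 2/3 − ε₀ has at least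
(4/9 − ε)·C(n,3) edges in FDF(Γ). -/
theorem stmt1 :
    ∃ ε₀ : ℝ, ε₀ > 0 ∧ ∀ ε : ℝ, ε > 0 → ∃ N : ℕ, ∀ n : ℕ, N ≤ n →
      ∀ E : Fin n → Fin n → Prop,
        IsOrgraph E → ¬ HasInducedC4 E →
        ((2 : ℝ) / 3 - ε₀) * (n.choose 2 : ℝ) ≤ (underlyingEdgeCount (Fin n) E : ℝ) →
        ((4 : ℝ) / 9 - ε) * (n.choose 3 : ℝ) ≤ (fdfCount (Fin n) E : ℝ) := by
  refine ⟨1 / 10 ^ 26, by norm_num, ?_⟩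
  intro ε hε
  refine ⟨10 ^ 26 + ⌈3 / ε⌉₊, ?_⟩
  intro n hN E hE hC hden
  have hN1 : (10 : ℝ) ^ 26 + 3 / ε ≤ n := by
    have h1 : ((10 ^ 26 + ⌈3 / ε⌉₊ : ℕ) : ℝ) ≤ n := Nat.cast_le.2 hN
    push_cast at h1
    have h2 := Nat.le_ceil (3 / ε)
    linarith
  have h3ε : 0 < 3 / ε := by positivity
  have hn1 : (10 : ℝ) ^ 26 ≤ n := by linarith
  have hn2 : 3 / ε ≤ n := by
    have : (0:ℝ) < 10 ^ 26 := by positivity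
    linarith
  have hn0 : (0:ℝ) < n := by linarith
  have hcard : (n : ℝ) = Fintype.card (Fin n) := by simp
  have hpp := sum_pp_le E
  rw [← hcard] at hpp
  rw [Nat.cast_choose_two] at hden
  have hmain := main_real_s1 hE hC (n : ℝ) hcard hn0 (by
    have h1 := mul_le_mul_of_nonneg_right hn1 hn0.le
    norm_num at *
    nlinarith)
  have hle := sum_ph_le hE
  rw [← hcard] at hle
  have hch : ((n.choose 3 : ℕ) : ℝ) ≤ (n : ℝ) ^ 3 / 6 := by
    have := Nat.choose_le_pow_div (α := ℝ) 3 n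
    simpa [Nat.factorial] using this
  have hf0 : (0:ℝ) ≤ (fdfCount (Fin n) E : ℝ) := by positivity
  have hc0 : (0:ℝ) ≤ (n.choose 3 : ℝ) := by positivity
  rcases le_or_gt (4 / 9 - ε) 0 with h | h
  · exact (mul_nonpos_of_nonpos_of_nonneg h hc0).trans hf0
  · have h1 := mul_le_mul_of_nonneg_left hch h.le
    have h2 : 3 ≤ n * ε := by rwa [div_le_iff₀ hε] at hn2
    have h3 : 3 * (n : ℝ) ^ 2 ≤ n * ε * (n : ℝ) ^ 2 := mul_le_mul_of_nonneg_right h2 (by positivity)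
    nlinarith
end

section
/- For every ε > 0 there exists N such that for every n ≥ N, every C⃗4-free orgraph Γ on n vertices satisfies: the number of edges of FDF(Γ) is at least (7/16 − ε)·C(n,3). -/
open Finset

/-! Certificate: Cholesky-type factors and the corresponding Gram matrices. -/

def facE : List (List ℤ) :=
  [[203, 0, 0, 0, 0, 0, 0, 0, 0],
   [194, 63, 0, 0, 0, 0, 0, 0, 0],
   [-36, -162, 171, 0, 0, 0, 0, 0, 0],
   [73, -60, -4, 6, 0, 0, 0, 0, 0],
   [-24, -5, -59, 5, 148, 0, 0, 0, 0],
   [-175, -160, 180, -1, 0, 6, 0, 0, 0],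
   [-16, 268, -125, -9, 0, 6, 7, 0, 0],
   [-53, 163, -186, -2, 0, -5, -1, 2, 0],
   [-268, -4, 11, -5, 0, 0, 1, -1, 4]]

def facN : List (List ℤ) :=
  [[101, 0, 0, 0, 0, 0],
   [103, 113, -2, 129, 0, 0],
   [-14, -135, -2, 0, 1, 0],
   [103, 113, -2, 129, 0, 0],
   [24, 129, 0, 0, 0, 0],
   [-43, 52, 2, -88, -2, 95],
   [-14, -135, -2, 0, 1, 0],
   [-43, 52, 2, -88, -2, 95],
   [-130, -100, 3, 0, 0, 0]]

def gramE : List (List ℤ) :=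
  [[41209, 39382, -7308, 14819, -4872, -35525, -3248, -10759, -54404],
   [39382, 41605, -17190, 10382, -4971, -44030, 13780, -13, -52244],
   [-7308, -17190, 56781, 6408, -8415, 63000, -64215, -56304, 12177],
   [14819, 10382, 6408, 8981, -1186, -3901, -16802, -12917, -19398],
   [-4872, -4971, -8415, -1186, 26011, -5625, 6374, 11421, 5778],
   [-35525, -44030, 63000, -3901, -5625, 88662, -62535, -50313, 49525],
   [-3248, 13780, -64215, -16802, 6374, -62535, 87871, 67763, 1893],
   [-10759, -13, -56304, -12917, 11421, -50313, 67763, 64008, 11513],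
   [-54404, -52244, 12177, -19398, 5778, 49525, 1893, 11513, 72004]]

def gramN : List (List ℤ) :=
  [[10201, 10403, -1414, 10403, 2424, -4343, -1414, -4343, -13130],
   [10403, 40023, -16693, 40023, 17049, -9909, -16693, -9909, -24696],
   [-1414, -16693, 18426, -16693, -17751, -6424, 18426, -6424, 15314],
   [10403, 40023, -16693, 40023, 17049, -9909, -16693, -9909, -24696],
   [2424, 17049, -17751, 17049, 17217, 5676, -17751, 5676, -16020],
   [-4343, -9909, -6424, -9909, 5676, 21330, -6424, 21330, 396],
   [-1414, -16693, 18426, -16693, -17751, -6424, 18426, -6424, 15314],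
   [-4343, -9909, -6424, -9909, 5676, 21330, -6424, 21330, 396],
   [-13130, -24696, 15314, -24696, -16020, 396, 15314, 396, 26909]]

/-- Table lookup; a row is selected by the two codes of a vertex towards the typed pair. -/
def look (T : List (List ℤ)) (b d k : ℕ) : ℤ := (T.getD (3 * b + d) []).getD k 0

/-- The FDF indicator in terms of codes `a = s x y`, `b = s x z`, `d = s y z`. -/
def fdfCode (a b d : ℕ) : ℤ :=
  if (a = 2 ∧ b = 2) ∨ (a = 0 ∧ d = 2) ∨ (b = 0 ∧ d = 0) ∨
     (a = 1 ∧ b = 1) ∨ (a = 1 ∧ d = 1) ∨ (b = 1 ∧ d = 1) then 1 else 0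

def quadCode (a b c d e : ℕ) : ℤ :=
  if a = 2 then look gramE b d (3 * c + e)
  else if a = 1 then look gramN b d (3 * c + e) else 0

def k0 (a b c d e _f : ℕ) : ℤ :=
  490000 * fdfCode a b d - 214375 - 16 * quadCode a b c d e

def k1 (a b c d e f : ℕ) : ℤ := k0 a b c d e f + k0 (2 - a) d e b c f

def k2 (a b c d e f : ℕ) : ℤ :=
  k1 a b c d e f + k1 (2 - d) (2 - b) f (2 - a) e c + k1 b a c (2 - d) f e

def k3 (a b c d e f : ℕ) : ℤ :=
  k2 a b c d e f + k2 (2 - e) (2 - f) (2 - c) d (2 - a) (2 - b) +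
    k2 c b a (2 - f) (2 - e) (2 - d) + k2 a c b e d (2 - f)

def c4Code (a b c d e f : ℕ) : Prop :=
  (b = 1 ∧ e = 1 ∧ ((a = 2 ∧ d = 2 ∧ f = 2 ∧ c = 0) ∨ (a = 0 ∧ d = 0 ∧ f = 0 ∧ c = 2))) ∨
  (c = 1 ∧ d = 1 ∧ ((a = 2 ∧ e = 2 ∧ f = 0 ∧ b = 0) ∨ (a = 0 ∧ e = 0 ∧ f = 2 ∧ b = 2))) ∨
  (a = 1 ∧ f = 1 ∧ ((b = 2 ∧ d = 0 ∧ e = 2 ∧ c = 0) ∨ (b = 0 ∧ d = 2 ∧ e = 0 ∧ c = 2)))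

instance (a b c d e f : ℕ) : Decidable (c4Code a b c d e f) := by
  unfold c4Code; infer_instance

set_option synthInstance.maxHeartbeats 400000 in
set_option synthInstance.maxSize 100000 in
theorem k3_nonneg : ∀ a < 3, ∀ b < 3, ∀ c < 3, ∀ d < 3, ∀ e < 3, ∀ f < 3,
    c4Code a b c d e f ∨ 0 ≤ k3 a b c d e f := by
  decide +kernel

theorem gramE_eq : ∀ b < 3, ∀ d < 3, ∀ c < 3, ∀ e < 3,
    look gramE b d (3 * c + e) = ((List.range 9).map (fun k => look facE b d k * look facE c e k)).sum := by
  decide +kernel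

theorem gramN_eq : ∀ b < 3, ∀ d < 3, ∀ c < 3, ∀ e < 3,
    look gramN b d (3 * c + e) = ((List.range 9).map (fun k => look facN b d k * look facN c e k)).sum := by
  decide +kernel

open Classical in
/-- Code of an ordered pair: 2 for an out-edge, 0 for an in-edge, 1 otherwise. -/
noncomputable def pcode {V : Type*} (E : V → V → Prop) (x y : V) : ℕ :=
  if E x y then 2 else if E y x then 0 else 1

theorem pcode_lt {V : Type*} (E : V → V → Prop) (x y : V) : pcode E x y < 3 := by
  unfold pcode; split_ifs <;> norm_num

theorem pcode_two {V : Type*} (E : V → V → Prop) (x y : V) : pcode E x y = 2 ↔ E x y := by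
  unfold pcode; split_ifs <;> simp_all

theorem pcode_zero {V : Type*} (E : V → V → Prop) (hO : IsOrgraph E) (x y : V) :
    pcode E x y = 0 ↔ E y x := by
  have := hO.2 x y
  unfold pcode; split_ifs <;> simp_all

theorem pcode_one {V : Type*} (E : V → V → Prop) (x y : V) :
    pcode E x y = 1 ↔ ¬ E x y ∧ ¬ E y x := by
  unfold pcode; split_ifs <;> simp_all

theorem pcode_symm {V : Type*} (E : V → V → Prop) (hO : IsOrgraph E) (x y : V) :
    pcode E x y = 2 - pcode E y x := by
  have := hO.2 x y
  unfold pcode; split_ifs <;> simp_all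

theorem cycle_false {V : Type*} (E : V → V → Prop) (hO : IsOrgraph E) (hC : ¬ HasInducedC4 E)
    (x y z w : V) (h1 : E x y) (h2 : E y z) (h3 : E z w) (h4 : E w x)
    (h5 : ¬ E x z ∧ ¬ E z x) (h6 : ¬ E y w ∧ ¬ E w y) : False := by
  refine hC ⟨x, y, z, w, ?_, ?_, ?_, ?_, ?_, ?_, h1, h2, h3, h4, hO.2 _ _ h1, hO.2 _ _ h2,
    hO.2 _ _ h3, hO.2 _ _ h4, h5.1, h5.2, h6.1, h6.2⟩
  · rintro rfl; exact hO.1 _ h1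
  · rintro rfl; exact hO.2 _ _ h1 h2
  · rintro rfl; exact hO.1 _ h4
  · rintro rfl; exact hO.1 _ h2
  · rintro rfl; exact hO.2 _ _ h2 h3
  · rintro rfl; exact hO.1 _ h3

theorem not_c4Code {V : Type*} (E : V → V → Prop) (hO : IsOrgraph E) (hC : ¬ HasInducedC4 E)
    (x y z w : V) : ¬ c4Code (pcode E x y) (pcode E x z) (pcode E x w)
      (pcode E y z) (pcode E y w) (pcode E z w) := by
  have key := cycle_false E hO hC
  unfold c4Code
  simp only [pcode_two, pcode_one, pcode_zero E hO]
  rintro (⟨h5, h6, (⟨h1, h2, h3, h4⟩ | ⟨h1, h2, h3, h4⟩)⟩ |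
    ⟨h5, h6, (⟨h1, h2, h3, h4⟩ | ⟨h1, h2, h3, h4⟩)⟩ |
    ⟨h5, h6, (⟨h1, h2, h3, h4⟩ | ⟨h1, h2, h3, h4⟩)⟩)
  · exact key x y z w h1 h2 h3 h4 h5 h6
  · exact key x w z y h4 h3 h2 h1 h5 h6.symm
  · exact key x y w z h1 h2 h3 h4 h5 h6
  · exact key x z w y h4 h3 h2 h1 h5 h6.symm
  · exact key x z y w h1 h2 h3 h4 h5 h6
  · exact key x w y z h4 h3 h2 h1 h5 h6.symm

open Classical in
theorem fdfCode_eq {V : Type*} (E : V → V → Prop) (hO : IsOrgraph E) (x y z : V) :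
    fdfCode (pcode E x y) (pcode E x z) (pcode E y z) = if FDFedge E x y z then 1 else 0 := by
  unfold fdfCode
  refine if_congr ?_ rfl rfl
  simp only [pcode_two, pcode_one, pcode_zero E hO, FDFedge]
  tauto

section sums

variable {V : Type*} [Fintype V]

theorem sum_swap01 (K : V → V → V → V → ℤ) :
    ∑ x, ∑ y, ∑ z, ∑ w, K y x z w = ∑ x, ∑ y, ∑ z, ∑ w, K x y z w :=
  Finset.sum_comm

theorem sum_swap12 (K : V → V → V → V → ℤ) :
    ∑ x, ∑ y, ∑ z, ∑ w, K x z y w = ∑ x, ∑ y, ∑ z, ∑ w, K x y z w :=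
  Finset.sum_congr rfl fun _ _ => Finset.sum_comm

theorem sum_swap23 (K : V → V → V → V → ℤ) :
    ∑ x, ∑ y, ∑ z, ∑ w, K x y w z = ∑ x, ∑ y, ∑ z, ∑ w, K x y z w :=
  Finset.sum_congr rfl fun _ _ => Finset.sum_congr rfl fun _ _ => Finset.sum_comm

theorem sum_swap02 (K : V → V → V → V → ℤ) :
    ∑ x, ∑ y, ∑ z, ∑ w, K z y x w = ∑ x, ∑ y, ∑ z, ∑ w, K x y z w := by
  rw [sum_swap01 (fun x y z w => K z x y w), sum_swap12 (fun x y z w => K y x z w), sum_swap01]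

theorem sum_swap13 (K : V → V → V → V → ℤ) :
    ∑ x, ∑ y, ∑ z, ∑ w, K x w z y = ∑ x, ∑ y, ∑ z, ∑ w, K x y z w := by
  rw [sum_swap12 (fun x y z w => K x w y z), sum_swap23 (fun x y z w => K x z y w), sum_swap12]

theorem sum_swap03 (K : V → V → V → V → ℤ) :
    ∑ x, ∑ y, ∑ z, ∑ w, K w y z x = ∑ x, ∑ y, ∑ z, ∑ w, K x y z w := by
  rw [sum_swap01 (fun x y z w => K w x z y), sum_swap13 (fun x y z w => K y x z w), sum_swap01]

/-- Symmetrization over the symmetric group on four points, as a product of transversals. -/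
theorem sum_nonneg_of_symm (K K1 K2 K3 : V → V → V → V → ℤ)
    (h1 : ∀ x y z w, K1 x y z w = K x y z w + K y x z w)
    (h2 : ∀ x y z w, K2 x y z w = K1 x y z w + K1 z y x w + K1 x z y w)
    (h3 : ∀ x y z w, K3 x y z w = K2 x y z w + K2 w y z x + K2 x w z y + K2 x y w z)
    (hK : ∀ x y z w, 0 ≤ K3 x y z w) :
    0 ≤ ∑ x, ∑ y, ∑ z, ∑ w, K x y z w := by
  have e1 : ∑ x, ∑ y, ∑ z, ∑ w, K1 x y z w = 2 * ∑ x, ∑ y, ∑ z, ∑ w, K x y z w := by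
    simp only [h1, Finset.sum_add_distrib]
    rw [sum_swap01 K]; ring
  have e2 : ∑ x, ∑ y, ∑ z, ∑ w, K2 x y z w = 3 * ∑ x, ∑ y, ∑ z, ∑ w, K1 x y z w := by
    simp only [h2, Finset.sum_add_distrib]
    rw [sum_swap02 K1, sum_swap12 K1]; ring
  have e3 : ∑ x, ∑ y, ∑ z, ∑ w, K3 x y z w = 4 * ∑ x, ∑ y, ∑ z, ∑ w, K2 x y z w := by
    simp only [h3, Finset.sum_add_distrib]
    rw [sum_swap03 K2, sum_swap13 K2, sum_swap23 K2]; ring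
  have e4 : 0 ≤ ∑ x, ∑ y, ∑ z, ∑ w, K3 x y z w :=
    Finset.sum_nonneg fun x _ => Finset.sum_nonneg fun y _ => Finset.sum_nonneg fun z _ =>
      Finset.sum_nonneg fun w _ => hK x y z w
  omega

theorem gram_sum_nonneg (T F : List (List ℤ))
    (hT : ∀ b < 3, ∀ d < 3, ∀ c < 3, ∀ e < 3, look T b d (3 * c + e) =
      ((List.range 9).map (fun k => look F b d k * look F c e k)).sum)
    (p q : V → ℕ) (hp : ∀ z, p z < 3) (hq : ∀ z, q z < 3) :
    0 ≤ ∑ z, ∑ w, look T (p z) (q z) (3 * p w + q w) := by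
  have : ∑ z, ∑ w, look T (p z) (q z) (3 * p w + q w)
      = ∑ k ∈ Finset.range 9, (∑ z, look F (p z) (q z) k) ^ 2 := by
    have h : ∀ z w, look T (p z) (q z) (3 * p w + q w)
        = ∑ k ∈ Finset.range 9, look F (p z) (q z) k * look F (p w) (q w) k := by
      intro z w
      rw [hT _ (hp z) _ (hq z) _ (hp w) _ (hq w)]
      simp [List.range_succ, Finset.sum_range_succ]
      ring
    simp only [h]
    rw [Finset.sum_congr rfl fun z _ => Finset.sum_comm, Finset.sum_comm]
    refine Finset.sum_congr rfl fun k _ => ?_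
    rw [sq, Finset.sum_mul_sum]
  rw [this]
  exact Finset.sum_nonneg fun k _ => sq_nonneg _

theorem ordered_count (E : V → V → Prop) (hO : IsOrgraph E) (hC : ¬ HasInducedC4 E) :
    7 * (Fintype.card V : ℤ) ^ 4 ≤ 16 * (Fintype.card V *
      ∑ x, ∑ y, ∑ z, fdfCode (pcode E x y) (pcode E x z) (pcode E y z)) := by
  have h0 : 0 ≤ ∑ x, ∑ y, ∑ z, ∑ w, k0 (pcode E x y) (pcode E x z) (pcode E x w)
      (pcode E y z) (pcode E y w) (pcode E z w) := by
    refine sum_nonneg_of_symm _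
      (fun x y z w => k1 (pcode E x y) (pcode E x z) (pcode E x w)
        (pcode E y z) (pcode E y w) (pcode E z w))
      (fun x y z w => k2 (pcode E x y) (pcode E x z) (pcode E x w)
        (pcode E y z) (pcode E y w) (pcode E z w))
      (fun x y z w => k3 (pcode E x y) (pcode E x z) (pcode E x w)
        (pcode E y z) (pcode E y w) (pcode E z w)) ?_ ?_ ?_ ?_
    · intro x y z w
      rw [pcode_symm E hO y x]; rfl
    · intro x y z w
      simp only [k2]
      rw [pcode_symm E hO z y, pcode_symm E hO z x, pcode_symm E hO y x]
    · intro x y z w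
      simp only [k3]
      rw [pcode_symm E hO w y, pcode_symm E hO w z, pcode_symm E hO w x, pcode_symm E hO y x,
        pcode_symm E hO z x, pcode_symm E hO z y]
    · intro x y z w
      rcases k3_nonneg _ (pcode_lt E x y) _ (pcode_lt E x z) _ (pcode_lt E x w)
        _ (pcode_lt E y z) _ (pcode_lt E y w) _ (pcode_lt E z w) with h | h
      · exact absurd h (not_c4Code E hO hC x y z w)
      · exact h
  have h1 : 0 ≤ ∑ x, ∑ y, ∑ z, ∑ w, quadCode (pcode E x y) (pcode E x z) (pcode E x w)
      (pcode E y z) (pcode E y w) := by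
    refine Finset.sum_nonneg fun x _ => Finset.sum_nonneg fun y _ => ?_
    unfold quadCode
    split_ifs
    · exact gram_sum_nonneg gramE facE gramE_eq _ _ (pcode_lt E x) (pcode_lt E y)
    · exact gram_sum_nonneg gramN facN gramN_eq _ _ (pcode_lt E x) (pcode_lt E y)
    · simp
  have h2 : ∑ x, ∑ y, ∑ z, ∑ w, k0 (pcode E x y) (pcode E x z) (pcode E x w)
      (pcode E y z) (pcode E y w) (pcode E z w) =
      490000 * (Fintype.card V *
        ∑ x, ∑ y, ∑ z, fdfCode (pcode E x y) (pcode E x z) (pcode E y z))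
      - 214375 * (Fintype.card V : ℤ) ^ 4
      - 16 * ∑ x, ∑ y, ∑ z, ∑ w, quadCode (pcode E x y) (pcode E x z) (pcode E x w)
      (pcode E y z) (pcode E y w) := by
    simp only [k0, Finset.sum_sub_distrib, ← Finset.mul_sum, Finset.sum_const, Finset.card_univ,
      nsmul_eq_mul]
    ring
  rw [h2] at h0
  omega

end sums

open Classical in
theorem ordered_le (V : Type*) [Fintype V] (E : V → V → Prop) (hO : IsOrgraph E) :
    ∑ x, ∑ y, ∑ z, fdfCode (pcode E x y) (pcode E x z) (pcode E y z)
      ≤ 6 * (fdfCount V E : ℤ) + 3 * (Fintype.card V : ℤ) ^ 2 := by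
  have e1 : ∑ x, ∑ y, ∑ z, fdfCode (pcode E x y) (pcode E x z) (pcode E y z)
      = ((Finset.univ.filter fun t : V × V × V => FDFedge E t.1 t.2.1 t.2.2).card : ℤ) := by
    rw [Finset.card_filter]
    push_cast
    rw [Fintype.sum_prod_type]
    refine Finset.sum_congr rfl fun x _ => ?_
    rw [Fintype.sum_prod_type]
    refine Finset.sum_congr rfl fun y _ => Finset.sum_congr rfl fun z _ => ?_
    exact fdfCode_eq E hO x y z
  rw [e1]
  set A := Finset.univ.filter fun t : V × V × V => FDFedge E t.1 t.2.1 t.2.2 with hA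
  set B := A.filter fun t => t.1 ≠ t.2.1 ∧ t.1 ≠ t.2.2 ∧ t.2.1 ≠ t.2.2 with hB
  have hAB : A ⊆ B ∪ (((Finset.univ : Finset (V × V)).image fun p => (p.1, p.1, p.2)) ∪
      ((Finset.univ : Finset (V × V)).image fun p => (p.1, p.2, p.1)) ∪
      ((Finset.univ : Finset (V × V)).image fun p => (p.1, p.2, p.2))) := by
    rintro ⟨x, y, z⟩ ht
    by_cases h1 : x = y
    · subst h1; simp
    by_cases h2 : x = z
    · subst h2; simp
    by_cases h3 : y = z
    · subst h3; simp
    · simp [hB, ht, h1, h2, h3]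
  have c1 : ∀ f : V × V → V × V × V, ((Finset.univ : Finset (V × V)).image f).card
      ≤ Fintype.card V ^ 2 := by
    intro f
    refine Finset.card_image_le.trans ?_
    simp [sq]
  have hBc : B.card ≤ 6 * fdfCount V E := by
    unfold fdfCount
    refine Finset.card_le_mul_card_image_of_maps_to
      (f := fun t : V × V × V => ({t.1, t.2.1, t.2.2} : Finset V)) ?_ 6 ?_
    · rintro ⟨x, y, z⟩ ht
      simp only [hB, hA, Finset.mem_filter, Finset.mem_univ, true_and] at ht
      obtain ⟨h, h1, h2, h3⟩ := ht
      simp only [Finset.mem_filter, Finset.mem_powersetCard, Finset.subset_univ, true_and]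
      exact ⟨Finset.card_eq_three.mpr ⟨x, y, z, h1, h2, h3, rfl⟩, x, y, z, h1, h2, h3, rfl, h⟩
    · intro s hs
      simp only [Finset.mem_filter] at hs
      obtain ⟨-, u, v, w, -, -, -, rfl, -⟩ := hs
      refine (Finset.card_le_card (t := {(u, v, w), (u, w, v), (v, u, w), (v, w, u), (w, u, v),
        (w, v, u)}) ?_).trans Finset.card_le_six
      rintro ⟨x, y, z⟩ ht
      simp only [hB, hA, Finset.mem_filter, Finset.mem_univ, true_and] at ht
      obtain ⟨⟨-, h1, h2, h3⟩, hs⟩ := ht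
      have hx : x ∈ ({u, v, w} : Finset V) := by rw [← hs]; simp
      have hy : y ∈ ({u, v, w} : Finset V) := by rw [← hs]; simp
      have hz : z ∈ ({u, v, w} : Finset V) := by rw [← hs]; simp
      simp only [Finset.mem_insert, Finset.mem_singleton] at hx hy hz
      simp only [Finset.mem_insert, Finset.mem_singleton, Prod.mk.injEq]
      rcases hx with rfl | rfl | rfl <;> rcases hy with rfl | rfl | rfl <;>
        rcases hz with rfl | rfl | rfl <;> simp_all
  have h4 := Finset.card_le_card hAB
  have h5 := Finset.card_union_le B (((Finset.univ : Finset (V × V)).image fun p => (p.1, p.1, p.2)) ∪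
      ((Finset.univ : Finset (V × V)).image fun p => (p.1, p.2, p.1)) ∪
      ((Finset.univ : Finset (V × V)).image fun p => (p.1, p.2, p.2)))
  have h6 := Finset.card_union_le (((Finset.univ : Finset (V × V)).image fun p => (p.1, p.1, p.2)) ∪
      ((Finset.univ : Finset (V × V)).image fun p => (p.1, p.2, p.1)))
      ((Finset.univ : Finset (V × V)).image fun p => (p.1, p.2, p.2))
  have h7 := Finset.card_union_le ((Finset.univ : Finset (V × V)).image fun p => (p.1, p.1, p.2))
      ((Finset.univ : Finset (V × V)).image fun p => (p.1, p.2, p.1))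
  have c2 := c1 fun p => (p.1, p.1, p.2)
  have c3 := c1 fun p => (p.1, p.2, p.1)
  have c4 := c1 fun p => (p.1, p.2, p.2)
  have : A.card ≤ 6 * fdfCount V E + 3 * Fintype.card V ^ 2 := by omega
  exact_mod_cast this

/-- Every C⃗₄-free orgraph on n ≥ N vertices has at least (7/16 − ε)·C(n,3)
edges in FDF(Γ). -/
theorem stmt2 :
    ∀ ε : ℝ, ε > 0 → ∃ N : ℕ, ∀ n : ℕ, N ≤ n → ∀ E : Fin n → Fin n → Prop,
      IsOrgraph E → ¬ HasInducedC4 E →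
      ((7 : ℝ) / 16 - ε) * (n.choose 3 : ℝ) ≤ (fdfCount (Fin n) E : ℝ) := by
  intro ε hε
  refine ⟨⌈3 / ε⌉₊ + 1, fun n hn E hO hC => ?_⟩
  have h1 := ordered_count E hO hC
  have h2 := ordered_le (Fin n) E hO
  simp only [Fintype.card_fin] at h1 h2
  have hn0 : (0 : ℤ) < n := by exact_mod_cast (by omega : 0 < n)
  have h3 : 7 * (n : ℤ) ^ 3 ≤ 16 * (6 * (fdfCount (Fin n) E : ℤ) + 3 * (n : ℤ) ^ 2) := by
    have : (n : ℤ) * (7 * (n : ℤ) ^ 3)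
        ≤ n * (16 * (6 * (fdfCount (Fin n) E : ℤ) + 3 * (n : ℤ) ^ 2)) := by
      calc (n : ℤ) * (7 * (n : ℤ) ^ 3) = 7 * (n : ℤ) ^ 4 := by ring
        _ ≤ _ := h1
        _ ≤ _ := by nlinarith [mul_le_mul_of_nonneg_left h2 hn0.le]
    exact le_of_mul_le_mul_left this hn0
  have h3' : 7 * (n : ℝ) ^ 3 ≤ 16 * (6 * (fdfCount (Fin n) E : ℝ) + 3 * (n : ℝ) ^ 2) := by
    exact_mod_cast h3
  have hnε : 3 ≤ ε * n := by
    have a : 3 / ε ≤ n := (Nat.le_ceil _).trans (by exact_mod_cast (by omega : ⌈3 / ε⌉₊ ≤ n))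
    rw [div_le_iff₀ hε] at a
    linarith
  have hch : (n.choose 3 : ℝ) ≤ (n : ℝ) ^ 3 / 6 := by
    have := Nat.choose_le_pow_div (α := ℝ) 3 n
    simpa [Nat.factorial] using this
  rcases le_or_gt ((7 : ℝ) / 16 - ε) 0 with h | h
  · exact (mul_nonpos_of_nonpos_of_nonneg h (Nat.cast_nonneg _)).trans (Nat.cast_nonneg _)
  · have a1 := mul_le_mul_of_nonneg_left hch h.le
    have a2 := mul_le_mul_of_nonneg_right hnε (sq_nonneg (n : ℝ))
    nlinarith
end
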